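/- arXiv:1806.09823 — 7 statements merged into one kernel-verified Lean document; each statement's English description precedes it below -/
import Mathlib

section
/- There is a universal constant C > 0 such that the following holds. Fix dimensions d ≥ 1 and k with 1 ≤ k < d. Let Q be a random orthogonal d×d matrix distributed according to the Haar probability measure on the orthogonal group O(d), and define f_Q : ℝ^d → ℝ^k by f_Q(x) = √(d/k) · (the first k coordinates of Qx). Then for every ε ∈ (0,1/2) and every pair of distinct points x, y ∈ ℝ^d, the probability (over Q) that ‖f_Q(x) − f_Q(y)‖₂ / ‖x − y‖₂ lies in the open interval (1−ε, 1+ε) is at least 1 − e^{−Cε²k}. -/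
open MeasureTheory Set

noncomputable instance orthogonalGroup.measurableSpace (d : ℕ) :
    MeasurableSpace (Matrix.orthogonalGroup (Fin d) ℝ) := borel _

open scoped ENNReal

/-- The standard Gaussian measure on `ι → ℝ`, normalised to have density `exp (-π ∑ vᵢ²)`. -/
noncomputable def gaussPi (ι : Type*) [Fintype ι] : Measure (ι → ℝ) :=
  volume.withDensity fun v => ENNReal.ofReal (Real.exp (-(Real.pi * ∑ i, v i ^ 2)))

section Gaussian

variable {ι : Type*} [Fintype ι]

lemma measurable_gaussDensity :
    Measurable fun v : ι → ℝ => ENNReal.ofReal (Real.exp (-(Real.pi * ∑ i, v i ^ 2))) := by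
  fun_prop

lemma lintegral_gaussPi {f : (ι → ℝ) → ℝ≥0∞} (hf : Measurable f) :
    ∫⁻ v, f v ∂(gaussPi ι) =
      ∫⁻ v, ENNReal.ofReal (Real.exp (-(Real.pi * ∑ i, v i ^ 2))) * f v := by
  rw [gaussPi, lintegral_withDensity_eq_lintegral_mul _ measurable_gaussDensity hf]
  rfl

lemma lintegral_exp_neg_sum_mul_sq {b : ι → ℝ} (hb : ∀ i, 0 < b i) :
    ∫⁻ v : ι → ℝ, ENNReal.ofReal (Real.exp (-∑ i, b i * v i ^ 2)) =
      ENNReal.ofReal (∏ i, √(Real.pi / b i)) := by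
  have h : ∀ v : ι → ℝ, Real.exp (-∑ i, b i * v i ^ 2) = ∏ i, Real.exp (-b i * v i ^ 2) := by
    intro v
    rw [← Real.exp_sum]
    simp [Finset.sum_neg_distrib]
  simp_rw [h]
  rw [← ofReal_integral_eq_lintegral_ofReal, integral_fintype_prod_volume_eq_prod
    (fun i x => Real.exp (-b i * x ^ 2))]
  · simp_rw [integral_gaussian]
  · exact Integrable.fintype_prod fun i => integrable_exp_neg_mul_sq (hb i)
  · exact Filter.Eventually.of_forall fun v => Finset.prod_nonneg fun i _ => (Real.exp_pos _).le

instance : IsProbabilityMeasure (gaussPi ι) := by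
  constructor
  have := lintegral_exp_neg_sum_mul_sq (ι := ι) (b := fun _ => Real.pi) fun _ => Real.pi_pos
  rw [gaussPi, withDensity_apply _ MeasurableSet.univ]
  simpa [Finset.mul_sum, Real.pi_ne_zero] using this

lemma gaussPi_hyperplane (i : ι) : gaussPi ι {v | v i = 0} = 0 := by
  apply withDensity_absolutelyContinuous
  exact Measure.pi_hyperplane (fun _ : ι => (volume : Measure ℝ)) i 0

/-- Chernoff bound for linear combinations of two complementary squared norms. -/
lemma gaussPi_le_of_linear_le [DecidableEq ι] (I : Finset ι) {a b c : ℝ} (ha : a < 1) (hb : b < 1)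
    {E : Set (ι → ℝ)}
    (hE : ∀ v ∈ E, c ≤ a * ∑ i ∈ I, v i ^ 2 + b * ∑ i ∈ Iᶜ, v i ^ 2) :
    gaussPi ι E ≤ ENNReal.ofReal (Real.exp (-Real.pi * c - I.card / 2 * Real.log (1 - a)
      - Iᶜ.card / 2 * Real.log (1 - b))) := by
  set w : ι → ℝ := fun i => if i ∈ I then 1 - a else 1 - b with hw
  have hwpos : ∀ i, 0 < w i := by
    intro i; simp only [hw]; split_ifs <;> linarith
  have hsum : ∀ v : ι → ℝ, ∑ i, w i * v i ^ 2 =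
      (1 - a) * ∑ i ∈ I, v i ^ 2 + (1 - b) * ∑ i ∈ Iᶜ, v i ^ 2 := by
    intro v
    rw [← Finset.sum_add_sum_compl I, Finset.mul_sum, Finset.mul_sum]
    congr 1
    · exact Finset.sum_congr rfl fun i hi => by simp [hw, hi]
    · exact Finset.sum_congr rfl fun i hi => by simp [hw, Finset.mem_compl.1 hi]
  have hprod : ∏ i, √(Real.pi / (Real.pi * w i)) =
      Real.exp (- I.card / 2 * Real.log (1 - a) - Iᶜ.card / 2 * Real.log (1 - b)) := by
    have h1 : ∀ i, √(Real.pi / (Real.pi * w i)) = Real.exp (-(1/2) * Real.log (w i)) := by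
      intro i
      have : Real.pi / (Real.pi * w i) = Real.exp (- Real.log (w i)) := by
        rw [Real.exp_neg, Real.exp_log (hwpos i)]
        field_simp [Real.pi_ne_zero]
      rw [this, ← Real.exp_half]
      congr 1; ring
    simp_rw [h1]
    rw [← Real.exp_sum, ← Finset.sum_add_sum_compl I]
    congr 1
    rw [Finset.sum_congr rfl (g := fun _ => -(1/2) * Real.log (1 - a))
      (fun i hi => by simp [hw, hi]),
      Finset.sum_congr (s₁ := Iᶜ) rfl (g := fun _ => -(1/2) * Real.log (1 - b))
      (fun i hi => by simp [hw, Finset.mem_compl.1 hi])]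
    simp only [Finset.sum_const, nsmul_eq_mul]
    ring
  calc gaussPi ι E
      ≤ gaussPi ι {v | c ≤ a * ∑ i ∈ I, v i ^ 2 + b * ∑ i ∈ Iᶜ, v i ^ 2} := measure_mono hE
    _ ≤ ∫⁻ v : ι → ℝ, ENNReal.ofReal (Real.exp (-(Real.pi * c)))
          * ENNReal.ofReal (Real.exp (-∑ i, (Real.pi * w i) * v i ^ 2)) := by
        have hT : MeasurableSet {v : ι → ℝ | c ≤ a * ∑ i ∈ I, v i ^ 2 + b * ∑ i ∈ Iᶜ, v i ^ 2} :=
          measurableSet_le (by fun_prop) (by fun_prop)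
        rw [gaussPi, withDensity_apply _ hT]
        refine (setLIntegral_mono' hT fun v hv => ?_).trans (setLIntegral_le_lintegral _ _)
        rw [← ENNReal.ofReal_mul (Real.exp_pos _).le, ← Real.exp_add]
        refine ENNReal.ofReal_le_ofReal (Real.exp_le_exp.2 ?_)
        simp_rw [mul_assoc]
        rw [← Finset.mul_sum, hsum, ← Finset.sum_add_sum_compl I]
        have := mul_le_mul_of_nonneg_left (show _ ≤ _ from hv) Real.pi_pos.le
        linarith
    _ = _ := by
        rw [lintegral_const_mul _ (by fun_prop), lintegral_exp_neg_sum_mul_sq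
          (fun i => mul_pos Real.pi_pos (hwpos i)), hprod, ← ENNReal.ofReal_mul (Real.exp_pos _).le,
          ← Real.exp_add]
        congr 2; ring

/-- Change of variables under an invertible matrix. -/
lemma lintegral_comp_mulVec [DecidableEq ι] {M : Matrix ι ι ℝ} (hM : M.det ≠ 0)
    {f : (ι → ℝ) → ℝ≥0∞} (hf : Measurable f) :
    ∫⁻ v, f v = ENNReal.ofReal |M.det| * ∫⁻ v, f (M.mulVec v) := by
  have h := Real.map_matrix_volume_pi_eq_smul_volume_pi hM
  have h2 : ∫⁻ v, f (M.mulVec v) = ENNReal.ofReal |M.det⁻¹| * ∫⁻ v, f v := by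
    have := lintegral_map (μ := volume) hf
      (g := Matrix.toLin' M) (LinearMap.continuous_of_finiteDimensional _).measurable
    rw [h, lintegral_smul_measure] at this
    simpa using this.symm
  rw [h2, ← mul_assoc, ← ENNReal.ofReal_mul (abs_nonneg _), ← abs_mul, mul_inv_cancel₀ hM]
  simp

lemma sum_mulVec_sq_of_orthogonal [DecidableEq ι] (Q : Matrix.orthogonalGroup ι ℝ) (v : ι → ℝ) :
    ∑ i, (Q : Matrix ι ι ℝ).mulVec v i ^ 2 = ∑ i, v i ^ 2 := by
  have h : ∀ u : ι → ℝ, ∑ i, u i ^ 2 = u ⬝ᵥ u := fun u => by simp [dotProduct, sq]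
  rw [h, h, Matrix.dotProduct_mulVec, Matrix.vecMul_mulVec]
  have : (Q : Matrix ι ι ℝ).transpose * Q = 1 := by
    simpa [Matrix.star_eq_conjTranspose] using (Matrix.mem_orthogonalGroup_iff' _ _).1 Q.2
  rw [this, Matrix.vecMul_one]

lemma gaussPi_preimage_orthogonal [DecidableEq ι] (Q : Matrix.orthogonalGroup ι ℝ)
    {E : Set (ι → ℝ)} (hE : MeasurableSet E) :
    gaussPi ι {v | (Q : Matrix ι ι ℝ).mulVec v ∈ E} = gaussPi ι E := by
  have hdet : |(Q : Matrix ι ι ℝ).det| = 1 := by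
    have : (Q : Matrix ι ι ℝ).transpose * Q = 1 := by
      simpa [Matrix.star_eq_conjTranspose] using (Matrix.mem_orthogonalGroup_iff' _ _).1 Q.2
    have := congrArg Matrix.det this
    rw [Matrix.det_mul, Matrix.det_transpose, Matrix.det_one] at this
    rw [← abs_one, ← sq_eq_sq_iff_abs_eq_abs]; linarith
  have hd0 : (Q : Matrix ι ι ℝ).det ≠ 0 := by
    intro h; simp [h] at hdet
  have hmeas : Measurable fun v : ι → ℝ => (Q : Matrix ι ι ℝ).mulVec v :=
    (Continuous.matrix_mulVec continuous_const continuous_id).measurable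
  have hE' : MeasurableSet {v | (Q : Matrix ι ι ℝ).mulVec v ∈ E} := hmeas hE
  rw [← lintegral_indicator_one hE, ← lintegral_indicator_one hE',
    lintegral_gaussPi (measurable_one.indicator hE),
    lintegral_gaussPi (measurable_one.indicator hE'),
    lintegral_comp_mulVec hd0 (f := fun v => ENNReal.ofReal (Real.exp (-(Real.pi * ∑ i, v i ^ 2)))
      * E.indicator 1 v) (measurable_gaussDensity.mul (measurable_one.indicator hE)), hdet]
  simp only [ENNReal.ofReal_one, one_mul, sum_mulVec_sq_of_orthogonal]
  rfl


lemma gaussPi_sum_sq_tail [DecidableEq ι] (I : Finset ι) {b : ℝ} (hb : 0 < b) {E : Set (ι → ℝ)}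
    (hE : ∀ v ∈ E, 0 ≤ (b - 1) * (2 * Real.pi * ∑ i ∈ I, v i ^ 2 - I.card * b)) :
    gaussPi ι E ≤ ENNReal.ofReal (Real.exp (I.card / 2 * (1 - b + Real.log b))) := by
  refine (gaussPi_le_of_linear_le I (a := 1 - 1 / b) (b := 0) (c := (b - 1) * I.card / (2 * Real.pi))
    (by linarith [one_div_pos.2 hb]) one_pos fun v hv => ?_).trans (le_of_eq ?_)
  · have h := hE v hv
    have hpi := Real.pi_pos
    rw [div_le_iff₀ (by positivity)]
    have : (1 - 1 / b) * (∑ i ∈ I, v i ^ 2) * (2 * Real.pi) - (b - 1) * I.card =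
        1 / b * ((b - 1) * (2 * Real.pi * ∑ i ∈ I, v i ^ 2 - I.card * b)) := by
      field_simp
    have h2 := mul_nonneg (one_div_pos.2 hb).le h
    linarith
  · congr 2
    have : (1 : ℝ) - (1 - 1 / b) = b⁻¹ := by ring_nf
    rw [this, Real.log_inv]
    simp only [sub_zero, Real.log_one, mul_zero]
    field_simp [Real.pi_ne_zero]
    ring

lemma ratio_tail_identity {b k m q A B : ℝ} (hb : b ≠ 0) (hq : q ≠ 0) (hqe : k + m - k * b = q) :
    (1 - 1 / b) * A + (1 - m / q) * B =
      1 / (b * q) * ((b - 1) * ((k + m) * A - k * b * (A + B))) := by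
  obtain rfl : m = q - k + k * b := by linarith
  field_simp
  ring

lemma gaussPi_ratio_tail [DecidableEq ι] (I : Finset ι) (hI : Iᶜ.Nonempty) {b : ℝ} (hb : 0 < b)
    {E : Set (ι → ℝ)}
    (hE : ∀ v ∈ E, 0 ≤ (b - 1) * (((I.card : ℝ) + Iᶜ.card) * ∑ i ∈ I, v i ^ 2
      - I.card * b * ∑ i, v i ^ 2)) :
    gaussPi ι E ≤ ENNReal.ofReal (Real.exp (I.card / 2 * (1 - b + Real.log b))) := by
  have hm : (0 : ℝ) < Iᶜ.card := by exact_mod_cast hI.card_pos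
  have hk : (0 : ℝ) ≤ I.card := by positivity
  set k : ℝ := (I.card : ℝ)
  set m : ℝ := (Iᶜ.card : ℝ)
  simp_rw [← Finset.sum_add_sum_compl I] at hE
  rcases lt_or_ge (k * b) (k + m) with hlt | hge
  · have hq : 0 < k + m - k * b := by linarith
    refine (gaussPi_le_of_linear_le I (a := 1 - 1 / b) (b := 1 - m / (k + m - k * b)) (c := 0)
      (by linarith [one_div_pos.2 hb]) (by linarith [div_pos hm hq]) fun v hv => ?_).trans
      (ENNReal.ofReal_le_ofReal (Real.exp_le_exp.2 ?_))
    · have h := hE v hv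
      have : (1 - 1 / b) * (∑ i ∈ I, v i ^ 2) + (1 - m / (k + m - k * b)) * ∑ i ∈ Iᶜ, v i ^ 2 =
        1 / (b * (k + m - k * b)) * ((b - 1) * ((k + m) * ∑ i ∈ I, v i ^ 2
          - k * b * (∑ i ∈ I, v i ^ 2 + ∑ i ∈ Iᶜ, v i ^ 2))) := by
        exact ratio_tail_identity hb.ne' hq.ne' rfl
      rw [this]
      positivity
    · have e1 : (1 : ℝ) - (1 - 1 / b) = b⁻¹ := by ring_nf
      have e2 : 1 - (1 - m / (k + m - k * b)) = ((k + m - k * b) / m)⁻¹ := by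
        rw [inv_div]; ring
      rw [e1, e2, Real.log_inv, Real.log_inv]
      have h1 := Real.log_le_sub_one_of_pos (div_pos hq hm)
      have h2 := mul_le_mul_of_nonneg_left h1 (by positivity : (0 : ℝ) ≤ m / 2)
      have h3 : m / 2 * ((k + m - k * b) / m - 1) = k / 2 * (1 - b) := by
        field_simp; ring
      change _ - k / 2 * _ - m / 2 * _ ≤ k / 2 * _
      linarith
  · have hb1 : 1 < b := by
      by_contra! h
      nlinarith
    obtain ⟨j, hj⟩ := hI
    refine (measure_mono_null (t := {v | v j = 0}) (fun v hv => ?_) (gaussPi_hyperplane j)).le.trans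
      zero_le
    have h := nonneg_of_mul_nonneg_right (hE v hv) (by linarith)
    have hA : 0 ≤ ∑ i ∈ I, v i ^ 2 := Finset.sum_nonneg fun i _ => sq_nonneg _
    have hB : v j ^ 2 ≤ ∑ i ∈ Iᶜ, v i ^ 2 :=
      Finset.single_le_sum (f := fun i => v i ^ 2) (fun i _ => sq_nonneg _) hj
    have : v j ^ 2 ≤ 0 := by
      by_contra! h0
      have : 0 < k * b := by linarith
      nlinarith
    exact pow_eq_zero_iff two_ne_zero |>.1 (le_antisymm this (sq_nonneg _))

lemma one_sub_exp_add_self_le_of_nonneg {z : ℝ} (hz : 0 ≤ z) : 1 - Real.exp z + z ≤ -(z ^ 2 / 2) := by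
  linarith [Real.quadratic_le_exp_of_nonneg hz]

lemma one_sub_exp_neg_sub_le {z : ℝ} (hz : z ≤ 2) :
    1 - Real.exp (-z) - z ≤ -(z ^ 2 / 4) := by
  have h1 : 1 - z / 2 ≤ Real.exp (-(z / 2)) := Real.one_sub_le_exp_neg _
  have h2 : Real.exp (-z) = Real.exp (-(z / 2)) ^ 2 := by
    rw [← Real.exp_nat_mul]; congr 1; push_cast; ring
  have := pow_le_pow_left₀ (by linarith) h1 2
  nlinarith

lemma exp_sub_one_sub_self_le (y : ℝ) : Real.exp y - 1 - y ≤ y ^ 2 * Real.exp |y| := by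
  have h1 : Real.exp y - 1 ≤ y * Real.exp y := by
    have := Real.add_one_le_exp (-y)
    have h2 := mul_le_mul_of_nonneg_right this (Real.exp_pos y).le
    rw [← Real.exp_add] at h2
    simp at h2
    linarith
  rcases le_total 0 y with hy | hy
  · rw [abs_of_nonneg hy]
    nlinarith
  · have h3 : 1 ≤ Real.exp |y| := Real.one_le_exp (abs_nonneg y)
    have h4 := Real.add_one_le_exp y
    have h5 : y ^ 2 ≤ y ^ 2 * Real.exp |y| := le_mul_of_one_le_right (sq_nonneg _) h3
    nlinarith

/-- Off an event of probability at most `1 / 4`, the squared norm of the coordinates in `I` is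
within a factor `exp (16 / √(#I))` of its mean. -/
lemma gaussPi_log_sum_sq_tail [DecidableEq ι] (I : Finset ι) (hI : I.Nonempty) :
    gaussPi ι {v | ¬ (I.card * Real.exp (-(16 / √I.card)) < 2 * Real.pi * ∑ i ∈ I, v i ^ 2 ∧
      2 * Real.pi * ∑ i ∈ I, v i ^ 2 < I.card * Real.exp (16 / √I.card))} ≤
      ENNReal.ofReal (1 / 4) := by
  have hk : (1 : ℝ) ≤ I.card := by exact_mod_cast hI.card_pos
  have hs : 1 ≤ √(I.card : ℝ) := Real.one_le_sqrt.2 hk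
  have hsq : √(I.card : ℝ) ^ 2 = I.card := Real.sq_sqrt (by linarith)
  set s := √(I.card : ℝ)
  set z := 16 / s with hz
  have hz0 : 0 < z := by positivity
  have hzs : z * s = 16 := by rw [hz]; field_simp
  have hexp4 : Real.exp (-4) ≤ 1 / 8 := by
    have := Real.quadratic_le_exp_of_nonneg (x := 4) (by norm_num)
    rw [Real.exp_neg, one_div]
    exact inv_anti₀ (by norm_num) (by linarith)
  have bound : ∀ y : ℝ, s ^ 2 / 2 * (1 - Real.exp y + y) ≤ -4 →
      ENNReal.ofReal (Real.exp (I.card / 2 * (1 - Real.exp y + Real.log (Real.exp y)))) ≤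
        ENNReal.ofReal (1 / 8) := by
    intro y hy
    refine ENNReal.ofReal_le_ofReal (le_trans (Real.exp_le_exp.2 ?_) hexp4)
    rwa [Real.log_exp, ← hsq]
  have h1 : gaussPi ι {v | I.card * Real.exp z ≤ 2 * Real.pi * ∑ i ∈ I, v i ^ 2} ≤
      ENNReal.ofReal (1 / 8) := by
    refine (gaussPi_sum_sq_tail I (Real.exp_pos z) fun v hv => ?_).trans (bound z ?_)
    · exact mul_nonneg (by linarith [Real.one_le_exp hz0.le]) (sub_nonneg.2 hv)
    · have := mul_le_mul_of_nonneg_left (one_sub_exp_add_self_le_of_nonneg hz0.le)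
        (by positivity : 0 ≤ s ^ 2 / 2)
      have h3 : s ^ 2 / 2 * -(z ^ 2 / 2) = -(z * s) ^ 2 / 4 := by ring
      rw [h3, hzs] at this
      linarith
  have h2 : gaussPi ι {v | 2 * Real.pi * ∑ i ∈ I, v i ^ 2 ≤ I.card * Real.exp (-z)} ≤
      ENNReal.ofReal (1 / 8) := by
    refine (gaussPi_sum_sq_tail I (Real.exp_pos (-z)) fun v hv => ?_).trans (bound (-z) ?_)
    · have := Real.exp_le_one_iff.2 (neg_nonpos.2 hz0.le)
      exact mul_nonneg_of_nonpos_of_nonpos (by linarith) (sub_nonpos.2 hv)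
    · rcases le_total z 2 with hz2 | hz2
      · have := mul_le_mul_of_nonneg_left (one_sub_exp_neg_sub_le hz2)
          (by positivity : 0 ≤ s ^ 2 / 2)
        have h3 : s ^ 2 / 2 * -(z ^ 2 / 4) = -(z * s) ^ 2 / 8 := by ring
        rw [h3, hzs] at this
        linarith
      · have h4 : 1 - Real.exp (-z) + -z ≤ -(z / 2) := by linarith [Real.exp_pos (-z)]
        have := mul_le_mul_of_nonneg_left h4 (by positivity : 0 ≤ s ^ 2 / 2)
        have h3 : s ^ 2 / 2 * -(z / 2) = -(z * s) * s / 4 := by ring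
        rw [h3, hzs] at this
        linarith
  calc _ ≤ gaussPi ι ({v | I.card * Real.exp z ≤ 2 * Real.pi * ∑ i ∈ I, v i ^ 2} ∪
        {v | 2 * Real.pi * ∑ i ∈ I, v i ^ 2 ≤ I.card * Real.exp (-z)}) := by
        refine measure_mono fun v hv => ?_
        by_contra h
        simp only [mem_union, not_or] at h
        exact hv ⟨not_le.1 h.2, not_le.1 h.1⟩
    _ ≤ _ := measure_union_le _ _
    _ ≤ _ := add_le_add h1 h2
    _ = _ := by rw [← ENNReal.ofReal_add (by norm_num) (by norm_num)]; norm_num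

/-- The density of the logarithm of a chi-squared variable varies by at most a constant factor
over a range of a constant number of standard deviations. -/
lemma half_mul_sub_pi_mul_le {k a s : ℝ} (hk : 1 ≤ k) (ha1 : k * Real.exp (-(16 / √k)) < 2 * Real.pi * a)
    (ha2 : 2 * Real.pi * a < k * Real.exp (16 / √k)) (hs : |s| ≤ 33 / √k) :
    k * (s / 2) - Real.pi * a + Real.pi * (Real.exp (-s) * a) ≤ 2401 / 2 * Real.exp 49 := by
  have hk0 : 0 < k := by linarith
  have hr : 1 ≤ √k := Real.one_le_sqrt.2 hk
  have hsq : √k ^ 2 = k := Real.sq_sqrt hk0.le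
  have hapos : 0 < 2 * Real.pi * a := lt_trans (by positivity) ha1
  set h := Real.log (2 * Real.pi * a / k) with hh
  have hexp : Real.exp h = 2 * Real.pi * a / k := Real.exp_log (div_pos hapos hk0)
  have hpa : Real.pi * a = k / 2 * Real.exp h := by rw [hexp]; field_simp
  have h1 : -(16 / √k) < h := by
    rw [← Real.exp_lt_exp, hexp, lt_div_iff₀ hk0]; linarith
  have h2 : h < 16 / √k := by
    rw [← Real.exp_lt_exp, hexp, div_lt_iff₀ hk0]; linarith
  have hy : |h - s| ≤ 49 / √k := by
    have e : 49 / √k = 16 / √k + 33 / √k := by ring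
    rw [e]
    exact (abs_sub _ _).trans (add_le_add (abs_le.2 ⟨h1.le, h2.le⟩) hs)
  have hy49 : |h - s| ≤ 49 := hy.trans (div_le_self (by norm_num) hr)
  have e1 : k * (s / 2) - Real.pi * a + Real.pi * (Real.exp (-s) * a) =
      k / 2 * ((Real.exp (h - s) - 1 - (h - s)) - (Real.exp h - 1 - h)) := by
    rw [show Real.pi * (Real.exp (-s) * a) = Real.exp (-s) * (Real.pi * a) by ring, hpa,
      sub_eq_add_neg h s, Real.exp_add]
    ring
  have e2 : 0 ≤ Real.exp h - 1 - h := by linarith [Real.add_one_le_exp h]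
  have e3 : (h - s) ^ 2 ≤ 2401 / k := by
    have := pow_le_pow_left₀ (abs_nonneg _) hy 2
    rw [sq_abs, div_pow, hsq] at this
    linarith
  calc _ = _ := e1
    _ ≤ k / 2 * (2401 / k * Real.exp 49) := by
      refine mul_le_mul_of_nonneg_left ?_ (by positivity)
      have := exp_sub_one_sub_self_le (h - s)
      have h5 : (h - s) ^ 2 * Real.exp |h - s| ≤ 2401 / k * Real.exp 49 :=
        mul_le_mul e3 (Real.exp_le_exp.2 hy49) (Real.exp_pos _).le (by positivity)
      linarith
    _ = _ := by field_simp

lemma gaussPi_log_ratio_shift [DecidableEq ι] (I : Finset ι) (hI : I.Nonempty) {s : ℝ} (δ : ℝ)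
    (hs : |s| ≤ 33 / √I.card) {p q : ℝ} :
    gaussPi ι {v | (Real.exp (s - δ) * (q * ∑ i ∈ Iᶜ, v i ^ 2) < p * ∑ i ∈ I, v i ^ 2 ∧
        p * ∑ i ∈ I, v i ^ 2 < Real.exp (s + δ) * (q * ∑ i ∈ Iᶜ, v i ^ 2)) ∧
      (I.card * Real.exp (-(16 / √I.card)) < 2 * Real.pi * ∑ i ∈ I, v i ^ 2 ∧
      2 * Real.pi * ∑ i ∈ I, v i ^ 2 < I.card * Real.exp (16 / √I.card))} ≤
    ENNReal.ofReal (Real.exp (2401 / 2 * Real.exp 49)) *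
      gaussPi ι {v | Real.exp (-δ) * (q * ∑ i ∈ Iᶜ, v i ^ 2) < p * ∑ i ∈ I, v i ^ 2 ∧
        p * ∑ i ∈ I, v i ^ 2 < Real.exp δ * (q * ∑ i ∈ Iᶜ, v i ^ 2)} := by
  have hk : (1 : ℝ) ≤ I.card := by exact_mod_cast hI.card_pos
  set S : Set (ι → ℝ) := {v | (_ ∧ _) ∧ _} with hS
  set T : Set (ι → ℝ) := {v | Real.exp (-δ) * _ < _ ∧ _} with hT
  have mS : MeasurableSet S := by
    simp only [hS, ofPred_and]
    refine MeasurableSet.inter (MeasurableSet.inter ?_ ?_) (MeasurableSet.inter ?_ ?_) <;>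
      exact measurableSet_lt (by fun_prop) (by fun_prop)
  have mT : MeasurableSet T := by
    simp only [hT, ofPred_and]
    refine MeasurableSet.inter ?_ ?_ <;> exact measurableSet_lt (by fun_prop) (by fun_prop)
  set D : ι → ℝ := fun i => if i ∈ I then Real.exp (s / 2) else 1 with hD
  have hdet : (Matrix.diagonal D).det = Real.exp (I.card * (s / 2)) := by
    rw [Matrix.det_diagonal, hD, Finset.prod_ite_mem, Finset.univ_inter, Finset.prod_const,
      ← Real.exp_nat_mul]
  have hA : ∀ v : ι → ℝ, ∑ i ∈ I, (Matrix.diagonal D).mulVec v i ^ 2 =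
      Real.exp s * ∑ i ∈ I, v i ^ 2 := by
    intro v
    rw [Finset.mul_sum]
    refine Finset.sum_congr rfl fun i hi => ?_
    rw [Matrix.mulVec_diagonal, mul_pow]
    simp only [hD, hi, if_true]
    rw [← Real.exp_nat_mul]; congr 2; push_cast; ring
  have hB : ∀ v : ι → ℝ, ∑ i ∈ Iᶜ, (Matrix.diagonal D).mulVec v i ^ 2 = ∑ i ∈ Iᶜ, v i ^ 2 := by
    intro v
    refine Finset.sum_congr rfl fun i hi => ?_
    rw [Matrix.mulVec_diagonal]
    simp [hD, Finset.mem_compl.1 hi]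
  rw [← lintegral_indicator_one mS, ← lintegral_indicator_one mT,
    lintegral_gaussPi (measurable_one.indicator mS),
    lintegral_gaussPi (measurable_one.indicator mT),
    lintegral_comp_mulVec (M := Matrix.diagonal D) (by rw [hdet]; exact (Real.exp_pos _).ne')
      (f := fun v => ENNReal.ofReal (Real.exp (-(Real.pi * ∑ i, v i ^ 2))) * S.indicator 1 v)
      (measurable_gaussDensity.mul (measurable_one.indicator mS)), hdet, Real.abs_exp,
    ← lintegral_const_mul' _ _ ENNReal.ofReal_ne_top,
    ← lintegral_const_mul' _ _ ENNReal.ofReal_ne_top]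
  refine lintegral_mono fun v => ?_
  by_cases hv : (Matrix.diagonal D).mulVec v ∈ S
  · have hv' := hv
    simp only [hS, mem_ofPred_eq, hA, hB] at hv'
    obtain ⟨⟨h1, h2⟩, h3, h4⟩ := hv'
    have hvT : v ∈ T := by
      have e1 : Real.exp (s - δ) = Real.exp s * Real.exp (-δ) := by rw [← Real.exp_add]; rfl
      rw [e1] at h1
      rw [Real.exp_add] at h2
      exact ⟨lt_of_mul_lt_mul_left (by linarith) (Real.exp_pos s).le,
        lt_of_mul_lt_mul_left (by linarith) (Real.exp_pos s).le⟩
    rw [indicator_of_mem hv, indicator_of_mem hvT]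
    simp only [Pi.one_apply, mul_one]
    rw [← ENNReal.ofReal_mul (Real.exp_pos _).le, ← ENNReal.ofReal_mul (Real.exp_pos _).le,
      ← Real.exp_add, ← Real.exp_add]
    refine ENNReal.ofReal_le_ofReal (Real.exp_le_exp.2 ?_)
    rw [← Finset.sum_add_sum_compl I, ← Finset.sum_add_sum_compl I, hA, hB]
    have := half_mul_sub_pi_mul_le hk h3 h4 hs
    have e : Real.exp (-s) * (Real.exp s * ∑ i ∈ I, v i ^ 2) = ∑ i ∈ I, v i ^ 2 := by
      rw [← mul_assoc, ← Real.exp_add]; simp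
    rw [e] at this
    linarith
  · rw [indicator_of_notMem hv]
    simp

/-- Anticoncentration of the ratio of the mean squares of two complementary coordinate blocks. -/
lemma le_gaussPi_ratio_near_one [DecidableEq ι] (I : Finset ι) (hI : I.Nonempty)
    (hle : I.card ≤ Iᶜ.card) {δ : ℝ} (hδ : 0 < δ) (hδ1 : δ ≤ 1 / √I.card) :
    ENNReal.ofReal (Real.exp (-(2401 / 2 * Real.exp 49)) / 132 * (√I.card * δ)) ≤
      gaussPi ι {v | Real.exp (-δ) * (I.card * ∑ i ∈ Iᶜ, v i ^ 2) < Iᶜ.card * ∑ i ∈ I, v i ^ 2 ∧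
        Iᶜ.card * ∑ i ∈ I, v i ^ 2 < Real.exp δ * (I.card * ∑ i ∈ Iᶜ, v i ^ 2)} := by
  have hk : (1 : ℝ) ≤ I.card := by exact_mod_cast hI.card_pos
  have hkm : (I.card : ℝ) ≤ Iᶜ.card := by exact_mod_cast hle
  have hI' : Iᶜ.Nonempty := Finset.card_pos.1 (hI.card_pos.trans_le hle)
  have hr : 1 ≤ √(I.card : ℝ) := Real.one_le_sqrt.2 hk
  have hrr : √(I.card : ℝ) ≤ √(Iᶜ.card : ℝ) := Real.sqrt_le_sqrt hkm
  set T : Set (ι → ℝ) := {v | Real.exp (-δ) * _ < _ ∧ _} with hT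
  set K := 2401 / 2 * Real.exp 49 with hK
  let G : Finset ι → Set (ι → ℝ) := fun J => {v | J.card * Real.exp (-(16 / √J.card)) <
    2 * Real.pi * ∑ i ∈ J, v i ^ 2 ∧ 2 * Real.pi * ∑ i ∈ J, v i ^ 2 < J.card * Real.exp (16 / √J.card)}
  let F : ℝ → Set (ι → ℝ) := fun s => {v |
    (Real.exp (s - δ) * (I.card * ∑ i ∈ Iᶜ, v i ^ 2) < Iᶜ.card * ∑ i ∈ I, v i ^ 2 ∧
      Iᶜ.card * ∑ i ∈ I, v i ^ 2 < Real.exp (s + δ) * (I.card * ∑ i ∈ Iᶜ, v i ^ 2)) ∧ v ∈ G I}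
  set N : ℤ := ⌊32 / √(I.card : ℝ) / δ⌋ with hN
  have hN0 : 0 ≤ N := Int.floor_nonneg.2 (by positivity)
  have hNle : (N : ℝ) ≤ 32 / √(I.card : ℝ) / δ := Int.floor_le _
  have hNδ : (N : ℝ) * δ ≤ 32 / √(I.card : ℝ) := by rwa [le_div_iff₀ hδ] at hNle
  have hcover : G I ∩ G Iᶜ ⊆ ⋃ j ∈ Finset.Icc (-N - 1) N, F (j * δ) := by
    rintro v ⟨hv, hv'⟩
    obtain ⟨h1, h2⟩ := hv
    obtain ⟨h3, h4⟩ := id hv'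
    set A := ∑ i ∈ I, v i ^ 2 with hA
    set B := ∑ i ∈ Iᶜ, v i ^ 2 with hB
    have hpi := Real.pi_pos
    have hA0 : 0 < A := by
      have := lt_trans (by positivity) h1
      exact pos_of_mul_pos_right this (by positivity)
    have hB0 : 0 < B := by
      have := lt_trans (by positivity) h3
      exact pos_of_mul_pos_right this (by positivity)
    have hm0 : (0 : ℝ) < Iᶜ.card := by linarith
    have hk0 : (0 : ℝ) < I.card := by linarith
    set t := Real.log (Iᶜ.card * A / (I.card * B)) with ht
    have ht' : t = Real.log (2 * Real.pi * A / I.card) - Real.log (2 * Real.pi * B / Iᶜ.card) := by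
      rw [ht, ← Real.log_div (by positivity) (by positivity)]
      congr 1; field_simp
    have hb : ∀ {k a : ℝ}, 0 < k → k * Real.exp (-(16 / √k)) < a → a < k * Real.exp (16 / √k) →
        |Real.log (a / k)| ≤ 16 / √k := by
      intro k a hk ha1 ha2
      have ha : 0 < a := lt_trans (by positivity) ha1
      rw [abs_le, Real.le_log_iff_exp_le (by positivity), Real.log_le_iff_le_exp (by positivity),
        le_div_iff₀ hk, div_le_iff₀ hk]
      constructor <;> linarith
    have htle : |t| ≤ 32 / √(I.card : ℝ) := by
      have := hb hk0 h1 h2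
      have h6 := hb hm0 h3 h4
      have h7 : 16 / √(Iᶜ.card : ℝ) ≤ 16 / √(I.card : ℝ) := by gcongr
      have e : 32 / √(I.card : ℝ) = 16 / √(I.card : ℝ) + 16 / √(I.card : ℝ) := by ring
      rw [ht', e]
      exact (abs_sub _ _).trans (add_le_add this (h6.trans h7))
    have het : Real.exp t * (I.card * B) = Iᶜ.card * A := by
      rw [ht, Real.exp_log (by positivity)]; field_simp
    have hj1 : (⌊t / δ⌋ : ℝ) * δ ≤ t := (le_div_iff₀ hδ).1 (Int.floor_le _)
    have hj2 : t < (⌊t / δ⌋ : ℝ) * δ + δ := by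
      have := (div_lt_iff₀ hδ).1 (Int.lt_floor_add_one (t / δ)); linarith
    have hkB : 0 < I.card * B := by positivity
    refine mem_iUnion₂.2 ⟨⌊t / δ⌋, Finset.mem_Icc.2 ⟨?_, ?_⟩, ⟨?_, ?_⟩, h1, h2⟩
    · have h8 : (-N - 1 : ℤ) < t / δ := by
        have := Int.lt_floor_add_one (32 / √(I.card : ℝ) / δ)
        have h9 : -(32 / √(I.card : ℝ) / δ) ≤ t / δ := by
          rw [← neg_div]; gcongr; exact (abs_le.1 htle).1
        push_cast
        linarith
      exact Int.le_floor.2 h8.le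
    · exact Int.floor_le_floor (by gcongr; exact (abs_le.1 htle).2)
    · rw [← hA, ← hB, ← het]
      exact mul_lt_mul_of_pos_right (Real.exp_lt_exp.2 (by linarith)) hkB
    · rw [← hA, ← hB, ← het]
      exact mul_lt_mul_of_pos_right (Real.exp_lt_exp.2 (by linarith)) hkB
  have hF : ∀ j ∈ Finset.Icc (-N - 1) N, gaussPi ι (F (j * δ)) ≤
      ENNReal.ofReal (Real.exp K) * gaussPi ι T := by
    intro j hj
    obtain ⟨hj1, hj2⟩ := Finset.mem_Icc.1 hj
    refine gaussPi_log_ratio_shift I hI δ ?_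
    have e : 33 / √(I.card : ℝ) = 32 / √(I.card : ℝ) + 1 / √(I.card : ℝ) := by ring
    have hj1' : (-N - 1 : ℝ) ≤ j := by exact_mod_cast hj1
    have hj2' : (j : ℝ) ≤ N := by exact_mod_cast hj2
    rw [e, abs_le]
    constructor <;> nlinarith
  have hhalf : ENNReal.ofReal (1 / 2) ≤ gaussPi ι (G I ∩ G Iᶜ) := by
    have h1 := gaussPi_log_sum_sq_tail I hI
    have h2 := gaussPi_log_sum_sq_tail Iᶜ hI'
    have h3 : (1 : ℝ≥0∞) ≤ gaussPi ι (G I ∩ G Iᶜ) + gaussPi ι ((G I)ᶜ ∪ (G Iᶜ)ᶜ) := by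
      rw [← measure_univ (μ := gaussPi ι), ← compl_inter]
      exact (measure_mono (by simp)).trans (measure_union_le _ _)
    have h4 : gaussPi ι ((G I)ᶜ ∪ (G Iᶜ)ᶜ) ≤ ENNReal.ofReal (1 / 2) := by
      refine (measure_union_le _ _).trans ((add_le_add h1 h2).trans ?_)
      rw [← ENNReal.ofReal_add (by norm_num) (by norm_num)]; norm_num
    have h5 : ENNReal.ofReal (1 / 2) + ENNReal.ofReal (1 / 2) = 1 := by
      rw [← ENNReal.ofReal_add (by norm_num) (by norm_num)]; norm_num
    have h6 := h3.trans (add_le_add_right h4 _)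
    rw [← h5] at h6
    exact (ENNReal.add_le_add_iff_right ENNReal.ofReal_ne_top).1 h6
  have hsum : ENNReal.ofReal (1 / 2) ≤
      ENNReal.ofReal (66 / (√(I.card : ℝ) * δ) * Real.exp K) * gaussPi ι T := by
    refine hhalf.trans ((measure_mono hcover).trans ((measure_biUnion_finset_le _ _).trans
      ((Finset.sum_le_sum hF).trans ?_)))
    rw [Finset.sum_const, nsmul_eq_mul, ← mul_assoc, ENNReal.ofReal_mul (by positivity)]
    gcongr
    rw [← ENNReal.ofReal_natCast, Int.card_Icc]
    refine ENNReal.ofReal_le_ofReal ?_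
    have e : (((N + 1 - (-N - 1)).toNat : ℤ) : ℝ) = 2 * N + 2 := by
      rw [Int.toNat_of_nonneg (by linarith)]; push_cast; ring
    rw [Int.cast_natCast] at e
    rw [e, le_div_iff₀ (by positivity)]
    have h1 : N * δ * √(I.card : ℝ) ≤ 32 := by rwa [le_div_iff₀ (by positivity)] at hNδ
    have h2 : δ * √(I.card : ℝ) ≤ 1 := by rwa [le_div_iff₀ (by positivity)] at hδ1
    nlinarith
  have hsplit : Real.exp (-K) / 132 * (√(I.card : ℝ) * δ) =
      (66 / (√(I.card : ℝ) * δ) * Real.exp K)⁻¹ * (1 / 2) := by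
    rw [Real.exp_neg]; field_simp; norm_num
  rw [hsplit, ENNReal.ofReal_mul (by positivity), ENNReal.ofReal_inv_of_pos (by positivity)]
  refine (mul_le_mul_right hsum _).trans ?_
  rw [← mul_assoc, ENNReal.inv_mul_cancel _ ENNReal.ofReal_ne_top, one_mul]
  exact (ENNReal.ofReal_pos.2 (by positivity)).ne'

lemma gaussPi_norm_ratio_compl_le [DecidableEq ι] (I : Finset ι) (hI : Iᶜ.Nonempty) {ε : ℝ}
    (hε : ε ∈ Ioo (0 : ℝ) (1 / 2)) :
    gaussPi ι {v | ¬ ((1 - ε) ^ 2 * (I.card * ∑ i, v i ^ 2) <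
        ((I.card : ℝ) + Iᶜ.card) * ∑ i ∈ I, v i ^ 2 ∧
      ((I.card : ℝ) + Iᶜ.card) * ∑ i ∈ I, v i ^ 2 < (1 + ε) ^ 2 * (I.card * ∑ i, v i ^ 2))} ≤
      ENNReal.ofReal (2 * Real.exp (-(ε ^ 2 * I.card / 2))) := by
  obtain ⟨hε0, hε1⟩ := hε
  have bound : ∀ t : ℝ, 0 < 1 + t → t ^ 2 = ε ^ 2 →
      ENNReal.ofReal (Real.exp (I.card / 2 * (1 - (1 + t) ^ 2 + Real.log ((1 + t) ^ 2)))) ≤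
        ENNReal.ofReal (Real.exp (-(ε ^ 2 * I.card / 2))) := by
    intro t ht hte
    refine ENNReal.ofReal_le_ofReal (Real.exp_le_exp.2 ?_)
    have h1 := Real.log_le_sub_one_of_pos ht
    have h2 : 1 - (1 + t) ^ 2 + Real.log ((1 + t) ^ 2) ≤ -ε ^ 2 := by
      rw [Real.log_pow, ← hte]; push_cast; nlinarith
    have := mul_le_mul_of_nonneg_left h2 (by positivity : (0 : ℝ) ≤ I.card / 2)
    linarith
  have h1 : gaussPi ι {v | (1 + ε) ^ 2 * (I.card * ∑ i, v i ^ 2) ≤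
      ((I.card : ℝ) + Iᶜ.card) * ∑ i ∈ I, v i ^ 2} ≤ _ :=
    (gaussPi_ratio_tail I hI (b := (1 + ε) ^ 2) (by positivity) fun v hv => mul_nonneg (by nlinarith)
      (by rw [mem_ofPred_eq] at hv; linarith)).trans (bound ε (by linarith) rfl)
  have h2 : gaussPi ι {v | ((I.card : ℝ) + Iᶜ.card) * ∑ i ∈ I, v i ^ 2 ≤
      (1 - ε) ^ 2 * (I.card * ∑ i, v i ^ 2)} ≤ _ :=
    (gaussPi_ratio_tail I hI (b := (1 + -ε) ^ 2) (pow_pos (by linarith) 2) fun v hv =>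
      mul_nonneg_of_nonpos_of_nonpos (by nlinarith)
      (by rw [mem_ofPred_eq] at hv; linarith)).trans (bound (-ε) (by linarith) (by ring))
  refine (measure_mono fun v hv => ?_).trans ((measure_union_le _ _).trans
    ((add_le_add h1 h2).trans ?_))
  · by_contra h
    simp only [mem_union, not_or] at h
    exact hv ⟨not_le.1 h.2, not_le.1 h.1⟩
  · rw [← ENNReal.ofReal_add (Real.exp_pos _).le (Real.exp_pos _).le, two_mul]

lemma le_gaussPi_norm_ratio_near_one [DecidableEq ι] (I : Finset ι) (hI : I.Nonempty)
    (hI' : Iᶜ.Nonempty) {ε : ℝ} (hε : ε ∈ Ioo (0 : ℝ) (1 / 2)) :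
    ENNReal.ofReal (Real.exp (-(2401 / 2 * Real.exp 49)) / 132 * min 1 (√I.card * ε / 2)) ≤
    gaussPi ι {v | (1 - ε) ^ 2 * (I.card * ∑ i, v i ^ 2) <
        ((I.card : ℝ) + Iᶜ.card) * ∑ i ∈ I, v i ^ 2 ∧
      ((I.card : ℝ) + Iᶜ.card) * ∑ i ∈ I, v i ^ 2 < (1 + ε) ^ 2 * (I.card * ∑ i, v i ^ 2)} := by
  obtain ⟨hε0, hε1⟩ := hε
  have hk : (1 : ℝ) ≤ I.card := by exact_mod_cast hI.card_pos
  have hm : (1 : ℝ) ≤ Iᶜ.card := by exact_mod_cast hI'.card_pos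
  have hA : ∀ (J : Finset ι) (v : ι → ℝ), 0 ≤ ∑ i ∈ J, v i ^ 2 :=
    fun J v => Finset.sum_nonneg fun i _ => sq_nonneg _
  have hexp : ∀ {δ : ℝ}, 0 ≤ δ → δ ≤ 1 → Real.exp δ ≤ 1 + 2 * δ := by
    intro δ h0 h1
    have := (abs_le.1 (Real.abs_exp_sub_one_sub_id_le (x := δ) (by rwa [abs_of_nonneg h0]))).2
    nlinarith
  simp_rw [← Finset.sum_add_sum_compl I]
  have key : ∀ {A B : ℝ}, 0 ≤ A → 0 ≤ B →
      (1 - ε) * (I.card * (A + B)) < (I.card + Iᶜ.card) * A ∧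
        (I.card + Iᶜ.card) * A < (1 + ε) * (I.card * (A + B)) →
      (1 - ε) ^ 2 * (I.card * (A + B)) < (I.card + Iᶜ.card) * A ∧
        (I.card + Iᶜ.card) * A < (1 + ε) ^ 2 * (I.card * (A + B)) := by
    rintro A B hA hB ⟨h1, h2⟩
    have h0 : 0 ≤ I.card * (A + B) := by positivity
    exact ⟨lt_of_le_of_lt (mul_le_mul_of_nonneg_right (by nlinarith) h0) h1,
      lt_of_lt_of_le h2 (mul_le_mul_of_nonneg_right (by nlinarith) h0)⟩
  rcases le_or_gt I.card Iᶜ.card with hle | hlt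
  · have hr : 0 < √(I.card : ℝ) := by positivity
    set δ := min (ε / 2) (1 / √(I.card : ℝ)) with hδ
    have hδ0 : 0 < δ := lt_min (by linarith) (by positivity)
    have hδ1 : δ ≤ 1 / √(I.card : ℝ) := min_le_right _ _
    have hδε : δ ≤ ε / 2 := min_le_left _ _
    have e : min 1 (√(I.card : ℝ) * ε / 2) = √(I.card : ℝ) * δ := by
      rw [hδ, mul_min_of_nonneg _ _ hr.le, min_comm]
      congr 1
      · ring
      · field_simp
    rw [e]
    refine (le_gaussPi_ratio_near_one I hI hle hδ0 hδ1).trans (measure_mono fun v hv => ?_)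
    obtain ⟨h1, h2⟩ := hv
    refine key (hA I v) (hA Iᶜ v) ?_
    have hA' := hA I v
    have hB' := hA Iᶜ v
    generalize ∑ i ∈ I, v i ^ 2 = A at *
    generalize ∑ i ∈ Iᶜ, v i ^ 2 = B at *
    have hkB : 0 ≤ I.card * B := by positivity
    have hkA : 0 ≤ ε * (I.card * A) := by positivity
    have h3 := mul_le_mul_of_nonneg_right (hexp hδ0.le (by linarith)) hkB
    have h4 := mul_le_mul_of_nonneg_right (Real.add_one_le_exp (-δ)) hkB
    have h5 := mul_le_mul_of_nonneg_right hδε hkB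
    have h6 : 0 ≤ ε * (I.card * B) := by positivity
    constructor <;> linarith
  · have hr : 0 < √(Iᶜ.card : ℝ) := by positivity
    have hr1 : 1 ≤ √(Iᶜ.card : ℝ) := Real.one_le_sqrt.2 hm
    have hmk : (Iᶜ.card : ℝ) ≤ I.card := by exact_mod_cast hlt.le
    set δ := min (I.card * ε / (2 * Iᶜ.card)) (1 / √(Iᶜ.card : ℝ)) with hδ
    have hδ0 : 0 < δ := lt_min (by positivity) (by positivity)
    have hδ1 : δ ≤ 1 / √(Iᶜ.card : ℝ) := min_le_right _ _
    have hδε : δ ≤ I.card * ε / (2 * Iᶜ.card) := min_le_left _ _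
    have e : min 1 (√(I.card : ℝ) * ε / 2) ≤ √(Iᶜ.card : ℝ) * δ := by
      rw [hδ, mul_min_of_nonneg _ _ hr.le, min_comm]
      refine min_le_min ?_ (by field_simp; rfl)
      have h1 : √(Iᶜ.card : ℝ) ≤ √(I.card : ℝ) := Real.sqrt_le_sqrt hmk
      have h2 : √(Iᶜ.card : ℝ) ^ 2 = Iᶜ.card := Real.sq_sqrt (by linarith)
      have h3 : √(I.card : ℝ) ^ 2 = I.card := Real.sq_sqrt (by linarith)
      have h4 : √(Iᶜ.card : ℝ) * (√(I.card : ℝ) ^ 2 * ε / (2 * √(Iᶜ.card : ℝ) ^ 2)) =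
        √(I.card : ℝ) * ε / 2 * (√(I.card : ℝ) / √(Iᶜ.card : ℝ)) := by field_simp
      rw [h2, h3] at h4
      rw [h4]
      exact le_mul_of_one_le_right (by positivity) ((one_le_div hr).2 h1)
    refine (ENNReal.ofReal_le_ofReal (mul_le_mul_of_nonneg_left e (by positivity))).trans
      ((le_gaussPi_ratio_near_one Iᶜ hI' (by rw [compl_compl]; exact hlt.le) hδ0 hδ1).trans
      (measure_mono fun v hv => ?_))
    rw [compl_compl] at hv
    obtain ⟨h1, h2⟩ := hv
    refine key (hA I v) (hA Iᶜ v) ?_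
    have hA' := hA I v
    have hB' := hA Iᶜ v
    generalize ∑ i ∈ I, v i ^ 2 = A at *
    generalize ∑ i ∈ Iᶜ, v i ^ 2 = B at *
    have hmA : 0 ≤ Iᶜ.card * A := by positivity
    have hkB : 0 ≤ ε * (I.card * B) := by positivity
    have hδle : δ ≤ 1 := hδ1.trans (by rw [div_le_one hr]; exact hr1)
    have h3 := mul_le_mul_of_nonneg_right (hexp hδ0.le hδle) hmA
    have h4 := mul_le_mul_of_nonneg_right (Real.add_one_le_exp (-δ)) hmA
    have h5 := mul_le_mul_of_nonneg_right hδε hmA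
    have h6 : I.card * ε / (2 * Iᶜ.card) * (Iᶜ.card * A) = ε * (I.card * A) / 2 := by field_simp
    rw [h6] at h5
    have h7 : 0 ≤ ε * (I.card * A) := by positivity
    constructor <;> linarith

/-- A universal constant for which the Johnson–Lindenstrauss probability bound holds. -/
noncomputable def jlConst : ℝ := Real.exp (-(2401 / 2 * Real.exp 49)) / 528

lemma jlConst_pos : 0 < jlConst := by unfold jlConst; positivity

lemma jlConst_le : jlConst ≤ 1 / 4 := by
  have : Real.exp (-(2401 / 2 * Real.exp 49)) ≤ 1 := by
    rw [Real.exp_le_one_iff]; have := Real.exp_pos 49; linarith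
  unfold jlConst; linarith

lemma le_gaussPi_norm_ratio [DecidableEq ι] (I : Finset ι) (hI : I.Nonempty)
    (hI' : Iᶜ.Nonempty) {ε : ℝ} (hε : ε ∈ Ioo (0 : ℝ) (1 / 2)) :
    ENNReal.ofReal (1 - Real.exp (-jlConst * ε ^ 2 * I.card)) ≤
    gaussPi ι {v | (1 - ε) ^ 2 * (I.card * ∑ i, v i ^ 2) <
        ((I.card : ℝ) + Iᶜ.card) * ∑ i ∈ I, v i ^ 2 ∧
      ((I.card : ℝ) + Iᶜ.card) * ∑ i ∈ I, v i ^ 2 < (1 + ε) ^ 2 * (I.card * ∑ i, v i ^ 2)} := by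
  have hsq : √(I.card : ℝ) ^ 2 = I.card := Real.sq_sqrt (by positivity)
  have hε0 := hε.1
  rcases le_total (√(I.card : ℝ) * ε) 2 with h | h
  · refine le_trans (ENNReal.ofReal_le_ofReal ?_) (le_gaussPi_norm_ratio_near_one I hI hI' hε)
    have h1 := Real.add_one_le_exp (-jlConst * ε ^ 2 * I.card)
    rw [min_eq_right (by linarith)]
    have h2 : ε ^ 2 * I.card ≤ 2 * (√(I.card : ℝ) * ε) := by
      have h0 := mul_le_mul_of_nonneg_right h (mul_nonneg (Real.sqrt_nonneg (I.card : ℝ)) hε0.le)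
      have e : ε ^ 2 * I.card = √(I.card : ℝ) * ε * (√(I.card : ℝ) * ε) := by
        rw [← sq, mul_pow, hsq]; ring
      linarith
    have h3 := mul_le_mul_of_nonneg_left h2 jlConst_pos.le
    have h4 : Real.exp (-(2401 / 2 * Real.exp 49)) / 132 = 4 * jlConst := by
      unfold jlConst; ring
    rw [h4]
    linarith
  · set T : Set (ι → ℝ) := {v | (1 - ε) ^ 2 * _ < _ ∧ _} with hT
    have h4 : 4 ≤ ε ^ 2 * I.card := by
      have e : ε ^ 2 * I.card = (√(I.card : ℝ) * ε) ^ 2 := by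
        rw [mul_pow, hsq]; ring
      rw [e]; nlinarith
    have h1 : gaussPi ι Tᶜ ≤ _ := gaussPi_norm_ratio_compl_le I hI' hε
    have h2 : 2 * Real.exp (-(ε ^ 2 * I.card / 2)) ≤ Real.exp (-jlConst * ε ^ 2 * I.card) := by
      have e1 : (2 : ℝ) ≤ Real.exp 1 := by linarith [Real.add_one_le_exp (1 : ℝ)]
      refine (mul_le_mul_of_nonneg_right e1 (Real.exp_pos _).le).trans ?_
      rw [← Real.exp_add]
      refine Real.exp_le_exp.2 ?_
      have := mul_le_mul_of_nonneg_right jlConst_le (by positivity : 0 ≤ ε ^ 2 * I.card)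
      linarith
    have h3 : (1 : ℝ≥0∞) ≤ gaussPi ι T + gaussPi ι Tᶜ := by
      rw [← measure_univ (μ := gaussPi ι), ← union_compl_self T]
      exact measure_union_le _ _
    rw [ENNReal.ofReal_sub _ (Real.exp_pos _).le, ENNReal.ofReal_one]
    exact tsub_le_iff_right.2
      (h3.trans (add_le_add_right (h1.trans (ENNReal.ofReal_le_ofReal h2)) _))

end Gaussian

section Haar

variable {d : ℕ}

instance : BorelSpace (Matrix.orthogonalGroup (Fin d) ℝ) := ⟨rfl⟩

instance : SecondCountableTopology (Matrix.orthogonalGroup (Fin d) ℝ) :=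
  haveI : SecondCountableTopology (Matrix (Fin d) (Fin d) ℝ) :=
    inferInstanceAs (SecondCountableTopology (Fin d → Fin d → ℝ))
  inferInstanceAs (SecondCountableTopology
    ((Matrix.orthogonalGroup (Fin d) ℝ : Submonoid _) : Set (Matrix (Fin d) (Fin d) ℝ)))

/-- A left-invariant probability measure on a group is right-invariant. -/
lemma map_mul_right_eq_self_of_isProbabilityMeasure {G : Type*} [Group G] [MeasurableSpace G]
    [MeasurableMul₂ G] [MeasurableInv G] (μ : Measure G) [IsProbabilityMeasure μ]
    [μ.IsMulLeftInvariant] (g : G) : μ.map (· * g) = μ := by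
  have : IsProbabilityMeasure (μ.map (· * g)) :=
    Measure.isProbabilityMeasure_map (measurable_mul_const g).aemeasurable
  simpa using measure_eq_div_smul (μ.map (· * g)) μ (s := univ) (by simp) (by simp)

lemma exists_orthogonal_mulVec_eq {w w' : Fin d → ℝ} (h : ∑ i, w i ^ 2 = ∑ i, w' i ^ 2) :
    ∃ g : Matrix.orthogonalGroup (Fin d) ℝ, (g : Matrix (Fin d) (Fin d) ℝ).mulVec w = w' := by
  have hdot : ∀ u : Fin d → ℝ, ∑ i, u i ^ 2 = u ⬝ᵥ u := fun u => by simp [dotProduct, sq]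
  rw [hdot, hdot] at h
  by_cases hw : w = w'
  · exact ⟨1, by simp [hw]⟩
  set u := w - w' with hu
  have hu0 : u ⬝ᵥ u ≠ 0 := by
    rw [Ne, dotProduct_self_eq_zero]
    exact sub_ne_zero.2 hw
  set c := u ⬝ᵥ u with hc
  have huw : u ⬝ᵥ w = c / 2 := by
    rw [hc, hu]
    simp only [sub_dotProduct, dotProduct_sub]
    rw [dotProduct_comm w' w]
    linarith
  refine ⟨⟨1 - (2 / c) • Matrix.vecMulVec u u, ?_⟩, ?_⟩
  · rw [Matrix.mem_orthogonalGroup_iff]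
    have hstar : (1 - (2 / c) • Matrix.vecMulVec u u).transpose = 1 - (2 / c) • Matrix.vecMulVec u u := by
      simp [Matrix.transpose_vecMulVec]
    rw [hstar]
    simp only [mul_sub, sub_mul, one_mul, mul_one, Matrix.smul_mul, Matrix.mul_smul,
      Matrix.vecMulVec_mul_vecMulVec]
    rw [← hc]
    ext i j
    simp [Matrix.vecMulVec_apply]
    field_simp
    ring
  · simp only [Matrix.sub_mulVec, Matrix.one_mulVec, Matrix.smul_mulVec, Matrix.vecMulVec_mulVec]
    rw [huw]
    ext i
    simp [hu]
    field_simp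
    ring

/-- The image of a nonzero vector under a Haar-random orthogonal matrix has the same distribution
as a Gaussian vector, up to positive scaling. -/
lemma haar_mulVec_eq_gaussPi (hd : 0 < d) (μ : Measure (Matrix.orthogonalGroup (Fin d) ℝ))
    [IsProbabilityMeasure μ]
    (hμ : ∀ g : Matrix.orthogonalGroup (Fin d) ℝ, μ.map (fun Q => g * Q) = μ)
    {E : Set (Fin d → ℝ)} (hE : MeasurableSet E)
    (hcone : ∀ (t : ℝ) (v : Fin d → ℝ), 0 < t → v ∈ E → t • v ∈ E) {w : Fin d → ℝ} (hw : w ≠ 0) :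
    μ {Q | (Q : Matrix (Fin d) (Fin d) ℝ).mulVec w ∈ E} = gaussPi (Fin d) E := by
  have : μ.IsMulLeftInvariant := ⟨hμ⟩
  have hcont : Continuous fun p : Matrix.orthogonalGroup (Fin d) ℝ × (Fin d → ℝ) =>
      (p.1 : Matrix (Fin d) (Fin d) ℝ).mulVec p.2 :=
    Continuous.matrix_mulVec (continuous_subtype_val.comp continuous_fst) continuous_snd
  have hcone' : ∀ (t : ℝ) (v : Fin d → ℝ), 0 < t → (t • v ∈ E ↔ v ∈ E) := by
    intro t v ht
    refine ⟨fun h => ?_, hcone t v ht⟩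
    simpa [smul_smul, inv_mul_cancel₀ ht.ne'] using hcone t⁻¹ _ (inv_pos.2 ht) h
  have hpos : ∀ {v : Fin d → ℝ}, v ≠ 0 → 0 < ∑ i, v i ^ 2 := by
    intro v hv
    obtain ⟨i, hi⟩ := Function.ne_iff.1 hv
    exact Finset.sum_pos' (fun _ _ => sq_nonneg _) ⟨i, Finset.mem_univ _, sq_pos_of_ne_zero hi⟩
  have hconst : ∀ v : Fin d → ℝ, v ≠ 0 →
      μ {Q | (Q : Matrix (Fin d) (Fin d) ℝ).mulVec v ∈ E} =
        μ {Q | (Q : Matrix (Fin d) (Fin d) ℝ).mulVec w ∈ E} := by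
    intro v hv
    set t := √(∑ i, v i ^ 2) / √(∑ i, w i ^ 2) with ht
    have ht0 : 0 < t := div_pos (Real.sqrt_pos.2 (hpos hv)) (Real.sqrt_pos.2 (hpos hw))
    obtain ⟨g, hg⟩ := exists_orthogonal_mulVec_eq (w := t • w) (w' := v) (by
      simp only [Pi.smul_apply, smul_eq_mul, mul_pow]
      rw [← Finset.mul_sum, ht, div_pow, Real.sq_sqrt (hpos hv).le, Real.sq_sqrt (hpos hw).le,
        div_mul_cancel₀ _ (hpos hw).ne'])
    have hmeas : MeasurableSet {Q : Matrix.orthogonalGroup (Fin d) ℝ |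
        (Q : Matrix (Fin d) (Fin d) ℝ).mulVec w ∈ E} :=
      (hcont.comp (continuous_id.prodMk continuous_const)).measurable hE
    conv_rhs => rw [← map_mul_right_eq_self_of_isProbabilityMeasure μ g]
    rw [Measure.map_apply (measurable_mul_const g) hmeas]
    congr 1
    ext Q
    simp only [mem_ofPred_eq, mem_preimage, ← hg]
    rw [Matrix.mulVec_mulVec, Matrix.mulVec_smul, hcone' _ _ ht0]
    rfl
  have hS : MeasurableSet {p : Matrix.orthogonalGroup (Fin d) ℝ × (Fin d → ℝ) |
      (p.1 : Matrix (Fin d) (Fin d) ℝ).mulVec p.2 ∈ E} := hcont.measurable hE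
  have h1 := Measure.prod_apply (μ := μ) (ν := gaussPi (Fin d)) hS
  rw [Measure.prod_apply_symm hS] at h1
  have hae : ∀ᵐ v ∂(gaussPi (Fin d)), v ≠ 0 := by
    refine measure_mono_null (fun v hv => ?_) (gaussPi_hyperplane (⟨0, hd⟩ : Fin d))
    have : v = 0 := by simpa using hv
    simp [this]
  have h2 : ∀ Q : Matrix.orthogonalGroup (Fin d) ℝ, gaussPi (Fin d) (Prod.mk Q ⁻¹'
      {p | (p.1 : Matrix (Fin d) (Fin d) ℝ).mulVec p.2 ∈ E}) = gaussPi (Fin d) E :=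
    fun Q => gaussPi_preimage_orthogonal Q hE
  simp_rw [h2] at h1
  have h3 : ∀ᵐ v ∂(gaussPi (Fin d)), μ ((fun Q => (Q, v)) ⁻¹'
      {p : Matrix.orthogonalGroup (Fin d) ℝ × (Fin d → ℝ) |
        (p.1 : Matrix (Fin d) (Fin d) ℝ).mulVec p.2 ∈ E}) =
      μ {Q | (Q : Matrix (Fin d) (Fin d) ℝ).mulVec w ∈ E} := hae.mono fun v hv => hconst v hv
  rw [lintegral_congr_ae h3] at h1
  simpa using h1

end Haar

/-- **Johnson–Lindenstrauss lemma.** There is a universal constant `C > 0` such that for all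
dimensions `1 ≤ k < d`, for a Haar-random orthogonal matrix `Q` (i.e. distributed according to
the unique left-invariant probability measure on `O(d)`), the map
`f_Q x = √(d/k) · (first k coordinates of Q x)` satisfies, for every `ε ∈ (0, 1/2)` and every
pair of distinct `x y : ℝ^d`,
`Pr[‖f_Q x − f_Q y‖₂ / ‖x − y‖₂ ∈ (1−ε, 1+ε)] ≥ 1 − e^{−Cε²k}`. -/
theorem johnson_lindenstrauss :
    ∃ C : ℝ, 0 < C ∧
      ∀ (d k : ℕ), 1 ≤ d → 1 ≤ k → ∀ (hkd : k < d),
        ∀ (μ : Measure (Matrix.orthogonalGroup (Fin d) ℝ)), IsProbabilityMeasure μ →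
          (∀ g : Matrix.orthogonalGroup (Fin d) ℝ, μ.map (fun Q => g * Q) = μ) →
          ∀ ε : ℝ, ε ∈ Set.Ioo (0 : ℝ) (1/2) →
            ∀ x y : Fin d → ℝ, x ≠ y →
              μ {Q : Matrix.orthogonalGroup (Fin d) ℝ |
                  Real.sqrt (∑ i : Fin k,
                      (Real.sqrt ((d : ℝ) / k) *
                          ((Q : Matrix (Fin d) (Fin d) ℝ).mulVec x (Fin.castLE hkd.le i)) -
                        Real.sqrt ((d : ℝ) / k) *
                          ((Q : Matrix (Fin d) (Fin d) ℝ).mulVec y (Fin.castLE hkd.le i))) ^ 2) /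
                    Real.sqrt (∑ i : Fin d, (x i - y i) ^ 2) ∈ Set.Ioo (1 - ε) (1 + ε)}
                ≥ ENNReal.ofReal (1 - Real.exp (-C * ε ^ 2 * k)) := by
  refine ⟨jlConst, jlConst_pos, fun d k hd hk hkd μ hμ hinv ε hε x y hxy => ?_⟩
  set I : Finset (Fin d) := Finset.univ.map (Fin.castLEEmb hkd.le) with hI
  have hIcard : I.card = k := by simp [hI]
  have hIc : Iᶜ.card = d - k := by rw [Finset.card_compl, hIcard, Fintype.card_fin]
  have hsum : (I.card : ℝ) + Iᶜ.card = d := by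
    rw [hIcard, hIc, Nat.cast_sub hkd.le]; ring
  have hgauss := le_gaussPi_norm_ratio I (Finset.card_pos.1 (by lia)) (Finset.card_pos.1 (by lia)) hε
  rw [hsum, hIcard] at hgauss
  set E : Set (Fin d → ℝ) := {v | (1 - ε) ^ 2 * _ < _ ∧ _} with hE
  have hEm : MeasurableSet E := by
    simp only [hE, ofPred_and]
    refine MeasurableSet.inter ?_ ?_ <;> exact measurableSet_lt (by fun_prop) (by fun_prop)
  have hw : x - y ≠ 0 := sub_ne_zero.2 hxy
  rw [← haar_mulVec_eq_gaussPi hd μ hinv hEm (fun t v ht hv => ?_) hw] at hgauss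
  · refine hgauss.trans (measure_mono fun Q hQ => ?_)
    obtain ⟨h1, h2⟩ := hQ
    rw [sum_mulVec_sq_of_orthogonal] at h1 h2
    obtain ⟨i, hi⟩ := Function.ne_iff.1 hw
    have hN : 0 < ∑ i, (x - y) i ^ 2 :=
      Finset.sum_pos' (fun _ _ => sq_nonneg _) ⟨i, Finset.mem_univ _, sq_pos_of_ne_zero hi⟩
    have hk0 : (0 : ℝ) < k := by exact_mod_cast hk
    have hnum : ∑ i : Fin k, (Real.sqrt ((d : ℝ) / k) *
          ((Q : Matrix (Fin d) (Fin d) ℝ).mulVec x (Fin.castLE hkd.le i)) -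
        Real.sqrt ((d : ℝ) / k) *
          ((Q : Matrix (Fin d) (Fin d) ℝ).mulVec y (Fin.castLE hkd.le i))) ^ 2 =
        d * (∑ i ∈ I, (Q : Matrix (Fin d) (Fin d) ℝ).mulVec (x - y) i ^ 2) / k := by
      rw [hI, Finset.sum_map, Finset.mul_sum, Finset.sum_div]
      refine Finset.sum_congr rfl fun i _ => ?_
      rw [← mul_sub, mul_pow, Real.sq_sqrt (by positivity), Matrix.mulVec_sub, Pi.sub_apply,
        Fin.coe_castLEEmb]
      ring
    have hden : ∑ i : Fin d, (x i - y i) ^ 2 = ∑ i, (x - y) i ^ 2 := rfl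
    rw [mem_ofPred_eq, hnum, hden, ← Real.sqrt_div' _ hN.le]
    constructor
    · refine Real.lt_sqrt_of_sq_lt ?_
      rw [lt_div_iff₀ hN, lt_div_iff₀ hk0]
      linarith
    · rw [Real.sqrt_lt' (by linarith [hε.1]), div_lt_iff₀ hN, div_lt_iff₀ hk0]
      linarith
  · obtain ⟨h1, h2⟩ := hv
    have ht2 : 0 < t ^ 2 := by positivity
    simp only [hE, mem_ofPred_eq, Pi.smul_apply, smul_eq_mul, mul_pow, ← Finset.mul_sum]
    have h3 := mul_lt_mul_of_pos_left h1 ht2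
    have h4 := mul_lt_mul_of_pos_left h2 ht2
    constructor <;> linarith
end

section
/- Let G = (U, V, E) be an (r, α)-unbalanced expander: a bipartite simple graph with |U| = d, |V| = k, in which every left vertex has exactly Δ neighbors, and such that for every X ⊆ U with |X| ≤ r the neighborhood N(X) satisfies |N(X)| ≥ (1 − α)Δ|X|. Define f_G : {0,1}^U → Π_{j∈V} ({0,1}^{N(j)}) by letting f_G(x)_j be the restriction of x to N(j). Then for all x, y ∈ {0,1}^U with Hamming distance H(x,y) ≥ r (where r is a positive integer), the number of coordinates j ∈ V with f_G(x)_j ≠ f_G(y)_j is at least (1 − α)Δr. -/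
/-- For an `(r, α)`-unbalanced expander `G = (U, V, E)` (bipartite, left degree exactly `Δ`,
every left set `X` with `|X| ≤ r` has `|N(X)| ≥ (1−α)Δ|X|`), the map `f_G` sending
`x ∈ {0,1}^U` to the tuple of restrictions of `x` to the neighborhoods `N(j)`, `j ∈ V`,
satisfies: if `H(x,y) ≥ r` then the number of `j ∈ V` with `f_G(x)_j ≠ f_G(y)_j` is at least
`(1−α)Δr`. -/
theorem expander_map_lower_bound {U V : Type*} [Fintype U] [Fintype V] [DecidableEq U]
    [DecidableEq V] (E : U → V → Prop) [∀ u v, Decidable (E u v)] (Δ r : ℕ) (hr : 0 < r)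
    (α : ℝ) (hα : 0 ≤ α) (hα' : α ≤ 1)
    (hdeg : ∀ u : U, (Finset.univ.filter (fun v => E u v)).card = Δ)
    (hexp : ∀ X : Finset U, X.card ≤ r →
      (((Finset.univ.filter (fun v : V => ∃ u ∈ X, E u v)).card : ℝ)
        ≥ (1 - α) * Δ * X.card))
    (f : (U → Bool) → ∀ j : V, {u : U // E u j} → Bool)
    (hf : ∀ x j u, f x j u = x u.1)
    (x y : U → Bool) (hxy : r ≤ hammingDist x y) :
    (((Finset.univ.filter (fun j : V => f x j ≠ f y j)).card : ℝ) ≥ (1 - α) * Δ * r) := by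
  obtain ⟨X, hX, hcard⟩ := Finset.exists_subset_card_eq hxy
  have hN := hexp X hcard.le
  rw [hcard] at hN
  refine hN.le.trans (Nat.cast_le.mpr (Finset.card_le_card fun j hj => ?_))
  obtain ⟨u, hu, huj⟩ := (Finset.mem_filter.mp hj).2
  refine Finset.mem_filter.mpr ⟨Finset.mem_univ j, fun h => ?_⟩
  have hne : x u ≠ y u := (Finset.mem_filter.mp (hX hu)).2
  exact hne (by simpa only [hf] using congrFun h ⟨u, huj⟩)
end

section
/- There exists a universal constant C > 0 such that every finite metric space (X, d) with |X| = N ≥ 2 admits a bi-Lipschitz embedding with distortion at most C·log N into the Euclidean space (ℝ^k, ℓ₂) with k ≤ C·log N: there exist k ≤ C·log N, λ > 0, and a map f : X → ℝ^k such that λ·d(x,y) ≤ ‖f(x) − f(y)‖₂ ≤ C·(log N)·λ·d(x,y) for all x, y ∈ X. -/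
section JohnsonLindenstrauss

open MeasureTheory ProbabilityTheory
open scoped RealInnerProductSpace

lemma integral_exp_mul_sq_gaussianReal {s : ℝ} :
    ∫ x, Real.exp (s * x ^ 2) ∂(gaussianReal 0 1) = (√(1 - 2 * s))⁻¹ := by
  rw [integral_gaussianReal_eq_integral_smul one_ne_zero]
  have h (x : ℝ) : gaussianPDFReal 0 1 x • Real.exp (s * x ^ 2) =
      (√(2 * Real.pi))⁻¹ * Real.exp (-(1 / 2 - s) * x ^ 2) := by
    rw [gaussianPDFReal, smul_eq_mul, mul_assoc, ← Real.exp_add]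
    simp only [NNReal.coe_one, mul_one]
    congr 2
    ring
  simp_rw [h]
  rw [integral_const_mul, integral_gaussian, show Real.pi / (1 / 2 - s) =
    (2 * Real.pi) / (1 - 2 * s) by rw [show 1 - 2 * s = 2 * (1 / 2 - s) by ring,
      mul_div_mul_left _ _ two_ne_zero], Real.sqrt_div (by positivity)]
  have : √(2 * Real.pi) ≠ 0 := by positivity
  field_simp

section Gaussian

variable {E : Type*} [NormedAddCommGroup E] [InnerProductSpace ℝ E] [FiniteDimensional ℝ E]
  [MeasurableSpace E] [BorelSpace E]

lemma stdGaussian_map_inner {u : E} (hu : ‖u‖ = 1) :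
    (stdGaussian E).map (fun x => ⟪u, x⟫) = gaussianReal 0 1 := by
  have h := IsGaussian.map_eq_gaussianReal (μ := stdGaussian E) (innerSL ℝ u)
  rw [integral_strongDual_stdGaussian, variance_dual_stdGaussian, innerSL_apply_norm, hu] at h
  simpa [innerSL_apply_apply] using h

lemma integral_exp_sum_sq_inner_pi_stdGaussian {u : E} (hu : ‖u‖ = 1) (k : ℕ) (s : ℝ) :
    ∫ g, Real.exp (s * ∑ j, ⟪u, g j⟫ ^ 2) ∂(Measure.pi fun _ : Fin k => stdGaussian E) =
      (√(1 - 2 * s))⁻¹ ^ k := by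
  simp_rw [Finset.mul_sum, Real.exp_sum]
  rw [integral_fintype_prod_eq_pow (ι := Fin k) (fun x : E => Real.exp (s * ⟪u, x⟫ ^ 2)),
    Fintype.card_fin, ← integral_exp_mul_sq_gaussianReal, ← stdGaussian_map_inner hu,
    integral_map (by fun_prop) (by fun_prop)]

lemma exists_sum_sq_inner_mem_Icc {ι : Type*} (V : Finset ι) (u : ι → E)
    (hu : ∀ i ∈ V, ‖u i‖ = 1) (k : ℕ) (hk : 2 * (V.card : ℝ) < Real.exp (k / 4)) :
    ∃ g : Fin k → E, ∀ i ∈ V, ∑ j, ⟪u i, g j⟫ ^ 2 ∈ Set.Icc (k / 6 : ℝ) (16 / 3 * k) := by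
  set μ := Measure.pi fun _ : Fin k => stdGaussian E
  let S : ι → (Fin k → E) → ℝ := fun i g => ∑ j, ⟪u i, g j⟫ ^ 2
  have hlow (i) (hi : i ∈ V) : ∫ g, Real.exp (-(3 / 2) * S i g) ∂μ = (2 : ℝ)⁻¹ ^ k := by
    rw [integral_exp_sum_sq_inner_pi_stdGaussian (hu i hi),
      show (1 - 2 * (-(3 / 2)) : ℝ) = 2 ^ 2 by norm_num, Real.sqrt_sq (by norm_num)]
  have hup (i) (hi : i ∈ V) : ∫ g, Real.exp (3 / 8 * S i g) ∂μ = (2 : ℝ) ^ k := by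
    rw [integral_exp_sum_sq_inner_pi_stdGaussian (hu i hi),
      show (1 - 2 * (3 / 8) : ℝ) = 2⁻¹ ^ 2 by norm_num, Real.sqrt_sq (by norm_num), inv_inv]
  have hilow (i) (hi : i ∈ V) : Integrable (fun g => Real.exp (-(3 / 2) * S i g)) μ :=
    not_imp_comm.1 integral_undef (by rw [hlow i hi]; positivity)
  have hiup (i) (hi : i ∈ V) : Integrable (fun g => Real.exp (3 / 8 * S i g)) μ :=
    not_imp_comm.1 integral_undef (by rw [hup i hi]; positivity)
  let Φ : (Fin k → E) → ℝ := fun g => ∑ i ∈ V,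
    (Real.exp (k / 4) * Real.exp (-(3 / 2) * S i g) +
      Real.exp (-(2 * k)) * Real.exp (3 / 8 * S i g))
  have hi (i) (hi : i ∈ V) : Integrable (fun g => Real.exp (k / 4) * Real.exp (-(3 / 2) * S i g) +
      Real.exp (-(2 * k)) * Real.exp (3 / 8 * S i g)) μ :=
    ((hilow i hi).const_mul _).add ((hiup i hi).const_mul _)
  obtain ⟨g, hg⟩ := exists_le_integral (μ := μ) (f := Φ) (integrable_finsetSum _ hi)
  have hlog : (1 / 2 : ℝ) ≤ Real.log 2 := by linarith [Real.log_two_gt_d9]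
  have hlog' : Real.log 2 ≤ 1 := by linarith [Real.log_two_lt_d9]
  have hpow : (2 : ℝ) ^ k = Real.exp (k * Real.log 2) := by
    rw [mul_comm, Real.exp_mul, Real.exp_log two_pos, Real.rpow_natCast]
  have hk0 : (0 : ℝ) ≤ k := k.cast_nonneg
  have hint : ∫ g, Φ g ∂μ < 1 := by
    calc ∫ g, Φ g ∂μ = ∑ i ∈ V, (Real.exp (k / 4) * (2 : ℝ)⁻¹ ^ k +
          Real.exp (-(2 * k)) * (2 : ℝ) ^ k) := by
          rw [integral_finsetSum _ hi]
          refine Finset.sum_congr rfl fun i hi => ?_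
          rw [integral_add ((hilow i hi).const_mul _) ((hiup i hi).const_mul _),
            integral_const_mul, integral_const_mul, hlow i hi, hup i hi]
      _ ≤ ∑ i ∈ V, (Real.exp (-(k / 4)) + Real.exp (-(k / 4))) := by
          gcongr with i
          · rw [inv_pow, hpow, ← Real.exp_neg, ← Real.exp_add, Real.exp_le_exp]
            nlinarith
          · rw [hpow, ← Real.exp_add, Real.exp_le_exp]
            nlinarith
      _ = 2 * V.card * Real.exp (-(k / 4)) := by
          rw [Finset.sum_const, nsmul_eq_mul]
          ring
      _ < Real.exp (k / 4) * Real.exp (-(k / 4)) := by gcongr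
      _ = 1 := by rw [← Real.exp_add]; simp
  refine ⟨g, fun i hi => ?_⟩
  have hterm : Real.exp (k / 4) * Real.exp (-(3 / 2) * S i g) +
      Real.exp (-(2 * k)) * Real.exp (3 / 8 * S i g) < 1 :=
    (Finset.single_le_sum (f := fun i => Real.exp (k / 4) * Real.exp (-(3 / 2) * S i g) +
      Real.exp (-(2 * k)) * Real.exp (3 / 8 * S i g)) (fun _ _ => by positivity) hi).trans_lt
      (hg.trans_lt hint)
  rw [← Real.exp_add, ← Real.exp_add] at hterm
  have h₁ := Real.exp_lt_one_iff.1 ((lt_add_of_pos_right _ (Real.exp_pos _)).trans hterm)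
  have h₂ := Real.exp_lt_one_iff.1 ((lt_add_of_pos_left _ (Real.exp_pos _)).trans hterm)
  change S i g ∈ _
  constructor <;> linarith

end Gaussian

/-- A form of the **Johnson–Lindenstrauss lemma** with constant distortion. -/
theorem exists_euclideanSpace_map_norm_sub_bounds {X E : Type*} [Fintype X]
    [NormedAddCommGroup E] [InnerProductSpace ℝ E] [FiniteDimensional ℝ E]
    (hX : 2 ≤ Fintype.card X) (F : X → E) :
    ∃ k : ℕ, (k : ℝ) ≤ 14 * Real.log (Fintype.card X) ∧ ∃ c : ℝ, 0 < c ∧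
      ∃ f : X → EuclideanSpace ℝ (Fin k), ∀ x y,
        c * ‖F x - F y‖ ≤ ‖f x - f y‖ ∧ ‖f x - f y‖ ≤ 6 * c * ‖F x - F y‖ := by
  classical
  let _ : MeasurableSpace E := borel E
  have _ : BorelSpace E := ⟨rfl⟩
  set N := Fintype.card X
  have hN : (2 : ℝ) ≤ N := by exact_mod_cast hX
  have hlog : (1 / 2 : ℝ) ≤ Real.log N :=
    le_trans (by linarith [Real.log_two_gt_d9]) (Real.log_le_log two_pos hN)
  set k := ⌊12 * Real.log N⌋₊ + 1
  have hk : 12 * Real.log N < k := by exact_mod_cast Nat.lt_floor_add_one _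
  have hk' : (k : ℝ) ≤ 14 * Real.log N := by
    have := Nat.floor_le (a := 12 * Real.log N) (by positivity)
    push_cast [k]
    linarith
  let V : Finset (X × X) := {p | F p.1 ≠ F p.2}
  let u : X × X → E := fun p => ‖F p.1 - F p.2‖⁻¹ • (F p.1 - F p.2)
  have hu (p) (hp : p ∈ V) : ‖u p‖ = 1 :=
    norm_smul_inv_norm (𝕜 := ℝ) (sub_ne_zero.2 (by simpa [V] using hp))
  have hV : 2 * (V.card : ℝ) < Real.exp (k / 4) := by
    have h₁ : V.card ≤ N * N := by
      simpa [N] using Finset.card_le_univ V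
    have h₂ : (V.card : ℝ) ≤ N * N := by exact_mod_cast h₁
    have h₃ : (N : ℝ) ^ 3 < Real.exp (k / 4) := by
      rw [← Real.exp_log (show (0 : ℝ) < N ^ 3 by positivity), Real.exp_lt_exp, Real.log_pow]
      push_cast
      linarith
    nlinarith
  obtain ⟨g, hg⟩ := exists_sum_sq_inner_mem_Icc V u hu k hV
  have hk0 : (0 : ℝ) < k := by positivity
  refine ⟨k, hk', √(k / 6), by positivity, fun x => WithLp.toLp 2 fun j => ⟪F x, g j⟫, ?_⟩
  intro x y
  by_cases hxy : F x = F y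
  · simp [hxy]
  have hmem := hg (x, y) (by simpa [V] using hxy)
  have hpos : 0 < ‖F x - F y‖ := norm_pos_iff.2 (sub_ne_zero.2 hxy)
  have hsum : ‖(WithLp.toLp 2 fun j => ⟪F x, g j⟫ : EuclideanSpace ℝ (Fin k)) -
      WithLp.toLp 2 fun j => ⟪F y, g j⟫‖ ^ 2 =
      ‖F x - F y‖ ^ 2 * ∑ j, ⟪u (x, y), g j⟫ ^ 2 := by
    rw [EuclideanSpace.norm_sq_eq, Finset.mul_sum]
    refine Finset.sum_congr rfl fun j _ => ?_
    simp only [u, PiLp.sub_apply, Real.norm_eq_abs, sq_abs, real_inner_smul_left, inner_sub_left]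
    field_simp
  constructor
  · refine le_of_sq_le_sq ?_ (norm_nonneg _)
    rw [hsum, mul_pow, Real.sq_sqrt (by positivity), mul_comm]
    gcongr
    exact hmem.1
  · refine le_of_sq_le_sq ?_ (by positivity)
    rw [hsum, mul_pow, mul_pow, Real.sq_sqrt (by positivity), mul_comm]
    gcongr
    linarith [hmem.2]

end JohnsonLindenstrauss

section Bourgain

open Finset Metric

lemma card_filter_forall_ne {X K : Type*} [Fintype X] [DecidableEq X] [Fintype K] [DecidableEq K]
    (a : K) (B : Finset X) :
    (#{ω : X → K | ∀ z ∈ B, ω z ≠ a} : ℝ) =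
      (1 - (Fintype.card K : ℝ)⁻¹) ^ #B * (Fintype.card K : ℝ) ^ Fintype.card X := by
  have hK : 0 < Fintype.card K := Fintype.card_pos_iff.2 ⟨a⟩
  have hset : ({ω : X → K | ∀ z ∈ B, ω z ≠ a} : Finset (X → K)) =
      Fintype.piFinset fun z => if z ∈ B then {a}ᶜ else univ := by
    ext ω
    simp only [mem_filter, mem_univ, true_and, Fintype.mem_piFinset]
    refine forall_congr' fun z => ?_
    split_ifs with hz <;> simp [hz]
  have hterm (z : X) : ((#(if z ∈ B then ({a}ᶜ : Finset K) else univ) : ℕ) : ℝ) =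
      (if z ∈ B then 1 - (Fintype.card K : ℝ)⁻¹ else 1) * Fintype.card K := by
    split_ifs
    · rw [card_compl, card_singleton, Nat.cast_sub hK, Nat.cast_one, sub_mul,
        inv_mul_cancel₀ (by positivity), one_mul]
    · simp
  rw [hset, Fintype.card_piFinset, Nat.cast_prod]
  simp_rw [hterm]
  rw [prod_mul_distrib, prod_const, card_univ, prod_ite_mem, univ_inter, prod_const]

lemma one_twelfth_le_pow_mul_one_sub_pow {m b c : ℕ} (hm : 1 ≤ m) (hb : b ≤ 2 * m) (hc : m ≤ c) :
    (1 / 12 : ℝ) ≤ (1 - (2 * m : ℝ)⁻¹) ^ b * (1 - (1 - (2 * m : ℝ)⁻¹) ^ c) := by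
  have hm' : (1 : ℝ) ≤ m := by exact_mod_cast hm
  set p : ℝ := 1 - (2 * m : ℝ)⁻¹
  have hinv : (2 * m : ℝ)⁻¹ ≤ 1 / 2 := by
    rw [inv_le_comm₀ (by positivity) (by positivity)]
    linarith
  have hinv0 : 0 < (2 * m : ℝ)⁻¹ := by positivity
  have hmul : m * (2 * m : ℝ)⁻¹ = 1 / 2 := by field_simp
  have hp0 : 0 ≤ p := by simp only [p]; linarith
  have hp1 : p ≤ 1 := by simp only [p]; linarith
  have h₁ : 1 / 2 ≤ p ^ m := by
    have := one_add_mul_le_pow (a := -(2 * m : ℝ)⁻¹) (by linarith) m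
    rw [mul_neg, hmul, ← sub_eq_add_neg 1 (2 * m : ℝ)⁻¹] at this
    linarith
  have h₂ : p ^ m ≤ 2 / 3 := by
    have h := one_add_mul_le_pow (a := (2 * m : ℝ)⁻¹) (by linarith) m
    rw [hmul] at h
    have hle : p ^ m * (1 + (2 * m : ℝ)⁻¹) ^ m ≤ 1 := by
      rw [← mul_pow]
      refine pow_le_one₀ (by positivity) ?_
      simp only [p]
      nlinarith
    nlinarith [pow_nonneg hp0 m]
  have hb' : 1 / 4 ≤ p ^ b := by
    have : p ^ (2 * m) ≤ p ^ b := pow_le_pow_of_le_one hp0 hp1 hb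
    rw [mul_comm, pow_mul] at this
    nlinarith
  have hc' : p ^ c ≤ p ^ m := pow_le_pow_of_le_one hp0 hp1 hc
  calc (1 / 12 : ℝ) = 1 / 4 * (1 / 3) := by norm_num
    _ ≤ p ^ b * (1 - p ^ c) := by gcongr; linarith

lemma card_filter_miss_hit {X K : Type*} [Fintype X] [DecidableEq X] [Fintype K] [DecidableEq K]
    (a : K) {m : ℕ} (hm : 1 ≤ m) (hK : Fintype.card K = 2 * m) {B B' : Finset X}
    (hBB' : Disjoint B B') (hB : #B ≤ 2 * m) (hB' : m ≤ #B') :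
    1 / 12 * (Fintype.card K : ℝ) ^ Fintype.card X ≤
      #{ω : X → K | (∀ z ∈ B, ω z ≠ a) ∧ ∃ z ∈ B', ω z = a} := by
  have hsplit : #{ω : X → K | ∀ z ∈ B, ω z ≠ a} =
      #{ω : X → K | (∀ z ∈ B, ω z ≠ a) ∧ ∃ z ∈ B', ω z = a} +
      #{ω : X → K | ∀ z ∈ B ∪ B', ω z ≠ a} := by
    rw [← card_filter_add_card_filter_not (s := {ω : X → K | ∀ z ∈ B, ω z ≠ a})
      (fun ω => ∃ z ∈ B', ω z = a), filter_filter, filter_filter]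
    congr 3
    ext ω
    simp only [mem_union, or_imp, forall_and, not_exists, not_and, ne_eq]
  have hsplit' : (#{ω : X → K | ∀ z ∈ B, ω z ≠ a} : ℝ) =
      #{ω : X → K | (∀ z ∈ B, ω z ≠ a) ∧ ∃ z ∈ B', ω z = a} +
      #{ω : X → K | ∀ z ∈ B ∪ B', ω z ≠ a} := by exact_mod_cast hsplit
  rw [card_filter_forall_ne, card_filter_forall_ne, card_union_of_disjoint hBB', pow_add]
    at hsplit'
  have h := one_twelfth_le_pow_mul_one_sub_pow hm hB hB'
  rw [show (2 * m : ℝ) = Fintype.card K by rw [hK]; push_cast; rfl] at h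
  rw [eq_sub_of_add_eq hsplit'.symm]
  calc 1 / 12 * (Fintype.card K : ℝ) ^ Fintype.card X
      ≤ _ * (Fintype.card K : ℝ) ^ Fintype.card X :=
        mul_le_mul_of_nonneg_right h (by positivity)
    _ = _ := by ring

variable {X : Type*} [MetricSpace X] [Fintype X]

lemma sub_le_sum_abs_infDist_sub [DecidableEq X] {K : Type*} [Fintype K] (a : K) {m : ℕ}
    (hm : 1 ≤ m) (hK : Fintype.card K = 2 * m) {x y : X} {r s : ℝ} (hrs : r + s ≤ dist x y)
    (hr : #{z | dist z x < r} ≤ 2 * m) (hs : m ≤ #{z | dist z y ≤ s}) :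
    (r - s) / 12 * (Fintype.card K : ℝ) ^ Fintype.card X ≤
      ∑ ω : X → K, |infDist x {z | ω z = a} - infDist y {z | ω z = a}| := by
  classical
  rcases le_total r s with hle | hle
  · calc (r - s) / 12 * (Fintype.card K : ℝ) ^ Fintype.card X ≤ 0 :=
        mul_nonpos_of_nonpos_of_nonneg (by linarith) (by positivity)
      _ ≤ _ := sum_nonneg fun _ _ => abs_nonneg _
  set B : Finset X := {z | dist z x < r}
  set B' : Finset X := {z | dist z y ≤ s}
  have hdisj : Disjoint B B' := by
    rw [Finset.disjoint_left]
    intro z hz hz'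
    simp only [B, B', mem_filter, mem_univ, true_and] at hz hz'
    linarith [dist_triangle_left x y z]
  set A : Finset (X → K) := {ω | (∀ z ∈ B, ω z ≠ a) ∧ ∃ z ∈ B', ω z = a}
  calc (r - s) / 12 * (Fintype.card K : ℝ) ^ Fintype.card X
      = (1 / 12 * (Fintype.card K : ℝ) ^ Fintype.card X) * (r - s) := by ring
    _ ≤ #A * (r - s) :=
        mul_le_mul_of_nonneg_right (card_filter_miss_hit a hm hK hdisj hr hs) (by linarith)
    _ = ∑ _ω ∈ A, (r - s) := by rw [sum_const, nsmul_eq_mul]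
    _ ≤ ∑ ω ∈ A, |infDist x {z | ω z = a} - infDist y {z | ω z = a}| := by
        refine sum_le_sum fun ω hω => ?_
        simp only [A, B, B', mem_filter, mem_univ, true_and] at hω
        obtain ⟨hmiss, z, hz, hza⟩ := hω
        have h₁ : r ≤ infDist x {z | ω z = a} := by
          refine (le_infDist ⟨z, hza⟩).2 fun w hw => ?_
          by_contra! hlt
          exact hmiss w (by rwa [dist_comm]) hw
        have h₂ : infDist y {z | ω z = a} ≤ s :=
          (infDist_le_dist_of_mem (show z ∈ {z | ω z = a} from hza)).trans (by rwa [dist_comm])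
        exact (by linarith : r - s ≤ _).trans (le_abs_self _)
    _ ≤ _ := sum_le_sum_of_subset_of_nonneg (subset_univ _) fun _ _ _ => abs_nonneg _

lemma exists_radius_card_ball_lt_le_card_closedBall (x : X) (n : ℕ) {D : ℝ} (hD : 0 ≤ D) :
    ∃ r, 0 ≤ r ∧ r ≤ D ∧ (r < D → n ≤ #{z | dist z x ≤ r}) ∧
      (0 < r → #{z | dist z x < r} < n) := by
  classical
  let S : Finset ℝ := {r ∈ insert D (univ.image fun z => dist z x) |
    r = D ∨ n ≤ #{z | dist z x ≤ r}}
  have hDS : D ∈ S := by simp [S]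
  have hmem := S.min'_mem ⟨D, hDS⟩
  have hmin : ∀ s ∈ S, S.min' ⟨D, hDS⟩ ≤ s := fun s hs => S.min'_le s hs
  generalize S.min' ⟨D, hDS⟩ = r at hmem hmin
  have hmem' := hmem
  simp only [S, mem_filter, mem_insert, mem_image, mem_univ, true_and] at hmem'
  refine ⟨r, ?_, hmin D hDS, fun h => hmem'.2.resolve_left h.ne, fun hr => ?_⟩
  · rcases hmem'.1 with rfl | ⟨z, rfl⟩
    exacts [hD, dist_nonneg]
  · by_contra! hn
    obtain ⟨w, hw, hmax⟩ := exists_max_image ({z | dist z x < r} : Finset X)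
      (fun z => dist z x) ⟨x, by simpa using hr⟩
    have hwr : dist w x < r := by simpa using hw
    refine (hmin (dist w x) ?_).not_gt hwr
    simp only [S, mem_filter, mem_insert, mem_image, mem_univ, true_and]
    refine ⟨Or.inr ⟨w, rfl⟩, Or.inr (hn.trans (card_le_card fun z hz => ?_))⟩
    simpa using hmax z hz

/-- A scale parameter for a pair of points: the radius at which the balls around both points
first contain `n` points, truncated at `D`. -/
lemma exists_radius_card_balls_lt_le_card_closedBalls (x y : X) (n : ℕ) {D : ℝ} (hD : 0 ≤ D) :
    ∃ r, 0 ≤ r ∧ r ≤ D ∧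
      (r < D → n ≤ #{z | dist z x ≤ r} ∧ n ≤ #{z | dist z y ≤ r}) ∧
      (0 < r → #{z | dist z x < r} < n ∨ #{z | dist z y < r} < n) := by
  obtain ⟨r, hr0, hrD, hr, hr'⟩ := exists_radius_card_ball_lt_le_card_closedBall x n hD
  obtain ⟨s, hs0, hsD, hs, hs'⟩ := exists_radius_card_ball_lt_le_card_closedBall y n hD
  refine ⟨max r s, le_max_of_le_left hr0, max_le hrD hsD, fun h => ?_, fun h => ?_⟩
  · rw [max_lt_iff] at h
    exact ⟨(hr h.1).trans (card_le_card (monotone_filter_right _ fun z _ hz =>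
        le_max_of_le_left hz)),
      (hs h.2).trans (card_le_card (monotone_filter_right _ fun z _ hz =>
        le_max_of_le_right hz))⟩
  · rcases le_total r s with hle | hle
    · rw [max_eq_right hle] at h ⊢
      exact Or.inr (hs' h)
    · rw [max_eq_left hle] at h ⊢
      exact Or.inl (hr' h)

lemma dist_le_sum_average_abs_infDist_sub [DecidableEq X] {T : ℕ}
    (hT : Fintype.card X < 2 ^ T) (x y : X) :
    dist x y / 24 ≤ ∑ t : Fin T, ((2 ^ (t + 1 : ℕ) : ℝ) ^ Fintype.card X)⁻¹ *
      ∑ ω : X → Fin (2 ^ (t + 1 : ℕ)), |infDist x {z | ω z = 0} - infDist y {z | ω z = 0}| := by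
  choose r hr0 hrD hclosed hopen using fun t : ℕ =>
    exists_radius_card_balls_lt_le_card_closedBalls x y (2 ^ t) (D := dist x y / 2) (by positivity)
  have hr_zero : r 0 = 0 := by
    by_contra hne
    have hpos := (hr0 0).lt_of_ne' hne
    rcases hopen 0 hpos with h | h
    · have hx : x ∈ ({z | dist z x < r 0} : Finset X) := by simpa using hpos
      exact (card_pos.2 ⟨x, hx⟩).not_ge (by simpa using Nat.le_of_lt_succ h)
    · have hy : y ∈ ({z | dist z y < r 0} : Finset X) := by simpa using hpos
      exact (card_pos.2 ⟨y, hy⟩).not_ge (by simpa using Nat.le_of_lt_succ h)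
  have hr_last : r T = dist x y / 2 := by
    by_contra hne
    exact ((hclosed T ((hrD T).lt_of_ne hne)).1.trans (card_le_univ _)).not_gt hT
  have hterm (t : ℕ) : (r (t + 1) - r t) / 12 ≤ ((2 ^ (t + 1) : ℝ) ^ Fintype.card X)⁻¹ *
      ∑ ω : X → Fin (2 ^ (t + 1)), |infDist x {z | ω z = 0} - infDist y {z | ω z = 0}| := by
    rcases le_or_gt (r (t + 1)) (r t) with hle | hlt
    · calc (r (t + 1) - r t) / 12 ≤ 0 := by linarith
        _ ≤ _ := mul_nonneg (by positivity) (sum_nonneg fun _ _ => abs_nonneg _)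
    rw [inv_mul_eq_div, le_div_iff₀ (by positivity)]
    have hcl := hclosed t (hlt.trans_le (hrD _))
    have hm : 1 ≤ 2 ^ t := Nat.one_le_two_pow
    have hK : Fintype.card (Fin (2 ^ (t + 1))) = 2 * 2 ^ t := by rw [Fintype.card_fin, pow_succ']
    have hsum : r (t + 1) + r t ≤ dist x y := by linarith [hrD t, hrD (t + 1)]
    rcases hopen (t + 1) ((hr0 t).trans_lt hlt) with h | h
    · simpa using sub_le_sum_abs_infDist_sub (0 : Fin (2 ^ (t + 1))) hm hK hsum
        (h.le.trans_eq (pow_succ' 2 t)) hcl.2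
    · simp_rw [abs_sub_comm (infDist x _)]
      simpa using sub_le_sum_abs_infDist_sub (0 : Fin (2 ^ (t + 1))) hm hK
        (hsum.trans_eq (dist_comm x y)) (h.le.trans_eq (pow_succ' 2 t)) hcl.1
  calc dist x y / 24 = ∑ t ∈ range T, (r (t + 1) - r t) / 12 := by
        rw [← sum_div, sum_range_sub, hr_zero, hr_last]
        ring
    _ = ∑ t : Fin T, (r (t + 1) - r t) / 12 := (Fin.sum_univ_eq_sum_range _ T).symm
    _ ≤ _ := sum_le_sum fun t _ => hterm t

/-- **Bourgain's embedding theorem** without control on the dimension. -/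
theorem exists_euclideanSpace_map_dist_bounds [DecidableEq X] {T : ℕ}
    (hT : Fintype.card X < 2 ^ T) :
    ∃ F : X → EuclideanSpace ℝ (Σ t : Fin T, X → Fin (2 ^ (t + 1 : ℕ))), ∀ x y,
      dist x y ≤ 24 * √T * ‖F x - F y‖ ∧ ‖F x - F y‖ ≤ √T * dist x y := by
  let w : (Σ t : Fin T, X → Fin (2 ^ (t + 1 : ℕ))) → ℝ := fun p =>
    √((2 ^ (p.1 + 1 : ℕ) : ℝ) ^ Fintype.card X)⁻¹
  have hw (p) : w p ^ 2 = ((2 ^ (p.1 + 1 : ℕ) : ℝ) ^ Fintype.card X)⁻¹ :=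
    Real.sq_sqrt (by positivity)
  have hwsum : ∑ p, w p ^ 2 = T := by
    simp_rw [hw, Fintype.sum_sigma, sum_const, card_univ, nsmul_eq_mul]
    simp
  let δ (x y : X) (p : Σ t : Fin T, X → Fin (2 ^ (t + 1 : ℕ))) : ℝ :=
    |infDist x {z | p.2 z = 0} - infDist y {z | p.2 z = 0}|
  let F : X → EuclideanSpace ℝ (Σ t : Fin T, X → Fin (2 ^ (t + 1 : ℕ))) := fun x =>
    WithLp.toLp 2 fun p => w p * infDist x {z | p.2 z = 0}
  have hF (x y) : ‖F x - F y‖ ^ 2 = ∑ p, (w p * δ x y p) ^ 2 := by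
    rw [EuclideanSpace.norm_sq_eq]
    refine sum_congr rfl fun p _ => ?_
    simp only [F, δ, PiLp.sub_apply, ← mul_sub, Real.norm_eq_abs, sq_abs, mul_pow]
  refine ⟨F, fun x y => ⟨?_, ?_⟩⟩
  · refine le_of_sq_le_sq ?_ (by positivity)
    have h₁ := dist_le_sum_average_abs_infDist_sub hT x y
    have h₂ : dist x y / 24 ≤ ∑ p, w p * (w p * δ x y p) := by
      simp_rw [← mul_assoc, ← sq, hw, Fintype.sum_sigma, ← mul_sum]
      exact h₁
    have h₃ := sum_mul_sq_le_sq_mul_sq univ w (fun p => w p * δ x y p)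
    rw [hwsum, ← hF] at h₃
    have h₄ : (dist x y / 24) ^ 2 ≤ T * ‖F x - F y‖ ^ 2 :=
      (pow_le_pow_left₀ (by positivity) h₂ 2).trans h₃
    rw [mul_pow, mul_pow, Real.sq_sqrt (by positivity)]
    linarith
  · refine le_of_sq_le_sq ?_ (by positivity)
    rw [hF, mul_pow, Real.sq_sqrt (by positivity), ← hwsum, sum_mul]
    refine sum_le_sum fun p _ => ?_
    rw [mul_pow]
    gcongr
    exact abs_sub_le_iff.2 ⟨sub_le_iff_le_add'.2 infDist_le_infDist_add_dist,
      sub_le_iff_le_add'.2 (infDist_le_infDist_add_dist.trans_eq (by rw [dist_comm]))⟩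

end Bourgain

/-- **Bourgain's embedding theorem (with Johnson–Lindenstrauss dimension reduction).** There
is a universal constant `C > 0` such that every finite metric space on `N ≥ 2` points embeds
with distortion at most `C·log N` into the Euclidean space `ℝ^k` with `k ≤ C·log N`. -/
theorem bourgain_embedding :
    ∃ C : ℝ, 0 < C ∧
      ∀ (X : Type) [MetricSpace X] [Fintype X] (N : ℕ), Fintype.card X = N → 2 ≤ N →
        ∃ (k : ℕ), (k : ℝ) ≤ C * Real.log N ∧
          ∃ (lam : ℝ), 0 < lam ∧
            ∃ f : X → EuclideanSpace ℝ (Fin k),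
              ∀ x y : X,
                lam * dist x y ≤ ‖f x - f y‖ ∧
                ‖f x - f y‖ ≤ C * Real.log N * (lam * dist x y) := by
  classical
  refine ⟨432, by norm_num, ?_⟩
  rintro X _ _ N rfl hN
  have hT : Fintype.card X < 2 ^ (Nat.log 2 (Fintype.card X) + 1) :=
    Nat.lt_pow_succ_log_self one_lt_two _
  obtain ⟨F, hF⟩ := exists_euclideanSpace_map_dist_bounds hT
  obtain ⟨k, hk, c, hc, f, hf⟩ := exists_euclideanSpace_map_norm_sub_bounds hN F
  have hlog : Real.log 2 ≤ Real.log (Fintype.card X) :=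
    Real.log_le_log two_pos (by exact_mod_cast hN)
  have hlog2 := Real.log_two_gt_d9
  have hTlog : ((Nat.log 2 (Fintype.card X) + 1 : ℕ) : ℝ) ≤ 3 * Real.log (Fintype.card X) := by
    have h : (2 : ℝ) ^ Nat.log 2 (Fintype.card X) ≤ Fintype.card X := by
      exact_mod_cast Nat.pow_log_le_self 2 (by lia)
    have h' := Real.log_le_log (by positivity) h
    rw [Real.log_pow] at h'
    have := (Nat.log 2 (Fintype.card X)).cast_nonneg (α := ℝ)
    push_cast
    nlinarith
  generalize Nat.log 2 (Fintype.card X) + 1 = T at *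
  have hTpos : 0 < T := by
    by_contra! h
    interval_cases T
    lia
  have hsT : √(T : ℝ) ≠ 0 := by positivity
  have hsT' : √(T : ℝ) * √T = T := Real.mul_self_sqrt (by positivity)
  refine ⟨k, by linarith, c / (24 * √T), by positivity, f, fun x y => ?_⟩
  obtain ⟨hF₁, hF₂⟩ := hF x y
  obtain ⟨hf₁, hf₂⟩ := hf x y
  constructor
  · calc c / (24 * √T) * dist x y ≤ c / (24 * √T) * (24 * √T * ‖F x - F y‖) := by gcongr
      _ = c * ‖F x - F y‖ := by field_simp
      _ ≤ _ := hf₁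
  · calc ‖f x - f y‖ ≤ 6 * c * (√T * dist x y) := hf₂.trans (by gcongr)
      _ = 144 * (√T * √T) * (c / (24 * √T) * dist x y) := by
          field_simp
          ring
      _ = 144 * T * (c / (24 * √T) * dist x y) := by rw [hsT']
      _ ≤ 432 * Real.log (Fintype.card X) * (c / (24 * √T) * dist x y) :=
          mul_le_mul_of_nonneg_right (by linarith) (by positivity)
end

section
/- For every dimension d ≥ 1 and every norm ‖·‖ on ℝ^d, there exists an invertible linear map T : ℝ^d → ℝ^d such that ‖x‖ ≤ ‖T x‖₂ ≤ √d · ‖x‖ for all x ∈ ℝ^d. In other words, every d-dimensional normed space embeds into (ℝ^d, ℓ₂) with distortion √d via a linear map. -/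
open Matrix in
/-- A Hahn–Banach functional norming `x`, written as a dot product. -/
lemma Seminorm.exists_dotProduct_eq {ι : Type*} [Fintype ι] (p : Seminorm ℝ (ι → ℝ)) (x : ι → ℝ)
    (hx : x ≠ 0) : ∃ v : ι → ℝ, v ⬝ᵥ x = p x ∧ ∀ z, |v ⬝ᵥ z| ≤ p z := by
  classical
  let f : (ι → ℝ) →ₗ.[ℝ] ℝ := LinearPMap.mkSpanSingleton x (p x) hx
  have hf (z : f.domain) : f.toFun z ≤ p z := by
    obtain ⟨z, hz⟩ := z
    obtain ⟨c, rfl⟩ := Submodule.mem_span_singleton.mp hz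
    have h : f.toFun ⟨c • x, hz⟩ = c • p x := LinearPMap.mkSpanSingleton'_apply _ _ _ c hz
    rw [h, map_smul_eq_mul, smul_eq_mul, Real.norm_eq_abs]
    exact mul_le_mul_of_nonneg_right (le_abs_self c) (apply_nonneg p x)
  obtain ⟨g, hg, hgp⟩ := Module.Dual.exists_extension_of_le_seminorm_real f.domain f.toFun hf
  have hv (z : ι → ℝ) : (fun i ↦ g (Pi.single i 1)) ⬝ᵥ z = g z := by
    conv_rhs => rw [pi_eq_sum_univ' z]
    simp only [map_sum, map_smul, dotProduct, smul_eq_mul, mul_comm]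
  refine ⟨fun i ↦ g (Pi.single i 1), ?_, fun z ↦ (hv z).symm ▸ hgp z⟩
  rw [hv]
  exact (hg ⟨x, Submodule.mem_span_singleton_self x⟩).trans
    (LinearPMap.mkSpanSingleton'_apply_self _ _ _ _)

/-- A seminorm on a finite-dimensional space which is definite dominates a multiple of the norm. -/
lemma Seminorm.exists_pos_mul_norm_le {E : Type*} [NormedAddCommGroup E] [NormedSpace ℝ E]
    [FiniteDimensional ℝ E] (p : Seminorm ℝ E) (hp : ∀ x, p x = 0 → x = 0) :
    ∃ c > 0, ∀ x, c * ‖x‖ ≤ p x := by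
  have hcont : Continuous p := p.convexOn.locallyLipschitz.continuous
  rcases subsingleton_or_nontrivial E with hE | hE
  · exact ⟨1, one_pos, fun x ↦ by simp [Subsingleton.elim x 0]⟩
  obtain ⟨x₀, hx₀, hmin⟩ := (isCompact_sphere (0 : E) 1).exists_isMinOn
    (NormedSpace.sphere_nonempty.mpr zero_le_one) hcont.continuousOn
  have hx₀' : x₀ ≠ 0 := by
    rintro rfl
    simp at hx₀
  refine ⟨p x₀, (apply_nonneg p x₀).lt_of_ne fun h ↦ hx₀' (hp _ h.symm), fun x ↦ ?_⟩
  rcases eq_or_ne x 0 with rfl | hx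
  · simp
  have hn : 0 < ‖x‖ := norm_pos_iff.mpr hx
  have h : p x₀ ≤ p (‖x‖⁻¹ • x) := hmin (by simp [norm_smul, hn.ne'])
  rw [map_smul_eq_mul, norm_inv, norm_norm] at h
  calc p x₀ * ‖x‖ ≤ ‖x‖⁻¹ * p x * ‖x‖ := by gcongr
    _ = p x := by field_simp

open Matrix in
lemma Matrix.PosSemidef.exists_transpose_mul_self {ι : Type*} [Fintype ι]
    {M : Matrix ι ι ℝ} (hM : M.PosSemidef) : ∃ C : Matrix ι ι ℝ, M = Cᵀ * C := by
  classical
  open scoped MatrixOrder Matrix.Norms.L2Operator in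
  obtain ⟨C, hC⟩ := CStarAlgebra.nonneg_iff_eq_star_mul_self.mp hM.nonneg
  exact ⟨C, by rw [hC, star_eq_conjTranspose, conjTranspose_eq_transpose_of_trivial]⟩

open Matrix in
lemma Matrix.mulVec_dotProduct_mulVec {m n : Type*} [Fintype m] [Fintype n]
    (C : Matrix m n ℝ) (u w : n → ℝ) : (C *ᵥ u) ⬝ᵥ (C *ᵥ w) = u ⬝ᵥ ((Cᵀ * C) *ᵥ w) := by
  rw [← mulVec_mulVec, dotProduct_mulVec u, vecMul_transpose]

/-- The inequality behind the volume variation in John's theorem. -/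
lemma exists_one_lt_one_sub_pow_mul {n : ℕ} (hn : 1 ≤ n) {s : ℝ} (hs : n < s) :
    ∃ ε : ℝ, 0 < ε ∧ ε < 1 ∧ 1 < (1 - ε) ^ n * (1 + ε / (1 - ε) * s) := by
  obtain ⟨k, rfl⟩ : ∃ k, n = k + 1 := ⟨n - 1, by omega⟩
  push_cast at hs
  have hk : (0 : ℝ) ≤ k := k.cast_nonneg
  have hs1 : 0 < s := by linarith
  have hpos : 0 < (k + 1) * s := by positivity
  set ε : ℝ := (s - (k + 1)) / ((k + 1) * s) with hε
  have hmul : ε * ((k + 1) * s) = s - (k + 1) := div_mul_cancel₀ _ hpos.ne'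
  have hε0 : 0 < ε := div_pos (by linarith) hpos
  have hε1 : ε < 1 := by
    rw [hε, div_lt_one hpos]
    nlinarith
  refine ⟨ε, hε0, hε1, ?_⟩
  have hne : (1 - ε) ≠ 0 := by linarith
  have hbern : 1 - k * ε ≤ (1 - ε) ^ k := by
    have := one_add_mul_le_pow (a := -ε) (by linarith) k
    simpa [sub_eq_add_neg] using this
  have h : (1 - ε) ^ (k + 1) * (1 + ε / (1 - ε) * s) = (1 - ε) ^ k * (1 + ε * (s - 1)) := by
    rw [pow_succ]
    field_simp
    ring
  rw [h]
  have hfac : 0 < 1 + ε * (s - 1) := by nlinarith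
  refine lt_of_lt_of_le ?_ (mul_le_mul_of_nonneg_right hbern hfac.le)
  have : k * ε * (s - 1) < s - (k + 1) := by nlinarith [mul_nonneg hk hε0.le]
  nlinarith

open Matrix in
/-- If `|y|² > dim`, some convex combination of `|u|²` and `⟨y, u⟩²` is the squared length of
a linear image `C u` with `|det C| > 1`. -/
lemma exists_one_lt_sq_det_of_card_lt {ι : Type*} [Fintype ι] [DecidableEq ι] [Nonempty ι]
    {y : ι → ℝ} (hy : Fintype.card ι < y ⬝ᵥ y) :
    ∃ (C : Matrix ι ι ℝ) (ε : ℝ), 1 < C.det ^ 2 ∧ 0 < ε ∧ ε < 1 ∧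
      ∀ u, (C *ᵥ u) ⬝ᵥ (C *ᵥ u) = (1 - ε) * (u ⬝ᵥ u) + ε * (y ⬝ᵥ u) ^ 2 := by
  obtain ⟨ε, hε0, hε1, hε⟩ := exists_one_lt_one_sub_pow_mul Fintype.card_pos hy
  have hM : ((1 - ε) • (1 : Matrix ι ι ℝ) + ε • vecMulVec y y).PosSemidef :=
    (PosSemidef.one.smul (by linarith)).add
      ((by simpa using posSemidef_vecMulVec_self_star y : (vecMulVec y y).PosSemidef).smul hε0.le)
  obtain ⟨C, hC⟩ := hM.exists_transpose_mul_self
  refine ⟨C, ε, ?_, hε0, hε1, fun u ↦ ?_⟩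
  · have hne : (1 - ε) ≠ 0 := by linarith
    have hfac : (1 - ε) • (1 : Matrix ι ι ℝ) + ε • vecMulVec y y =
        (1 - ε) • (1 + replicateCol Unit ((ε / (1 - ε)) • y) * replicateRow Unit y) := by
      rw [← vecMulVec_eq, smul_add, smul_vecMulVec, smul_smul, mul_div_cancel₀ _ hne]
    have hdet : C.det ^ 2 = (Cᵀ * C).det := by rw [det_mul, det_transpose, sq]
    rw [hdet, ← hC, hfac, det_smul, det_one_add_replicateCol_mul_replicateRow,
      dotProduct_smul, smul_eq_mul]
    exact hε
  · rw [mulVec_dotProduct_mulVec, ← hC, add_mulVec, smul_mulVec, smul_mulVec, one_mulVec,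
      vecMulVec_mulVec, dotProduct_add, dotProduct_smul, dotProduct_smul]
    simp only [dotProduct_comm u y, smul_eq_mul, dotProduct_smul, op_smul_eq_smul]
    ring

open Matrix in
/-- Among the matrices `B` with `|B x| ≤ p x`, one maximizes `(det B)²`. -/
lemma Seminorm.exists_isMaxOn_sq_det {ι : Type*} [Fintype ι] [DecidableEq ι]
    (p : Seminorm ℝ (ι → ℝ)) :
    ∃ B ∈ {B : Matrix ι ι ℝ | ∀ x, (B *ᵥ x) ⬝ᵥ (B *ᵥ x) ≤ p x ^ 2},
      IsMaxOn (fun B : Matrix ι ι ℝ ↦ B.det ^ 2)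
        {B : Matrix ι ι ℝ | ∀ x, (B *ᵥ x) ⬝ᵥ (B *ᵥ x) ≤ p x ^ 2} B := by
  set S := {B : Matrix ι ι ℝ | ∀ x, (B *ᵥ x) ⬝ᵥ (B *ᵥ x) ≤ p x ^ 2}
  have hclosed : IsClosed S := by
    simp only [S, Set.ofPred_forall]
    exact isClosed_iInter fun x ↦ isClosed_le (by fun_prop) continuous_const
  have hbox : IsCompact (Set.univ.pi fun _ : ι ↦ Set.univ.pi fun j : ι ↦
      Set.Icc (-p (Pi.single j 1)) (p (Pi.single j 1)) : Set (Matrix ι ι ℝ)) :=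
    isCompact_univ_pi fun _ ↦ isCompact_univ_pi fun _ ↦ isCompact_Icc
  have hcompact : IsCompact S := by
    refine hbox.of_isClosed_subset hclosed fun (B : Matrix ι ι ℝ) hB i _ j _ ↦ ?_
    refine abs_le.mp (abs_le_of_sq_le_sq ?_ (apply_nonneg p _))
    refine le_trans ?_ (hB (Pi.single j 1))
    rw [mulVec_single_one, sq]
    exact Finset.single_le_sum (f := fun i ↦ B i j * B i j) (fun i _ ↦ mul_self_nonneg _)
      (Finset.mem_univ i)
  have hzero : (0 : Matrix ι ι ℝ) ∈ S := fun x ↦ by simp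
  exact hcompact.exists_isMaxOn ⟨0, hzero⟩ (by fun_prop)

lemma EuclideanSpace.norm_toLp_sq {ι : Type*} [Fintype ι] (x : ι → ℝ) :
    ‖WithLp.toLp 2 x‖ ^ 2 = x ⬝ᵥ x := by
  rw [EuclideanSpace.real_norm_sq_eq, dotProduct]
  simp only [sq]

open Matrix in
/-- John's theorem in matrix form. -/
lemma Seminorm.exists_matrix_john {ι : Type*} [Fintype ι] [DecidableEq ι] [Nonempty ι]
    (p : Seminorm ℝ (ι → ℝ)) (hp : ∀ x, p x = 0 → x = 0) :
    ∃ B : Matrix ι ι ℝ, B.det ≠ 0 ∧ ∀ x, (B *ᵥ x) ⬝ᵥ (B *ᵥ x) ≤ p x ^ 2 ∧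
      p x ^ 2 ≤ Fintype.card ι * ((B *ᵥ x) ⬝ᵥ (B *ᵥ x)) := by
  obtain ⟨B, hB, hmax⟩ := p.exists_isMaxOn_sq_det
  have hdet : B.det ≠ 0 := by
    let e := (WithLp.linearEquiv 2 ℝ (ι → ℝ)).toLinearMap
    obtain ⟨c, hc, hcp⟩ := (p.comp e).exists_pos_mul_norm_le fun x hx ↦ by
      simpa [e] using hp _ hx
    have hmem : ∀ x, ((c • (1 : Matrix ι ι ℝ)) *ᵥ x) ⬝ᵥ ((c • (1 : Matrix ι ι ℝ)) *ᵥ x) ≤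
        p x ^ 2 := fun x ↦ by
      have h : c * ‖WithLp.toLp 2 x‖ ≤ p x := hcp (WithLp.toLp 2 x)
      have h2 := pow_le_pow_left₀ (by positivity) h 2
      rw [mul_pow, EuclideanSpace.norm_toLp_sq] at h2
      simpa [smul_mulVec, sq, mul_assoc] using h2
    have hle : (c • (1 : Matrix ι ι ℝ)).det ^ 2 ≤ B.det ^ 2 := hmax hmem
    rw [det_smul, det_one, mul_one] at hle
    have : 0 < B.det ^ 2 := lt_of_lt_of_le (by positivity) hle
    exact fun h ↦ by simp [h] at this
  refine ⟨B, hdet, fun x ↦ ⟨hB x, ?_⟩⟩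
  by_contra! hlt
  have hnn (u : ι → ℝ) : 0 ≤ u ⬝ᵥ u := Finset.sum_nonneg fun i _ ↦ mul_self_nonneg _
  have hx : x ≠ 0 := by
    rintro rfl
    simp at hlt
  obtain ⟨v, hvx, hv⟩ := p.exists_dotProduct_eq x hx
  set y := v ᵥ* B⁻¹
  have hy (z : ι → ℝ) : y ⬝ᵥ (B *ᵥ z) = v ⬝ᵥ z := by
    rw [dotProduct_mulVec, vecMul_vecMul, nonsing_inv_mul B hdet.isUnit, vecMul_one]
  have hcs : p x ^ 2 ≤ (y ⬝ᵥ y) * ((B *ᵥ x) ⬝ᵥ (B *ᵥ x)) := by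
    rw [← hvx, ← hy]
    simpa only [dotProduct, sq] using
      Finset.sum_mul_sq_le_sq_mul_sq Finset.univ y (B *ᵥ x)
  have hcard : Fintype.card ι < y ⬝ᵥ y :=
    lt_of_mul_lt_mul_right (hlt.trans_le hcs) (hnn _)
  obtain ⟨C, ε, hC, hε0, hε1, hCu⟩ := exists_one_lt_sq_det_of_card_lt hcard
  have hmem : ∀ z, ((C * B) *ᵥ z) ⬝ᵥ ((C * B) *ᵥ z) ≤ p z ^ 2 := fun z ↦ by
    rw [← mulVec_mulVec, hCu, hy]
    have h1 : (v ⬝ᵥ z) ^ 2 ≤ p z ^ 2 := sq_le_sq.mpr ((hv z).trans (le_abs_self _))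
    calc (1 - ε) * ((B *ᵥ z) ⬝ᵥ (B *ᵥ z)) + ε * (v ⬝ᵥ z) ^ 2
        ≤ (1 - ε) * p z ^ 2 + ε * p z ^ 2 := by
          gcongr
          exact hB z
      _ = p z ^ 2 := by ring
  have hle : (C * B).det ^ 2 ≤ B.det ^ 2 := hmax hmem
  rw [det_mul, mul_pow] at hle
  have : 0 < B.det ^ 2 := by positivity
  nlinarith

/-- **John's theorem.** Every `d`-dimensional normed space embeds into `(ℝ^d, ℓ₂)` with
distortion `√d` via a linear map: for every norm `nrm` on `ℝ^d` there is an invertible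
linear map `T : ℝ^d → ℝ^d` with `nrm x ≤ ‖T x‖₂ ≤ √d · nrm x` for all `x`. -/
theorem john_ellipsoid_embedding (d : ℕ) (hd : 1 ≤ d)
    (nrm : (Fin d → ℝ) → ℝ)
    (hdef : ∀ x, nrm x = 0 ↔ x = 0)
    (hhom : ∀ (a : ℝ) (x), nrm (a • x) = |a| * nrm x)
    (htri : ∀ x y, nrm (x + y) ≤ nrm x + nrm y) :
    ∃ T : (Fin d → ℝ) →ₗ[ℝ] EuclideanSpace ℝ (Fin d),
      Function.Bijective T ∧
      ∀ x, nrm x ≤ ‖T x‖ ∧ ‖T x‖ ≤ Real.sqrt d * nrm x := by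
  have : Nonempty (Fin d) := ⟨⟨0, hd⟩⟩
  let p : Seminorm ℝ (Fin d → ℝ) := Seminorm.of nrm htri hhom
  have hnn (x : Fin d → ℝ) : 0 ≤ nrm x := apply_nonneg p x
  obtain ⟨B, hdet, hB⟩ := p.exists_matrix_john fun x ↦ (hdef x).mp
  have hd0 : (0 : ℝ) < √d := Real.sqrt_pos.mpr (by exact_mod_cast hd)
  have hunit : IsUnit (√d • B) := by
    rw [Matrix.isUnit_iff_isUnit_det, Matrix.det_smul]
    exact (mul_ne_zero (pow_ne_zero _ hd0.ne') hdet).isUnit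
  let T : (Fin d → ℝ) →ₗ[ℝ] EuclideanSpace ℝ (Fin d) :=
    (WithLp.linearEquiv 2 ℝ (Fin d → ℝ)).symm.toLinearMap ∘ₗ (√d • B).mulVecLin
  have hT (x : Fin d → ℝ) :
      ‖T x‖ ^ 2 = d * (dotProduct (B.mulVec x) (B.mulVec x)) := by
    have h : T x = WithLp.toLp 2 (√d • B.mulVec x) := by
      simp [T]
    rw [h, EuclideanSpace.norm_toLp_sq, smul_dotProduct, dotProduct_smul, smul_eq_mul, smul_eq_mul,
      ← mul_assoc, Real.mul_self_sqrt d.cast_nonneg]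
  refine ⟨T, (WithLp.linearEquiv 2 ℝ (Fin d → ℝ)).symm.bijective.comp
    ⟨Matrix.mulVec_injective_iff_isUnit.mpr hunit,
      Matrix.mulVec_surjective_iff_isUnit.mpr hunit⟩, fun x ↦ ⟨?_, ?_⟩⟩
  · refine le_of_sq_le_sq ?_ (norm_nonneg _)
    rw [hT]
    have h := (hB x).2
    rw [Fintype.card_fin] at h
    exact h
  · refine le_of_sq_le_sq ?_ (mul_nonneg hd0.le (hnn x))
    rw [hT, mul_pow, Real.sq_sqrt d.cast_nonneg]
    exact mul_le_mul_of_nonneg_left (hB x).1 d.cast_nonneg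
end

section
/- For every real p with 1 ≤ p < 2 and every dimension d ≥ 1, there exists a map f : ℝ^d → ℓ₂(ℕ) (the real Hilbert space of square-summable sequences) such that for all x, y ∈ ℝ^d, ‖f(x) − f(y)‖₂² = ‖x − y‖_p^p, where ‖x − y‖_p = (Σ_{i=1}^d |x_i − y_i|^p)^{1/p}. -/
open MeasureTheory Set

/-- An orthonormal family in a separable inner product space is countable. -/
theorem Orthonormal.countable_of_secondCountable {E ι : Type*} [NormedAddCommGroup E]
    [InnerProductSpace ℝ E] [SecondCountableTopology E] {v : ι → E} (hv : Orthonormal ℝ v) :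
    Countable ι := by
  have hdisj : (univ : Set ι).PairwiseDisjoint fun i => Metric.ball (v i) (1 / 2) := by
    intro i _ j _ hij
    apply Metric.ball_disjoint_ball
    have h : ‖v i - v j‖ ^ 2 = 2 := by
      rw [norm_sub_sq_real, hv.1 i, hv.1 j, hv.2 hij]
      norm_num
    rw [dist_eq_norm]
    nlinarith [norm_nonneg (v i - v j)]
  have := hdisj.countable_of_isOpen (fun _ _ => Metric.isOpen_ball)
    (fun i _ => ⟨v i, Metric.mem_ball_self (by norm_num)⟩)
  exact countable_univ_iff.mp this

/-- Every separable real Hilbert space embeds linearly and isometrically into `ℓ₂(ℕ)`. -/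
theorem exists_linearIsometry_lp_nat (E : Type*) [NormedAddCommGroup E] [InnerProductSpace ℝ E]
    [CompleteSpace E] [SecondCountableTopology E] :
    Nonempty (E →ₗᵢ[ℝ] lp (fun _ : ℕ => ℝ) 2) := by
  classical
  obtain ⟨w, b, -⟩ := exists_hilbertBasis ℝ E
  have : Countable w := b.orthonormal.countable_of_secondCountable
  obtain ⟨e, he⟩ := exists_injective_nat w
  let c : HilbertBasis ℕ ℝ (lp (fun _ : ℕ => ℝ) 2) := ⟨LinearIsometryEquiv.refl ℝ _⟩
  have hc : Orthonormal ℝ (c ∘ e) := c.orthonormal.comp e he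
  exact ⟨hc.orthogonalFamily.linearIsometry.comp b.repr.toLinearIsometry⟩

/-- The squared modulus `‖exp (i u t) - 1‖²` is integrable against `t ^ (-1 - p)` on `(0, ∞)`. -/
theorem integrableOn_norm_exp_sub_one_sq_mul_rpow {p : ℝ} (hp : 0 < p) (hp2 : p < 2) (u : ℝ) :
    IntegrableOn (fun t : ℝ => ‖Complex.exp (Complex.I * (u * t : ℝ)) - 1‖ ^ 2 * t ^ (-1 - p))
      (Ioi 0) := by
  have hm : Measurable
      (fun t : ℝ => ‖Complex.exp (Complex.I * (u * t : ℝ)) - 1‖ ^ 2 * t ^ (-1 - p)) := by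
    fun_prop
  rw [← Ioc_union_Ioi_eq_Ioi zero_le_one]
  refine IntegrableOn.union ?_ ?_
  · have h : IntegrableOn (fun t : ℝ => u ^ 2 * t ^ (1 - p)) (Ioc 0 1) := by
      rw [← intervalIntegrable_iff_integrableOn_Ioc_of_le zero_le_one]
      exact (intervalIntegral.intervalIntegrable_rpow' (by linarith)).const_mul _
    refine h.mono' hm.aestronglyMeasurable ?_
    filter_upwards [ae_restrict_mem measurableSet_Ioc] with t ht
    have ht0 : 0 < t := ht.1
    have hle := Real.norm_exp_I_mul_ofReal_sub_one_le (x := u * t)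
    have hsplit : t ^ (1 - p) = t ^ 2 * t ^ (-1 - p) := by
      rw [← Real.rpow_natCast, ← Real.rpow_add ht0]
      congr 1
      push_cast
      ring
    rw [Real.norm_of_nonneg (by positivity), hsplit, ← mul_assoc, ← mul_pow]
    gcongr ?_ * _
    calc _ ≤ ‖u * t‖ ^ 2 := by gcongr
      _ = (u * t) ^ 2 := by rw [Real.norm_eq_abs, sq_abs]
  · have h : IntegrableOn (fun t : ℝ => 4 * t ^ (-1 - p)) (Ioi 1) :=
      (integrableOn_Ioi_rpow_of_lt (by linarith) one_pos).const_mul _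
    refine h.mono' hm.aestronglyMeasurable ?_
    filter_upwards [ae_restrict_mem measurableSet_Ioi] with t ht
    have ht0 : 0 < t := one_pos.trans ht
    have hle : ‖Complex.exp (Complex.I * (u * t : ℝ)) - 1‖ ≤ 2 := by
      refine (norm_sub_le _ _).trans ?_
      rw [Complex.norm_exp_I_mul_ofReal, norm_one]
      norm_num
    rw [Real.norm_of_nonneg (by positivity)]
    gcongr ?_ * _
    nlinarith [norm_nonneg (Complex.exp (Complex.I * (u * t : ℝ)) - 1)]

theorem norm_exp_I_mul_abs_sub_one (u t : ℝ) :
    ‖Complex.exp (Complex.I * (|u| * t : ℝ)) - 1‖ = ‖Complex.exp (Complex.I * (u * t : ℝ)) - 1‖ := by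
  rcases abs_choice u with h | h
  · rw [h]
  · rw [h, Complex.norm_exp_I_mul_ofReal_sub_one, Complex.norm_exp_I_mul_ofReal_sub_one]
    simp [neg_mul, neg_div, Real.sin_neg]

theorem integral_norm_exp_sub_one_sq_mul_rpow {p : ℝ} (hp : 0 < p) (u : ℝ) :
    ∫ t in Ioi (0 : ℝ), ‖Complex.exp (Complex.I * (u * t : ℝ)) - 1‖ ^ 2 * t ^ (-1 - p) =
      |u| ^ p * ∫ t in Ioi (0 : ℝ), ‖Complex.exp (Complex.I * t) - 1‖ ^ 2 * t ^ (-1 - p) := by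
  rcases eq_or_ne u 0 with rfl | hu
  · simp [Real.zero_rpow hp.ne']
  have hu0 : 0 < |u| := abs_pos.mpr hu
  have h := integral_comp_mul_left_Ioi
    (fun t : ℝ => ‖Complex.exp (Complex.I * t) - 1‖ ^ 2 * t ^ (-1 - p)) 0 hu0
  rw [mul_zero, smul_eq_mul] at h
  have hpow : |u| ^ p = |u| ^ (1 + p) * |u|⁻¹ := by
    rw [← Real.rpow_neg_one, ← Real.rpow_add hu0]
    congr 1
    ring
  rw [hpow, mul_assoc, ← h, ← integral_const_mul]
  refine setIntegral_congr_fun measurableSet_Ioi fun t ht => ?_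
  have hinv : |u| ^ (1 + p) * |u| ^ (-1 - p) = 1 := by
    rw [← Real.rpow_add hu0]
    ring_nf
    exact Real.rpow_zero _
  rw [norm_exp_I_mul_abs_sub_one, Real.mul_rpow hu0.le (le_of_lt ht)]
  linear_combination -(‖Complex.exp (Complex.I * (u * t : ℝ)) - 1‖ ^ 2 * t ^ (-1 - p)) * hinv

theorem integral_norm_exp_sub_one_sq_mul_rpow_pos {p : ℝ} (hp : 0 < p) (hp2 : p < 2) :
    0 < ∫ t in Ioi (0 : ℝ), ‖Complex.exp (Complex.I * t) - 1‖ ^ 2 * t ^ (-1 - p) := by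
  have hint := integrableOn_norm_exp_sub_one_sq_mul_rpow hp hp2 1
  simp only [one_mul] at hint
  rw [setIntegral_pos_iff_support_of_nonneg_ae _ hint]
  · refine lt_of_lt_of_le ?_ (measure_mono (s := Ioo (0 : ℝ) 1) fun t ht => ⟨?_, ht.1⟩)
    · simp
    · have hsin : 0 < Real.sin (t / 2) :=
        Real.sin_pos_of_pos_of_lt_pi (by linarith [ht.1]) (by linarith [ht.2, Real.pi_gt_three])
      have := Real.rpow_pos_of_pos ht.1 (-1 - p)
      rw [Function.mem_support, Complex.norm_exp_I_mul_ofReal_sub_one]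
      have : 0 < ‖2 * Real.sin (t / 2)‖ := by
        rw [norm_pos_iff]
        positivity
      positivity
  · filter_upwards [ae_restrict_mem measurableSet_Ioi] with t ht
    have : 0 < t := ht
    simp only [Pi.zero_apply]
    positivity

/-- The curve `x ↦ (exp (i x t) - 1) t ^ (-(1 + p) / 2)`, whose increments in `L²(0, ∞)` have
squared norm proportional to `|x - y| ^ p`. -/
noncomputable def snowflakeCurve (p x t : ℝ) : ℂ :=
  (Complex.exp (Complex.I * (x * t : ℝ)) - 1) * (t ^ ((-1 - p) / 2) : ℝ)

theorem norm_snowflakeCurve_sub_sq (p x y : ℝ) {t : ℝ} (ht : 0 < t) :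
    ‖snowflakeCurve p x t - snowflakeCurve p y t‖ ^ 2 =
      ‖Complex.exp (Complex.I * ((x - y) * t : ℝ)) - 1‖ ^ 2 * t ^ (-1 - p) := by
  have h : snowflakeCurve p x t - snowflakeCurve p y t =
      Complex.exp (Complex.I * (y * t : ℝ)) *
        (Complex.exp (Complex.I * ((x - y) * t : ℝ)) - 1) * (t ^ ((-1 - p) / 2) : ℝ) := by
    rw [mul_sub, ← Complex.exp_add, snowflakeCurve, snowflakeCurve]
    push_cast
    ring_nf
  rw [h, norm_mul, norm_mul, Complex.norm_exp_I_mul_ofReal, one_mul, mul_pow,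
    Complex.norm_real, Real.norm_of_nonneg (by positivity), ← Real.rpow_mul_natCast ht.le]
  congr 2
  push_cast
  ring

theorem memLp_snowflakeCurve {p : ℝ} (hp : 0 < p) (hp2 : p < 2) (x : ℝ) :
    MemLp (snowflakeCurve p x) 2 (volume.restrict (Ioi 0)) := by
  have hm : Measurable (snowflakeCurve p x) := by
    unfold snowflakeCurve
    fun_prop
  rw [memLp_two_iff_integrable_sq_norm hm.aestronglyMeasurable]
  refine (integrableOn_norm_exp_sub_one_sq_mul_rpow hp hp2 x).congr ?_
  filter_upwards [ae_restrict_mem measurableSet_Ioi] with t ht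
  have h0 : snowflakeCurve p 0 t = 0 := by simp [snowflakeCurve]
  simpa [h0] using (norm_snowflakeCurve_sub_sq p x 0 ht).symm

theorem exists_map_Lp_norm_sub_sq_eq_rpow {p : ℝ} (hp : 0 < p) (hp2 : p < 2) :
    ∃ g : ℝ → Lp ℂ 2 (volume.restrict (Ioi (0 : ℝ))), ∀ x y, ‖g x - g y‖ ^ 2 = |x - y| ^ p := by
  set K := ∫ t in Ioi (0 : ℝ), ‖Complex.exp (Complex.I * t) - 1‖ ^ 2 * t ^ (-1 - p) with hK
  have hKpos : 0 < K := integral_norm_exp_sub_one_sq_mul_rpow_pos hp hp2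
  refine ⟨fun x => (√K)⁻¹ • (memLp_snowflakeCurve hp hp2 x).toLp _, fun x y => ?_⟩
  rw [← smul_sub, norm_smul, mul_pow, ← MemLp.toLp_sub]
  have h : ‖((memLp_snowflakeCurve hp hp2 x).sub (memLp_snowflakeCurve hp hp2 y)).toLp _‖ ^ 2 =
      |x - y| ^ p * K := by
    rw [← real_inner_self_eq_norm_sq, L2.inner_def, hK,
      ← integral_norm_exp_sub_one_sq_mul_rpow hp]
    refine integral_congr_ae ?_
    filter_upwards [ae_restrict_mem measurableSet_Ioi, MemLp.coeFn_toLp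
      ((memLp_snowflakeCurve hp hp2 x).sub (memLp_snowflakeCurve hp hp2 y))] with t ht hft
    rw [hft, real_inner_self_eq_norm_sq, Pi.sub_apply, norm_snowflakeCurve_sub_sq p x y ht]
  rw [h, norm_inv, inv_pow, Real.norm_eq_abs, sq_abs, Real.sq_sqrt hKpos.le]
  field_simp

/-- **Schoenberg's embedding.** For every `1 ≤ p < 2` and every `d ≥ 1`, there is a map
`f : ℝ^d → ℓ₂(ℕ)` such that `‖f(x) − f(y)‖₂² = ‖x − y‖_p^p = ∑ᵢ |xᵢ − yᵢ|^p` for all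
`x, y ∈ ℝ^d`. -/
theorem schoenberg_embedding (p : ℝ) (hp : 1 ≤ p) (hp2 : p < 2) (d : ℕ) (hd : 1 ≤ d) :
    ∃ f : (Fin d → ℝ) → lp (fun _ : ℕ => ℝ) 2,
      ∀ x y : Fin d → ℝ, ‖f x - f y‖ ^ 2 = ∑ i, |x i - y i| ^ p := by
  obtain ⟨g, hg⟩ := exists_map_Lp_norm_sub_sq_eq_rpow (one_pos.trans_le hp) hp2
  have : Fact ((2 : ENNReal) ≠ ⊤) := ⟨ENNReal.ofNat_ne_top⟩
  obtain ⟨L⟩ := exists_linearIsometry_lp_nat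
    (PiLp 2 fun _ : Fin d => Lp ℂ 2 (volume.restrict (Ioi (0 : ℝ))))
  refine ⟨fun x => L (WithLp.toLp 2 fun i => g (x i)), fun x y => ?_⟩
  rw [← map_sub, L.norm_map, PiLp.norm_sq_eq_of_L2]
  exact Finset.sum_congr rfl fun i _ => hg (x i) (y i)
end

section
/- There is a universal constant C > 0 such that for every dimension d ≥ 1, every real θ ≥ 1, every real s > 1, and every ε ∈ (0, 1), there exists a probability distribution μ, supported on finitely many real polynomials P in d variables of total degree at most C·ε^{−1/3}·log s, satisfying the following for every x ∈ {0,1}^d: (i) if Σ_{i=1}^d x_i ≤ θ, then Pr_{P∼μ}[|P(x)| ≤ 1] ≥ 1 − 1/s; (ii) if θ < Σ_{i=1}^d x_i < (1+ε)θ, then Pr_{P∼μ}[|P(x)| > 1] ≥ 1 − 1/s; (iii) if Σ_{i=1}^d x_i > (1+ε)θ, then Pr_{P∼μ}[|P(x)| ≥ s] ≥ 1 − 1/s. -/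
open Polynomial in
theorem Polynomial.exists_eval_natCast_eq_sum_range (q : ℝ[X]) :
    ∃ E : ℝ[X], E.natDegree ≤ q.natDegree + 1 ∧
      ∀ n : ℕ, E.eval (n : ℝ) = ∑ i ∈ Finset.range n, q.eval (i : ℝ) := by
  let S : ℕ → ℝ[X] := fun p => ∑ i ∈ Finset.range (p + 1),
    C (((_root_.bernoulli i * ((p + 1).choose i) / (p + 1) : ℚ)) : ℝ) * X ^ (p + 1 - i)
  have hS (p n : ℕ) : (S p).eval (n : ℝ) = ∑ k ∈ Finset.range n, (k : ℝ) ^ p := by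
    have h := congrArg (fun r : ℚ => (r : ℝ)) (sum_range_pow n p)
    simp only [Rat.cast_sum, Rat.cast_pow, Rat.cast_natCast] at h
    rw [h, eval_finsetSum]
    refine Finset.sum_congr rfl fun i _ => ?_
    simp only [eval_mul, eval_C, eval_pow, eval_X]
    push_cast
    ring
  refine ⟨∑ p ∈ Finset.range (q.natDegree + 1), C (q.coeff p) * S p, ?_, fun n => ?_⟩
  · refine natDegree_sum_le_of_forall_le _ _ fun p hp => ?_
    refine (natDegree_C_mul_le _ _).trans (natDegree_sum_le_of_forall_le _ _ fun i _ => ?_)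
    refine (natDegree_C_mul_X_pow_le _ _).trans ?_
    have := Finset.mem_range.mp hp
    omega
  · simp only [eval_finsetSum, eval_mul, eval_C, hS, Finset.mul_sum]
    rw [Finset.sum_comm]
    exact Finset.sum_congr rfl fun i _ => (eval_eq_sum_range _).symm

open Polynomial in
/-- A polynomial of degree linear in the lengths of two adjacent integer windows vanishing on the
first one, equal to `1` on the second one, and at least `1` on all later integers. -/
theorem Polynomial.exists_step (m k : ℕ) :
    ∃ F : ℝ[X], F.natDegree ≤ m + 2 * k ∧ (∀ n : ℕ, n < m → F.eval (n : ℝ) = 0) ∧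
      (∀ n : ℕ, m ≤ n → n ≤ m + k → F.eval (n : ℝ) = 1) ∧
      ∀ n : ℕ, m ≤ n → 1 ≤ F.eval (n : ℝ) := by
  rcases m with _ | m
  · exact ⟨1, by simp, by simp, by simp, by simp⟩
  let r : ℝ[X] := (∏ j ∈ Finset.range m, (X - C (j : ℝ))) *
    (∏ j ∈ Finset.Ico (m + 1) (m + 1 + k), (X - C (j : ℝ))) ^ 2
  have hr (x : ℝ) : r.eval x = (∏ j ∈ Finset.range m, (x - j)) *
      (∏ j ∈ Finset.Ico (m + 1) (m + 1 + k), (x - j)) ^ 2 := by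
    simp [r, eval_prod]
  have hrdeg : r.natDegree ≤ m + 2 * k := by
    refine natDegree_mul_le.trans (add_le_add ?_ (natDegree_pow_le.trans ?_))
    · refine (natDegree_prod_le _ _).trans ?_
      simp only [natDegree_X_sub_C, Finset.sum_const, Finset.card_range, smul_eq_mul, mul_one,
        le_refl]
    · gcongr
      refine (natDegree_prod_le _ _).trans ?_
      simp only [natDegree_X_sub_C, Finset.sum_const, Nat.card_Ico, smul_eq_mul, mul_one]
      omega
  clear_value r
  have hr0 : 0 < r.eval (m : ℝ) := by
    rw [hr]
    refine mul_pos (Finset.prod_pos fun j hj => ?_) (sq_pos_of_ne_zero ?_)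
    · have : (j : ℝ) < m := by exact_mod_cast Finset.mem_range.mp hj
      linarith
    · refine Finset.prod_ne_zero_iff.mpr fun j hj => ?_
      have : (m : ℝ) + 1 ≤ j := by exact_mod_cast (Finset.mem_Ico.mp hj).1
      linarith
  have hrlow (i : ℕ) (hi : i < m) : r.eval (i : ℝ) = 0 := by
    rw [hr, Finset.prod_eq_zero (Finset.mem_range.mpr hi) (sub_self _), zero_mul]
  have hrmid (i : ℕ) (hi : m + 1 ≤ i) (hi' : i < m + 1 + k) : r.eval (i : ℝ) = 0 := by
    rw [hr, Finset.prod_eq_zero (Finset.mem_Ico.mpr ⟨hi, hi'⟩) (sub_self _)]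
    simp
  have hrnn (i : ℕ) (hi : m ≤ i) : 0 ≤ r.eval (i : ℝ) := by
    rw [hr]
    refine mul_nonneg (Finset.prod_nonneg fun j hj => ?_) (sq_nonneg _)
    have : (j : ℝ) < i := by exact_mod_cast (Finset.mem_range.mp hj).trans_le hi
    linarith
  obtain ⟨E, hE, hEs⟩ := (C (r.eval (m : ℝ))⁻¹ * r).exists_eval_natCast_eq_sum_range
  have hzero (n : ℕ) (hn : n < m + 1) : E.eval (n : ℝ) = 0 := by
    rw [hEs]
    refine Finset.sum_eq_zero fun i hi => ?_
    rw [eval_mul, hrlow i (by have := Finset.mem_range.mp hi; omega), mul_zero]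
  have hsucc (n : ℕ) : E.eval ((n + 1 : ℕ) : ℝ) =
      E.eval (n : ℝ) + (r.eval (m : ℝ))⁻¹ * r.eval (n : ℝ) := by
    rw [hEs, hEs, Finset.sum_range_succ, eval_mul, eval_C]
  have hone : E.eval ((m + 1 : ℕ) : ℝ) = 1 := by
    rw [hsucc, hzero m (by omega), inv_mul_cancel₀ hr0.ne', zero_add]
  refine ⟨E, ?_, hzero, fun n hn => ?_, fun n hn => ?_⟩
  · have := natDegree_C_mul_le (r.eval (m : ℝ))⁻¹ r
    omega
  · induction n, hn using Nat.le_induction with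
    | base => exact fun _ => hone
    | succ n hn ih =>
      intro h
      rw [hsucc, ih (by omega), hrmid n hn (by omega)]
      simp
  · induction n, hn using Nat.le_induction with
    | base => exact hone.ge
    | succ n hn ih =>
      rw [hsucc]
      have := mul_nonneg (inv_nonneg.mpr hr0.le) (hrnn n (by omega))
      linarith

theorem MvPolynomial.totalDegree_aeval_sum_X_le {d : ℕ} (S : Finset (Fin d))
    (F : Polynomial ℝ) :
    (Polynomial.aeval (∑ i ∈ S, (X i : MvPolynomial (Fin d) ℝ)) F).totalDegree
      ≤ F.natDegree := by
  rw [Polynomial.aeval_eq_sum_range]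
  refine totalDegree_finsetSum_le fun i hi => ?_
  refine (totalDegree_smul_le _ _).trans ((totalDegree_pow _ _).trans ?_)
  have h : (∑ i ∈ S, (X i : MvPolynomial (Fin d) ℝ)).totalDegree ≤ 1 :=
    totalDegree_finsetSum_le fun i _ => (totalDegree_X i).le
  have := Finset.mem_range.mp hi
  nlinarith

theorem MvPolynomial.eval_aeval_sum_X {d : ℕ} (S : Finset (Fin d))
    (F : Polynomial ℝ) (x : Fin d → ℝ) :
    eval x (Polynomial.aeval (∑ i ∈ S, (X i : MvPolynomial (Fin d) ℝ)) F)
      = F.eval (∑ i ∈ S, x i) := by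
  rw [← MvPolynomial.coe_aeval_eq_eval, RingHom.coe_coe, ← Polynomial.aeval_algHom_apply]
  simp [Polynomial.aeval_def, Polynomial.eval₂_eq_eval_map]

/-- The probability that a random subset of `Fin d`, containing each element independently with
probability `p`, equals `S`. -/
noncomputable def binomialWeight {d : ℕ} (p : ℝ) (S : Finset (Fin d)) : ℝ :=
  (∏ _i ∈ S, p) * ∏ _i ∈ Sᶜ, (1 - p)

theorem binomialWeight_nonneg {d : ℕ} {p : ℝ} (hp : 0 ≤ p) (hp' : p ≤ 1) (S : Finset (Fin d)) :
    0 ≤ binomialWeight p S :=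
  mul_nonneg (Finset.prod_nonneg fun _ _ => hp) (Finset.prod_nonneg fun _ _ => by linarith)

theorem sum_binomialWeight {d : ℕ} (p : ℝ) : ∑ S : Finset (Fin d), binomialWeight p S = 1 := by
  have := (Fintype.prod_add (fun _ : Fin d => p) (fun _ => 1 - p)).symm
  simpa [binomialWeight] using this

theorem sum_binomialWeight_mul_exp_le {d : ℕ} {p l : ℝ} (hp : 0 ≤ p) (hp' : p ≤ 1)
    (hl : |l| ≤ 1) {x : Fin d → ℝ} (hx : ∀ i, x i = 0 ∨ x i = 1) :
    ∑ S : Finset (Fin d), binomialWeight p S * Real.exp (l * ∑ i ∈ S, x i)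
      ≤ Real.exp (p * (∑ i, x i) * (l + l ^ 2)) := by
  have hp1 : ∀ S : Finset (Fin d), binomialWeight p S * Real.exp (l * ∑ i ∈ S, x i) =
      (∏ i ∈ S, p * Real.exp (l * x i)) * ∏ i ∈ Sᶜ, (1 - p) := by
    intro S
    rw [binomialWeight, Finset.prod_mul_distrib, Finset.mul_sum, Real.exp_sum]
    ring
  simp_rw [hp1]
  rw [← Fintype.prod_add, Finset.mul_sum, Finset.sum_mul, Real.exp_sum]
  refine Finset.prod_le_prod (fun i _ => ?_) fun i _ => ?_
  · have := mul_nonneg hp (Real.exp_pos (l * x i)).le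
    linarith
  · rcases hx i with h | h
    · simp [h]
    · rw [h, mul_one, mul_one]
      have h1 := mul_le_mul_of_nonneg_left
        (abs_le.mp (Real.abs_exp_sub_one_sub_id_le hl)).2 hp
      have h2 := Real.add_one_le_exp (p * (l + l ^ 2))
      linarith

/-- Chernoff's bound. -/
theorem sum_binomialWeight_le {d : ℕ} {p l : ℝ} (hp : 0 ≤ p) (hp' : p ≤ 1) (hl : |l| ≤ 1)
    {x : Fin d → ℝ} (hx : ∀ i, x i = 0 ∨ x i = 1) (c : ℝ) (B : Finset (Finset (Fin d)))
    (hB : ∀ S ∈ B, l * c ≤ l * ∑ i ∈ S, x i) :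
    ∑ S ∈ B, binomialWeight p S ≤ Real.exp (p * (∑ i, x i) * (l + l ^ 2) - l * c) := by
  rw [Real.exp_sub, le_div_iff₀ (Real.exp_pos _), Finset.sum_mul]
  refine le_trans ?_ (sum_binomialWeight_mul_exp_le hp hp' hl hx)
  refine (Finset.sum_le_sum fun S hS => ?_).trans
    (Finset.sum_le_sum_of_subset_of_nonneg B.subset_univ fun S _ _ => ?_)
  · exact mul_le_mul_of_nonneg_left (Real.exp_le_exp.mpr (hB S hS))
      (binomialWeight_nonneg hp hp' S)
  · exact mul_nonneg (binomialWeight_nonneg hp hp' S) (Real.exp_pos _).le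

theorem Finset.sum_union_le_of_nonneg {ι : Type*} [DecidableEq ι] {w : ι → ℝ} (hw : ∀ i, 0 ≤ w i)
    (s t : Finset ι) : ∑ i ∈ s ∪ t, w i ≤ ∑ i ∈ s, w i + ∑ i ∈ t, w i := by
  rw [← Finset.sum_union_inter]
  exact le_add_of_nonneg_right (Finset.sum_nonneg fun i _ => hw i)

/-- There is a finitely supported random polynomial of degree at most `D` which at each Boolean
point `x` satisfies `good x` with probability at least `1 - η`. -/
def HasRandomPolynomial (d : ℕ) (D η : ℝ)
    (good : (Fin d → ℝ) → MvPolynomial (Fin d) ℝ → Prop) : Prop :=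
  ∃ (Ω : Type) (_ : Fintype Ω) (w : Ω → ℝ) (A : Ω → MvPolynomial (Fin d) ℝ),
    (∀ ω, 0 ≤ w ω) ∧ ∑ ω, w ω = 1 ∧ (∀ ω, ((A ω).totalDegree : ℝ) ≤ D) ∧
    ∀ x : Fin d → ℝ, (∀ i, x i = 0 ∨ x i = 1) →
      ∃ B : Finset Ω, ∑ ω ∈ B, w ω ≤ η ∧ ∀ ω ∉ B, good x (A ω)

namespace HasRandomPolynomial

variable {d : ℕ} {D D' η η' : ℝ} {good good' good'' : (Fin d → ℝ) → MvPolynomial (Fin d) ℝ → Prop}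

theorem mono (h : HasRandomPolynomial d D η good) (hD : D ≤ D') (hη : η ≤ η')
    (hg : ∀ x, (∀ i, x i = 0 ∨ x i = 1) → ∀ P, good x P → good' x P) :
    HasRandomPolynomial d D' η' good' := by
  obtain ⟨Ω, _, w, A, hw, hsum, hdeg, h⟩ := h
  refine ⟨Ω, inferInstance, w, A, hw, hsum, fun ω => (hdeg ω).trans hD, fun x hx => ?_⟩
  obtain ⟨B, hB, hgood⟩ := h x hx
  exact ⟨B, hB.trans hη, fun ω hω => hg x hx _ (hgood ω hω)⟩

theorem const (P : MvPolynomial (Fin d) ℝ) (hD : (P.totalDegree : ℝ) ≤ D) (hη : 0 ≤ η)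
    (hg : ∀ x, (∀ i, x i = 0 ∨ x i = 1) → good x P) : HasRandomPolynomial d D η good :=
  ⟨Unit, inferInstance, fun _ => 1, fun _ => P, fun _ => zero_le_one, by simp, fun _ => hD,
    fun x hx => ⟨∅, by simpa using hη, fun _ _ => hg x hx⟩⟩

theorem mul (h : HasRandomPolynomial d D η good) (h' : HasRandomPolynomial d D' η' good')
    (hg : ∀ x, (∀ i, x i = 0 ∨ x i = 1) → ∀ P Q, good x P → good' x Q → good'' x (P * Q)) :
    HasRandomPolynomial d (D + D') (η + η') good'' := by
  classical
  obtain ⟨Ω, _, w, A, hw, hsum, hdeg, h⟩ := h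
  obtain ⟨Ω', _, w', A', hw', hsum', hdeg', h'⟩ := h'
  have hww : ∀ ω : Ω × Ω', 0 ≤ w ω.1 * w' ω.2 := fun ω => mul_nonneg (hw _) (hw' _)
  refine ⟨Ω × Ω', inferInstance, fun ω => w ω.1 * w' ω.2, fun ω => A ω.1 * A' ω.2, hww, ?_,
    fun ω => ?_, fun x hx => ?_⟩
  · rw [Fintype.sum_prod_type]
    simp only [← Finset.mul_sum, hsum', mul_one, hsum]
  · have := MvPolynomial.totalDegree_mul (A ω.1) (A' ω.2)
    have : ((A ω.1 * A' ω.2).totalDegree : ℝ) ≤ (A ω.1).totalDegree + (A' ω.2).totalDegree := by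
      exact_mod_cast this
    linarith [hdeg ω.1, hdeg' ω.2]
  · obtain ⟨B, hB, hgood⟩ := h x hx
    obtain ⟨B', hB', hgood'⟩ := h' x hx
    refine ⟨B ×ˢ Finset.univ ∪ Finset.univ ×ˢ B', ?_, fun ω hω => ?_⟩
    · refine (Finset.sum_union_le_of_nonneg hww _ _).trans (add_le_add ?_ ?_)
      · rw [Finset.sum_product]
        simpa only [← Finset.mul_sum, hsum', mul_one] using hB
      · rw [Finset.sum_product_right]
        simpa only [← Finset.sum_mul, hsum, one_mul] using hB'
    · simp only [Finset.mem_union, Finset.mem_product, Finset.mem_univ, and_true, true_and,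
        not_or] at hω
      exact hg x hx _ _ (hgood _ hω.1) (hgood' _ hω.2)

theorem exists_pmf (h : HasRandomPolynomial d D η good) :
    ∃ μ : PMF (MvPolynomial (Fin d) ℝ), μ.support.Finite ∧
      (∀ P ∈ μ.support, (P.totalDegree : ℝ) ≤ D) ∧
      ∀ x : Fin d → ℝ, (∀ i, x i = 0 ∨ x i = 1) → ∀ S : Set (MvPolynomial (Fin d) ℝ),
        (∀ P, good x P → P ∈ S) → ENNReal.ofReal (1 - η) ≤ μ.toOuterMeasure S := by
  classical
  obtain ⟨Ω, _, w, A, hw, hsum, hdeg, h⟩ := h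
  have h1 : ∑ ω, ENNReal.ofReal (w ω) = 1 := by
    rw [← ENNReal.ofReal_sum_of_nonneg fun ω _ => hw ω, hsum, ENNReal.ofReal_one]
  refine ⟨(PMF.ofFintype _ h1).map A, ?_, fun P hP => ?_, fun x hx S hS => ?_⟩
  · rw [PMF.support_map]
    exact (Set.toFinite _).image _
  · rw [PMF.support_map] at hP
    obtain ⟨ω, -, rfl⟩ := hP
    exact hdeg ω
  · obtain ⟨B, hB, hgood⟩ := h x hx
    rw [PMF.toOuterMeasure_map_apply, PMF.toOuterMeasure_ofFintype_apply, tsum_fintype]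
    have hc : 1 - η ≤ ∑ ω ∈ Bᶜ, w ω := by
      have := Finset.sum_add_sum_compl B w
      linarith
    calc ENNReal.ofReal (1 - η) ≤ ENNReal.ofReal (∑ ω ∈ Bᶜ, w ω) := ENNReal.ofReal_le_ofReal hc
      _ = ∑ ω ∈ Bᶜ, ENNReal.ofReal (w ω) := ENNReal.ofReal_sum_of_nonneg fun ω _ => hw ω
      _ = ∑ ω ∈ Bᶜ, (A ⁻¹' S).indicator (fun ω => ENNReal.ofReal (w ω)) ω := by
          refine Finset.sum_congr rfl fun ω hω => ?_
          rw [Set.indicator_of_mem]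
          exact hS _ (hgood ω (Finset.mem_compl.mp hω))
      _ ≤ _ := Finset.sum_le_sum_of_subset (Finset.subset_univ _)

end HasRandomPolynomial

theorem exists_natCast_eq_sum {d : ℕ} {x : Fin d → ℝ} (hx : ∀ i, x i = 0 ∨ x i = 1)
    (S : Finset (Fin d)) : ∃ n : ℕ, ∑ i ∈ S, x i = n := by
  choose f hf using fun i => show ∃ n : ℕ, x i = n from
    (hx i).elim (fun h => ⟨0, by simp [h]⟩) fun h => ⟨1, by simp [h]⟩
  exact ⟨∑ i ∈ S, f i, by simp [hf]⟩

/-- `P` behaves at `x` like the threshold function at `θ`, with slack `δ` and no control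
below `c`. -/
def IsGate {d : ℕ} (θ c δ : ℝ) (x : Fin d → ℝ) (P : MvPolynomial (Fin d) ℝ) : Prop :=
  (c ≤ ∑ i, x i → ∑ i, x i < θ * (1 - δ) → MvPolynomial.eval x P = 0) ∧
  (c ≤ ∑ i, x i → ∑ i, x i ≤ θ → |MvPolynomial.eval x P| ≤ 1) ∧
  (θ ≤ ∑ i, x i → 1 ≤ |MvPolynomial.eval x P|)

theorem IsGate.mul {d : ℕ} {θ c δ δ' : ℝ} {x : Fin d → ℝ} {P Q : MvPolynomial (Fin d) ℝ}
    (hP : IsGate θ c δ' x P) (hQ : IsGate θ (θ * (1 - δ')) δ x Q) :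
    IsGate θ c δ x (P * Q) := by
  obtain ⟨hP0, hP1, hP2⟩ := hP
  obtain ⟨hQ0, hQ1, hQ2⟩ := hQ
  simp only [IsGate, map_mul, abs_mul]
  refine ⟨fun h h' => ?_, fun h h' => ?_, fun h => one_le_mul_of_one_le_of_one_le (hP2 h) (hQ2 h)⟩
  · rcases lt_or_ge (∑ i, x i) (θ * (1 - δ')) with h1 | h1
    · rw [hP0 h h1, zero_mul]
    · rw [hQ0 h1 h', mul_zero]
  · rcases lt_or_ge (∑ i, x i) (θ * (1 - δ')) with h1 | h1
    · rw [hP0 h h1]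
      simp
    · exact mul_le_one₀ (hP1 h h') (abs_nonneg _) (hQ1 h1 h')

/-- With `t = 2 * √(N * L)`, the number of ones of a random subsample of rate `N / θ` deviates
from its mean in the wrong direction by `t` with probability at most `2 * exp (-L)`. -/
theorem exists_bad_samples {d : ℕ} {θ N L l : ℝ} (hθ : 0 < θ) (hN : 0 < N) (hNθ : N ≤ θ)
    (hl : 0 ≤ l) (hl1 : l ≤ 1) (hlN : N * l ^ 2 = L) {x : Fin d → ℝ}
    (hx : ∀ i, x i = 0 ∨ x i = 1) :
    ∃ B : Finset (Finset (Fin d)), ∑ S ∈ B, binomialWeight (N / θ) S ≤ 2 * Real.exp (-L) ∧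
      ∀ S ∉ B,
        (∑ i, x i ≤ θ → |∑ i ∈ S, x i - N / θ * ∑ i, x i| < 2 * (N * l)) ∧
        (θ ≤ ∑ i, x i → N - 2 * (N * l) < ∑ i ∈ S, x i) := by
  classical
  have hp : 0 ≤ N / θ := by positivity
  have hp' : N / θ ≤ 1 := (div_le_one hθ).mpr hNθ
  have hpθ : N / θ * θ = N := div_mul_cancel₀ N hθ.ne'
  have hlp : |l| ≤ 1 := by rwa [abs_of_nonneg hl]
  have hln : |-l| ≤ 1 := by rwa [abs_neg]
  set p := N / θ
  set σ := ∑ i, x i with hσ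
  rcases le_or_gt σ θ with h | h
  · have hpσ : p * σ ≤ N := by rw [← hpθ]; gcongr
    have hpl : p * σ * l ^ 2 ≤ L := by rw [← hlN]; gcongr
    refine ⟨Finset.univ.filter (fun S => p * σ + 2 * (N * l) ≤ ∑ i ∈ S, x i) ∪
      Finset.univ.filter (fun S => ∑ i ∈ S, x i ≤ p * σ - 2 * (N * l)), ?_, fun S hS => ?_⟩
    · refine (Finset.sum_union_le_of_nonneg (binomialWeight_nonneg hp hp') _ _).trans ?_
      rw [two_mul (Real.exp _)]
      refine add_le_add
        ((sum_binomialWeight_le hp hp' hlp hx (p * σ + 2 * (N * l)) _ fun S hS => ?_).trans ?_)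
        ((sum_binomialWeight_le hp hp' hln hx (p * σ - 2 * (N * l)) _ fun S hS => ?_).trans ?_)
      · exact mul_le_mul_of_nonneg_left (Finset.mem_filter.mp hS).2 hl
      · refine Real.exp_le_exp.mpr ?_
        rw [← hσ]
        nlinarith
      · have := mul_le_mul_of_nonneg_left (Finset.mem_filter.mp hS).2 hl
        linarith
      · refine Real.exp_le_exp.mpr ?_
        rw [← hσ]
        nlinarith
    · simp only [Finset.mem_union, Finset.mem_filter, Finset.mem_univ, true_and, not_or,
        not_le] at hS
      refine ⟨fun _ => abs_lt.mpr ⟨by linarith, by linarith⟩, fun h' => ?_⟩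
      rw [le_antisymm h h', hpθ] at hS
      exact hS.2
  · have hpσ : N ≤ p * σ := by rw [← hpθ]; gcongr
    refine ⟨Finset.univ.filter (fun S => ∑ i ∈ S, x i ≤ N - 2 * (N * l)), ?_, fun S hS => ?_⟩
    · refine (sum_binomialWeight_le hp hp' hln hx (N - 2 * (N * l)) _ fun S hS => ?_).trans ?_
      · have := mul_le_mul_of_nonneg_left (Finset.mem_filter.mp hS).2 hl
        linarith
      · have h1 : Real.exp (p * σ * (-l + (-l) ^ 2) - -l * (N - 2 * (N * l))) ≤
            Real.exp (-L) := by
          refine Real.exp_le_exp.mpr ?_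
          nlinarith [mul_nonneg hl (sub_nonneg.mpr hl1)]
        linarith [Real.exp_pos (-L)]
    · simp only [Finset.mem_filter, Finset.mem_univ, true_and, not_le] at hS
      exact ⟨fun h' => absurd h' h.not_ge, fun _ => hS⟩

/-- A single sampling step reduces the slack of a gate from `δ'` to `δ`. -/
theorem hasRandomPolynomial_isGate_step {d : ℕ} {θ N L l δ δ' : ℝ} (hθ : 0 < θ) (hN : 0 < N)
    (hNθ : N ≤ θ) (hl1 : l ≤ 1) (hlN : N * l ^ 2 = L) (ht : 1 ≤ N * l) (hδ : δ = 6 * l)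
    (hδ' : δ' ≤ 18 * l) :
    HasRandomPolynomial d (36 * (N * l)) (2 * Real.exp (-L)) (IsGate θ (θ * (1 - δ')) δ) := by
  have hl : 0 ≤ l := by
    by_contra! h
    nlinarith
  set b := ⌊N - 2 * (N * l)⌋ with hb
  set m := ⌈18 * (N * l)⌉₊ with hm
  set k := ⌈4 * (N * l)⌉₊ + 1 with hk
  have hb1 : (b : ℝ) ≤ N - 2 * (N * l) := Int.floor_le _
  have hb2 : N - 2 * (N * l) < b + 1 := Int.lt_floor_add_one _
  have hm1 : 18 * (N * l) ≤ m := Nat.le_ceil _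
  have hm2 : (m : ℝ) < 18 * (N * l) + 1 := Nat.ceil_lt_add_one (by linarith)
  have hk1 : 4 * (N * l) + 1 ≤ k := by
    rw [hk]; push_cast; linarith [Nat.le_ceil (4 * (N * l))]
  have hk2 : (k : ℝ) < 4 * (N * l) + 2 := by
    rw [hk]; push_cast; linarith [Nat.ceil_lt_add_one (show 0 ≤ 4 * (N * l) by linarith)]
  obtain ⟨F, hFdeg, hF0, hF1, hF2⟩ := Polynomial.exists_step m k
  have key (y : ℕ) (hy : (b : ℝ) - m ≤ y) : ∃ n : ℕ, (y : ℝ) - (b - m) = n := by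
    have : b - m ≤ (y : ℤ) := by exact_mod_cast hy
    refine ⟨(y - (b - m)).toNat, ?_⟩
    have h := Int.toNat_of_nonneg (sub_nonneg.mpr this)
    have h' : (((y - (b - m)).toNat : ℤ) : ℝ) = ((y - (b - m) : ℤ) : ℝ) := by rw [h]
    push_cast at h'
    exact h'.symm
  refine ⟨Finset (Fin d), inferInstance, binomialWeight (N / θ), fun S =>
    Polynomial.aeval (∑ i ∈ S, MvPolynomial.X i)
      (F.comp (Polynomial.X - Polynomial.C ((b : ℝ) - m))),
    binomialWeight_nonneg (by positivity) ((div_le_one hθ).mpr hNθ), sum_binomialWeight _,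
    fun S => ?_, fun x hx => ?_⟩
  · have h := (MvPolynomial.totalDegree_aeval_sum_X_le S
      (F.comp (Polynomial.X - Polynomial.C ((b : ℝ) - m)))).trans Polynomial.natDegree_comp_le
    rw [Polynomial.natDegree_X_sub_C, mul_one] at h
    have h' := h.trans hFdeg
    refine (Nat.cast_le.mpr h').trans ?_
    push_cast
    linarith
  · obtain ⟨B, hB, hgood⟩ := exists_bad_samples hθ hN hNθ hl hl1 hlN hx
    refine ⟨B, hB, fun S hS => ?_⟩
    obtain ⟨h1, h2⟩ := hgood S hS
    obtain ⟨y, hy⟩ := exists_natCast_eq_sum hx S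
    simp only [IsGate, MvPolynomial.eval_aeval_sum_X, Polynomial.eval_comp, Polynomial.eval_sub,
      Polynomial.eval_X, Polynomial.eval_C]
    rw [hy] at h1 h2 ⊢
    set σ := ∑ i, x i
    have hpθ : N / θ * θ = N := div_mul_cancel₀ N hθ.ne'
    have hlow (h : θ * (1 - δ') ≤ σ) (h' : σ ≤ θ) : (b : ℝ) - m ≤ y := by
      have h3 := (abs_lt.mp (h1 h')).1
      have h4 : N / θ * (θ * (1 - δ')) ≤ N / θ * σ := by gcongr
      rw [← mul_assoc, hpθ] at h4
      nlinarith
    refine ⟨fun h h' => ?_, fun h h' => ?_, fun h => ?_⟩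
    · have hσθ : σ ≤ θ := by nlinarith
      obtain ⟨n, hn⟩ := key y (hlow h hσθ)
      rw [hn]
      refine hF0 n ?_
      have h3 := (abs_lt.mp (h1 hσθ)).2
      have h4 : N / θ * σ ≤ N / θ * (θ * (1 - δ)) := by gcongr
      rw [← mul_assoc, hpθ] at h4
      have : (n : ℝ) < m := by rw [← hn]; nlinarith
      exact_mod_cast this
    · obtain ⟨n, hn⟩ := key y (hlow h h')
      rw [hn]
      rcases lt_or_ge n m with h5 | h5
      · simp [hF0 n h5]
      · rw [hF1 n h5, abs_one]
        have h3 := (abs_lt.mp (h1 h')).2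
        have h4 : N / θ * σ ≤ N / θ * θ := by gcongr
        have : (n : ℝ) ≤ m + k := by rw [← hn]; linarith
        exact_mod_cast this
    · have h3 := h2 h
      have hyb : (b : ℝ) ≤ y := by linarith
      obtain ⟨n, hn⟩ := key y (by linarith [(Nat.cast_nonneg m : (0 : ℝ) ≤ m)])
      rw [hn]
      refine (hF2 n ?_).trans (le_abs_self _)
      have : (m : ℝ) ≤ n := by rw [← hn]; linarith
      exact_mod_cast this

theorem hasRandomPolynomial_isGate {d : ℕ} {θ : ℝ} (n : ℕ) {N L : ℝ} (hN : 0 < N) (hNθ : N ≤ θ)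
    (hL : 1 ≤ L) (hn : N ≤ 36 * 4 ^ n) :
    HasRandomPolynomial d (144 * √(N * L)) (4 * Real.exp (-L)) (IsGate θ 0 (6 * √(L / N))) := by
  have hθ : 0 < θ := hN.trans_le hNθ
  have base {N L : ℝ} (hN : 0 < N) (hNL : N ≤ 36 * L) :
      HasRandomPolynomial d (144 * √(N * L)) (4 * Real.exp (-L)) (IsGate θ 0 (6 * √(L / N))) := by
    refine .const 1 (by simp) (by positivity) fun x _ => ?_
    simp only [IsGate, map_one, one_ne_zero, abs_one, le_refl, implies_true, and_true]
    intro h h'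
    have h1 : (1 / 6 : ℝ) ≤ √(L / N) := by
      refine Real.le_sqrt_of_sq_le ?_
      rw [le_div_iff₀ hN]
      linarith
    nlinarith
  induction n generalizing N L with
  | zero => exact base hN (by linarith)
  | succ n ih =>
    rcases le_or_gt N (36 * L) with hNL | hNL
    · exact base hN hNL
    have ih' := ih (N := N / 4) (L := L + 1) (by positivity) (by linarith) (by linarith)
      (by rw [pow_succ] at hn; linarith)
    have hl1 : √(L / N) ≤ 1 := by
      rw [Real.sqrt_le_one, div_le_one hN]
      linarith
    have hlN : N * √(L / N) ^ 2 = L := by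
      rw [Real.sq_sqrt (by positivity)]
      field_simp
    have hT : N * √(L / N) = √(N * L) := by
      symm
      rw [Real.sqrt_eq_iff_mul_self_eq (by positivity) (by positivity)]
      linear_combination -N * hlN
    have hδ : 6 * √((L + 1) / (N / 4)) ≤ 18 * √(L / N) := by
      have : √((L + 1) / (N / 4)) ≤ 3 * √(L / N) := by
        rw [Real.sqrt_le_left (by positivity), mul_pow, Real.sq_sqrt (by positivity),
          ← mul_div_assoc, div_div_eq_mul_div]
        exact div_le_div_of_nonneg_right (by linarith) hN.le
      linarith
    have hD : √(N / 4 * (L + 1)) ≤ 3 / 4 * √(N * L) := by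
      rw [Real.sqrt_le_left (by positivity), mul_pow, Real.sq_sqrt (by positivity)]
      nlinarith
    have hexp : 4 * Real.exp (-(L + 1)) ≤ 2 * Real.exp (-L) := by
      have h2 : 2 * Real.exp (-1) ≤ 1 := by
        have := Real.add_one_le_exp 1
        have h3 : Real.exp (-1) * Real.exp 1 = 1 := by simp [← Real.exp_add]
        nlinarith [Real.exp_pos (-1)]
      rw [neg_add, Real.exp_add]
      nlinarith [Real.exp_pos (-L)]
    have hT1 : 1 ≤ √(N * L) := by
      rw [Real.one_le_sqrt]
      nlinarith
    have step := hasRandomPolynomial_isGate_step (d := d) hθ hN hNθ hl1 hlN (hT ▸ hT1) rfl hδ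
    rw [hT] at step
    exact (ih'.mul step fun x _ P Q hP hQ => hP.mul hQ).mono (by linarith) (by linarith)
      fun x _ P hP => hP

theorem le_eval_chebyshev_T {s τ x : ℝ} (hs : 0 < s) (hτ : 0 ≤ τ) (k : ℕ)
    (hk : Real.log (2 * s) ≤ k * τ) (hx : Real.cosh τ ≤ x) :
    s ≤ (Polynomial.Chebyshev.T ℝ k).eval x := by
  have hx1 : 1 ≤ x := (Real.one_le_cosh τ).trans hx
  rw [← Real.cosh_arcosh hx1, Polynomial.Chebyshev.T_real_cosh]
  have h1 : τ ≤ Real.arcosh x := by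
    rw [← Real.arcosh_cosh hτ]
    exact (Real.arcosh_le_arcosh (Real.cosh_pos _) (by linarith)).mpr hx
  have h2 : Real.log (2 * s) ≤ k * Real.arcosh x := hk.trans (by gcongr)
  have h3 := (Real.log_le_iff_le_exp (by positivity)).mp h2
  rw [Int.cast_natCast, Real.cosh_eq]
  linarith [Real.exp_pos (-(k * Real.arcosh x))]

/-- The behaviour at `x` required by a polynomial threshold function with threshold `θ`. -/
def IsThreshold {d : ℕ} (θ s ε : ℝ) (x : Fin d → ℝ) (P : MvPolynomial (Fin d) ℝ) : Prop :=
  (∑ i, x i ≤ θ → |MvPolynomial.eval x P| ≤ 1) ∧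
  (θ < ∑ i, x i → |MvPolynomial.eval x P| > 1) ∧
  ((1 + ε) * θ < ∑ i, x i → |MvPolynomial.eval x P| ≥ s)

theorem sum_nonneg_of_boolean {d : ℕ} {x : Fin d → ℝ} (hx : ∀ i, x i = 0 ∨ x i = 1) :
    0 ≤ ∑ i, x i :=
  Finset.sum_nonneg fun i _ => by rcases hx i with h | h <;> simp [h]

/-- A gate for a small threshold becomes a threshold function after multiplication with a
polynomial vanishing on the integers in its slack window. -/
theorem hasRandomPolynomial_isThreshold_of_window {d : ℕ} {θ δ s ε D η : ℝ} (hθ : 0 ≤ θ)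
    (hδ : 0 ≤ δ) (hε : 0 ≤ ε) (hs : 1 < s)
    (h : HasRandomPolynomial d D η (IsGate θ 0 δ)) :
    HasRandomPolynomial d (D + (θ * δ + 1)) η (IsThreshold θ s ε) := by
  set I := Finset.Icc ⌈θ * (1 - δ)⌉ ⌊θ⌋ with hI
  set R : Polynomial ℝ := Polynomial.C s * ∏ j ∈ I, (Polynomial.X - Polynomial.C (j : ℝ)) with hR
  have hReval (y : ℝ) : R.eval y = s * ∏ j ∈ I, (y - j) := by simp [hR, Polynomial.eval_prod]
  have hRdeg : (R.natDegree : ℝ) ≤ θ * δ + 1 := by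
    have h1 : R.natDegree ≤ I.card := by
      refine (Polynomial.natDegree_C_mul_le _ _).trans ((Polynomial.natDegree_prod_le _ _).trans ?_)
      simp only [Polynomial.natDegree_X_sub_C, Finset.sum_const, smul_eq_mul, mul_one, le_refl]
    have h2 : (I.card : ℝ) ≤ θ * δ + 1 := by
      rw [hI, Int.card_Icc]
      rcases le_total 0 (⌊θ⌋ + 1 - ⌈θ * (1 - δ)⌉) with h3 | h3
      · have h4 : (((⌊θ⌋ + 1 - ⌈θ * (1 - δ)⌉).toNat : ℤ) : ℝ) =
            ((⌊θ⌋ + 1 - ⌈θ * (1 - δ)⌉ : ℤ) : ℝ) := by rw [Int.toNat_of_nonneg h3]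
        push_cast at h4
        rw [h4]
        linarith [Int.floor_le θ, Int.le_ceil (θ * (1 - δ))]
      · rw [Int.toNat_of_nonpos h3, Nat.cast_zero]
        positivity
    exact (Nat.cast_le.mpr h1).trans h2
  have hconst : HasRandomPolynomial d (θ * δ + 1) 0
      (fun x P => P = Polynomial.aeval (∑ i, MvPolynomial.X i) R) :=
    .const _ ((Nat.cast_le.mpr (MvPolynomial.totalDegree_aeval_sum_X_le _ R)).trans hRdeg) le_rfl
      fun _ _ => rfl
  refine (h.mul (good'' := IsThreshold θ s ε) hconst ?_).mono le_rfl (by simp) fun x _ P hP => hP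
  rintro x hx P _ ⟨hP0, hP1, hP2⟩ rfl
  have hσ0 := sum_nonneg_of_boolean hx
  simp only [IsThreshold, map_mul, MvPolynomial.eval_aeval_sum_X, hReval]
  obtain ⟨y, hy⟩ := exists_natCast_eq_sum hx Finset.univ
  have hbig (h : θ < ∑ i, x i) :
      s ≤ |MvPolynomial.eval x P * (s * ∏ j ∈ I, (∑ i, x i - j))| := by
    have h1 : 1 ≤ ∏ j ∈ I, (∑ i, x i - (j : ℝ)) := by
      refine Finset.prod_induction _ (fun r : ℝ => 1 ≤ r)
        (fun _ _ => one_le_mul_of_one_le_of_one_le) le_rfl fun j hj => ?_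
      have h2 : ⌊θ⌋ < (y : ℤ) := Int.floor_lt.mpr (by rw [hy] at h; exact_mod_cast h)
      have h3 : j + 1 ≤ (y : ℤ) := by have := (Finset.mem_Icc.mp hj).2; omega
      have h4 : (j : ℝ) + 1 ≤ y := by exact_mod_cast h3
      rw [hy]
      linarith
    have h2 : s ≤ s * ∏ j ∈ I, (∑ i, x i - (j : ℝ)) := le_mul_of_one_le_right (by linarith) h1
    rw [abs_mul]
    exact (h2.trans (le_abs_self _)).trans
      (le_mul_of_one_le_left (abs_nonneg _) (hP2 h.le))
  refine ⟨fun h => ?_, fun h => hs.trans_le (hbig h), fun h => hbig (by nlinarith)⟩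
  rcases lt_or_ge (∑ i, x i) (θ * (1 - δ)) with h1 | h1
  · rw [hP0 hσ0 h1]
    simp
  · have hyI : (y : ℤ) ∈ I := by
      rw [hy] at h h1
      exact Finset.mem_Icc.mpr ⟨Int.ceil_le.mpr (by exact_mod_cast h1),
        Int.le_floor.mpr (by exact_mod_cast h)⟩
    rw [Finset.prod_eq_zero hyI (by rw [hy]; simp)]
    simp

/-- Multiplying a gate with a Chebyshev polynomial scaled to its slack window gives a threshold
function. -/
theorem hasRandomPolynomial_isThreshold_of_chebyshev {d : ℕ} {θ δ s ε τ D η : ℝ} (hθ : 0 < θ)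
    (hδ : 0 < δ) (hε : 0 ≤ ε) (hs : 1 < s) (hτ : 0 ≤ τ) {k : ℕ} (hk : k ≠ 0)
    (hkτ : Real.log (2 * s) ≤ k * τ) (hcosh : Real.cosh τ ≤ 1 + 2 * ε / δ)
    (h : HasRandomPolynomial d D η (IsGate θ 0 δ)) :
    HasRandomPolynomial d (D + k) η (IsThreshold θ s ε) := by
  set R : Polynomial ℝ := (Polynomial.Chebyshev.T ℝ k).comp
    (Polynomial.C (2 / (θ * δ)) * (Polynomial.X - Polynomial.C θ) + Polynomial.C 1) with hR
  have hReval (y : ℝ) : R.eval y =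
      (Polynomial.Chebyshev.T ℝ k).eval (2 / (θ * δ) * (y - θ) + 1) := by
    simp [hR, Polynomial.eval_comp]
  have hRdeg : R.natDegree ≤ k := by
    refine Polynomial.natDegree_comp_le.trans ?_
    rw [Polynomial.Chebyshev.natDegree_T, Int.natAbs_natCast, Polynomial.natDegree_add_C]
    have h1 := Polynomial.natDegree_C_mul_le (2 / (θ * δ)) (Polynomial.X - Polynomial.C θ)
    rw [Polynomial.natDegree_X_sub_C] at h1
    nlinarith
  have hconst : HasRandomPolynomial d k 0
      (fun x P => P = Polynomial.aeval (∑ i, MvPolynomial.X i) R) :=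
    .const _ (Nat.cast_le.mpr ((MvPolynomial.totalDegree_aeval_sum_X_le _ R).trans hRdeg)) le_rfl
      fun _ _ => rfl
  refine (h.mul (good'' := IsThreshold θ s ε) hconst ?_).mono le_rfl (by simp) fun x _ P hP => hP
  rintro x hx P _ ⟨hP0, hP1, hP2⟩ rfl
  have hσ0 := sum_nonneg_of_boolean hx
  simp only [IsThreshold, map_mul, MvPolynomial.eval_aeval_sum_X, hReval, abs_mul]
  set σ := ∑ i, x i
  have hθδ : 0 < θ * δ := mul_pos hθ hδ
  refine ⟨fun h => ?_, fun h => ?_, fun h => ?_⟩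
  · rcases lt_or_ge σ (θ * (1 - δ)) with h1 | h1
    · rw [hP0 hσ0 h1]
      simp
    · refine mul_le_one₀ (hP1 hσ0 h) (abs_nonneg _)
        (Polynomial.Chebyshev.abs_eval_T_real_le_one _ (abs_le.mpr ⟨?_, ?_⟩))
      · have : -2 ≤ 2 / (θ * δ) * (σ - θ) := by
          rw [div_mul_eq_mul_div, le_div_iff₀ hθδ]
          linarith
        linarith
      · have := mul_nonneg (div_nonneg zero_le_two hθδ.le) (sub_nonneg.mpr h)
        linarith
  · have h1 := Polynomial.Chebyshev.one_lt_eval_T_real (n := k) (by exact_mod_cast hk)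
      (x := 2 / (θ * δ) * (σ - θ) + 1)
      (lt_add_of_pos_left _ (mul_pos (by positivity) (sub_pos.mpr h)))
    exact (h1.trans_le (le_abs_self _)).trans_le (le_mul_of_one_le_left (abs_nonneg _) (hP2 h.le))
  · have hle : θ ≤ σ := by nlinarith
    refine le_trans ?_ (le_mul_of_one_le_left (abs_nonneg _) (hP2 hle))
    refine (le_eval_chebyshev_T (by linarith) hτ k hkτ (hcosh.trans ?_)).trans (le_abs_self _)
    have : 2 * ε / δ = 2 / (θ * δ) * ((1 + ε) * θ - θ) := by field_simp; ring
    rw [this, add_comm]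
    gcongr

theorem cosh_half_le {e : ℝ} (he : 0 ≤ e) (he1 : e ≤ 1) :
    Real.cosh (e / 2) ≤ 1 + e ^ 2 / 3 := by
  have h1 : |(e / 2) ^ 2 / 2| ≤ 1 := by
    rw [abs_of_nonneg (by positivity)]
    nlinarith
  have h2 := (abs_le.mp (Real.abs_exp_sub_one_sub_id_le h1)).2
  have h3 : (e ^ 2) ^ 2 ≤ e ^ 2 := pow_le_of_le_one (sq_nonneg e) (by nlinarith) two_ne_zero
  nlinarith [Real.cosh_le_exp_half_sq (e / 2), sq_nonneg e]

theorem hasRandomPolynomial_isThreshold (d : ℕ) {θ s e : ℝ} (hθ : 1 ≤ θ) (hs : 2 ≤ s)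
    (he : 0 < e) (he1 : e ≤ 1) :
    HasRandomPolynomial d (700 * e⁻¹ * Real.log s) (1 / s) (IsThreshold θ s (e ^ 3)) := by
  set L := Real.log s + 2 with hL
  have hlog2 : 0.69 < Real.log s :=
    (by linarith [Real.log_two_gt_d9] : 0.69 < Real.log 2).trans_le
      (Real.log_le_log two_pos hs)
  have hL4 : L ≤ 4 * Real.log s := by linarith
  have hL1 : 1 ≤ L := by linarith
  have hη : 4 * Real.exp (-L) ≤ 1 / s := by
    rw [hL, neg_add, Real.exp_add, Real.exp_neg, Real.exp_log (by linarith), one_div]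
    have h1 : 4 * Real.exp (-2) ≤ 1 := by
      have h2 : Real.exp (-2) * Real.exp 2 = 1 := by simp [← Real.exp_add]
      have h3 : Real.exp 2 = Real.exp 1 * Real.exp 1 := by rw [← Real.exp_add]; norm_num
      have h4 := Real.add_one_le_exp 1
      have h5 : 4 ≤ Real.exp 2 := by nlinarith
      nlinarith [Real.exp_pos (-2)]
    have : 0 < s⁻¹ := by positivity
    nlinarith
  have hinv : 1 ≤ e⁻¹ := (one_le_inv₀ he).mpr he1
  have hT : L ≤ e⁻¹ * L := le_mul_of_one_le_left (by linarith) hinv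
  have hfin : 175 * (e⁻¹ * L) ≤ 700 * e⁻¹ * Real.log s := by
    have := mul_le_mul_of_nonneg_left hL4 (by positivity : 0 ≤ e⁻¹)
    linarith
  have gate {N : ℝ} (hN : 0 < N) (hNθ : N ≤ θ) :
      HasRandomPolynomial d (144 * √(N * L)) (4 * Real.exp (-L)) (IsGate θ 0 (6 * √(L / N))) := by
    obtain ⟨n, hn⟩ := pow_unbounded_of_one_lt N (by norm_num : (1 : ℝ) < 4)
    exact hasRandomPolynomial_isGate n hN hNθ hL1 (by linarith)
  rcases le_or_gt θ (L / e ^ 2) with h | h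
  · have hsqrt : √(θ * L) ≤ e⁻¹ * L := by
      rw [Real.sqrt_le_left (by positivity), mul_pow, inv_pow]
      calc θ * L ≤ L / e ^ 2 * L := by gcongr
        _ = _ := by field_simp
    have hwin : θ * (6 * √(L / θ)) = 6 * √(θ * L) := by
      have h1 : √(θ * L) = θ * √(L / θ) := by
        rw [Real.sqrt_eq_iff_mul_self_eq (by positivity) (by positivity), mul_mul_mul_comm,
          Real.mul_self_sqrt (by positivity)]
        field_simp
      rw [h1]
      ring
    refine (hasRandomPolynomial_isThreshold_of_window (by linarith) (by positivity)
      (by positivity) (by linarith) (gate (by linarith) le_rfl)).mono ?_ hη fun x _ P hP => hP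
    rw [hwin]
    linarith
  · have hδ : 6 * √(L / (L / e ^ 2)) = 6 * e := by
      rw [div_div_cancel₀ (by linarith), Real.sqrt_sq he.le]
    have hsqrt : √(L / e ^ 2 * L) = e⁻¹ * L := by
      rw [Real.sqrt_eq_iff_mul_self_eq (by positivity) (by positivity)]
      field_simp
    have g := gate (by positivity) h.le
    rw [hδ, hsqrt] at g
    have hk1 : 2 * (e⁻¹ * L) ≤ ⌈2 * (e⁻¹ * L)⌉₊ := Nat.le_ceil _
    have hk2 := Nat.ceil_lt_add_one (by positivity : 0 ≤ 2 * (e⁻¹ * L))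
    refine (hasRandomPolynomial_isThreshold_of_chebyshev (s := s) (ε := e ^ 3) (τ := e / 2)
      (k := ⌈2 * (e⁻¹ * L)⌉₊) (by linarith) (by positivity) (by positivity) (by linarith)
      (by positivity) (Nat.ceil_pos.mpr (by positivity)).ne' ?_ ?_ g).mono ?_ hη fun x _ P hP => hP
    · have h1 : Real.log (2 * s) ≤ L := by
        rw [Real.log_mul two_ne_zero (by linarith)]
        linarith [Real.log_two_lt_d9]
      have h2 : 2 * (e⁻¹ * L) * (e / 2) = L := by field_simp
      have h3 := mul_le_mul_of_nonneg_right hk1 (by positivity : 0 ≤ e / 2)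
      linarith
    · refine (cosh_half_le he.le he1).trans_eq ?_
      field_simp
      ring
    · linarith

theorem hasRandomPolynomial_isThreshold_of_le_two (d : ℕ) {θ s ε D : ℝ} (hθ : 0 ≤ θ)
    (hε : 0 ≤ ε) (hs : 1 < s) (hs2 : s ≤ 2) (hD : 0 ≤ D) :
    HasRandomPolynomial d D (1 / s) (IsThreshold θ s ε) := by
  have hη : 1 / 2 ≤ 1 / s := one_div_le_one_div_of_le (by linarith) hs2
  refine ⟨Bool, inferInstance, fun _ => 1 / 2, fun b => if b then MvPolynomial.C s else 0,
    fun _ => by norm_num, by simp, fun b => by cases b <;> simpa using hD, fun x _ => ?_⟩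
  rcases le_or_gt (∑ i, x i) θ with h | h
  · refine ⟨{true}, by simpa using hη, fun b hb => ?_⟩
    obtain rfl : b = false := by simpa using hb
    exact ⟨fun _ => by simp, fun h' => absurd h h'.not_ge, fun h' => by nlinarith⟩
  · refine ⟨{false}, by simpa using hη, fun b hb => ?_⟩
    obtain rfl : b = true := by simpa using hb
    have : |s| = s := abs_of_pos (by linarith)
    exact ⟨fun h' => absurd h h'.not_gt, fun _ => by simpa [this] using hs,
      fun _ => by simp [this]⟩

/-- **Probabilistic polynomial threshold functions (Alman–Chan–Williams).** There is a
universal constant `C > 0` such that for every dimension `d ≥ 1`, every `θ ≥ 1`, `s > 1` and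
`ε ∈ (0,1)`, there is a finitely supported distribution `μ` over real polynomials in `d`
variables of total degree at most `C·ε^{−1/3}·log s` such that for every `x ∈ {0,1}^d`:
(i) if `∑ᵢ xᵢ ≤ θ` then `|P(x)| ≤ 1` with probability `≥ 1 − 1/s`;
(ii) if `θ < ∑ᵢ xᵢ < (1+ε)θ` then `|P(x)| > 1` with probability `≥ 1 − 1/s`;
(iii) if `∑ᵢ xᵢ > (1+ε)θ` then `|P(x)| ≥ s` with probability `≥ 1 − 1/s`. -/
theorem probabilistic_polynomial_threshold :
    ∃ C : ℝ, 0 < C ∧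
      ∀ (d : ℕ), 1 ≤ d → ∀ (θ s ε : ℝ), 1 ≤ θ → 1 < s → ε ∈ Set.Ioo (0 : ℝ) 1 →
        ∃ μ : PMF (MvPolynomial (Fin d) ℝ),
          μ.support.Finite ∧
          (∀ P ∈ μ.support, (P.totalDegree : ℝ) ≤ C * ε ^ (-(1/3 : ℝ)) * Real.log s) ∧
          ∀ x : Fin d → ℝ, (∀ i, x i = 0 ∨ x i = 1) →
            ((∑ i, x i ≤ θ →
              μ.toOuterMeasure {P | |MvPolynomial.eval x P| ≤ 1}
                ≥ ENNReal.ofReal (1 - 1 / s)) ∧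
             (θ < ∑ i, x i → ∑ i, x i < (1 + ε) * θ →
              μ.toOuterMeasure {P | |MvPolynomial.eval x P| > 1}
                ≥ ENNReal.ofReal (1 - 1 / s)) ∧
             ((1 + ε) * θ < ∑ i, x i →
              μ.toOuterMeasure {P | |MvPolynomial.eval x P| ≥ s}
                ≥ ENNReal.ofReal (1 - 1 / s))) := by
  refine ⟨700, by norm_num, fun d _ θ s ε hθ hs hε => ?_⟩
  have h : HasRandomPolynomial d (700 * ε ^ (-(1/3 : ℝ)) * Real.log s) (1 / s)
      (IsThreshold θ s ε) := by
    rcases le_total s 2 with hs2 | hs2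
    · have := Real.log_pos hs
      have := Real.rpow_nonneg hε.1.le (-(1/3 : ℝ))
      exact hasRandomPolynomial_isThreshold_of_le_two d (by linarith) hε.1.le hs hs2
        (by positivity)
    · have h1 : (ε ^ (1/3 : ℝ)) ^ 3 = ε := by
        rw [← Real.rpow_natCast, ← Real.rpow_mul hε.1.le]
        norm_num
      have h2 := hasRandomPolynomial_isThreshold d hθ hs2 (Real.rpow_pos_of_pos hε.1 (1/3))
        (Real.rpow_le_one hε.1.le hε.2.le (by norm_num))
      rwa [h1, ← Real.rpow_neg hε.1.le] at h2
  obtain ⟨μ, hfin, hdeg, hμ⟩ := h.exists_pmf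
  exact ⟨μ, hfin, hdeg, fun x hx =>
    ⟨fun h => hμ x hx _ fun P hP => hP.1 h, fun h _ => hμ x hx _ fun P hP => hP.2.1 h,
      fun h => hμ x hx _ fun P hP => hP.2.2 h⟩⟩
end

section
/- There exist universal constants K > 0 and c₀ ∈ (0,1) such that the following holds for every integer d ≥ 4, every ε ∈ (0,1), and every finite set P ⊂ ℝ^d of n ≥ 1 points. At least one of the two alternatives holds: (1) there exists x ∈ ℝ^d such that the ℓ∞-ball of radius K·(log log d)/ε centered at x contains at least c₀·n points of P; or (2) there exist a coordinate i ∈ {1,…,d} and a threshold u ∈ ℝ such that, setting A = {p ∈ P : p_i < u − 1}, B = {p ∈ P : u − 1 ≤ p_i ≤ u + 1}, and C = {p ∈ P : p_i > u + 1}, one has ((|A| + |B|)/n)^{1+ε} + ((|B| + |C|)/n)^{1+ε} ≤ 1, and moreover |A|/n ≥ c₀/d and |C|/n ≥ c₀/d. -/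
open Finset

namespace BalancedCut

variable {α : Type*}

/-- The level `u` is a balanced cut of `P` along `f`: the two overlapping sides `f ≤ u + 1` and
`u - 1 ≤ f` satisfy the replication bound, and each strict side has density at least `δ`. -/
def IsBalancedCut (P : Finset α) (f : α → ℝ) (ε δ u : ℝ) : Prop :=
  letI a : ℝ := (P.filter (fun p => f p < u - 1)).card
  letI b : ℝ := (P.filter (fun p => u - 1 ≤ f p ∧ f p ≤ u + 1)).card
  letI c : ℝ := (P.filter (fun p => u + 1 < f p)).card
  ((a + b) / P.card) ^ (1 + ε) + ((b + c) / P.card) ^ (1 + ε) ≤ 1 ∧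
    δ ≤ a / P.card ∧ δ ≤ c / P.card

lemma IsBalancedCut.of_neg {P : Finset α} {f : α → ℝ} {ε δ u : ℝ}
    (h : IsBalancedCut P (fun p => -f p) ε δ u) : IsBalancedCut P f ε δ (-u) := by
  have e₁ : ∀ p, (-f p < u - 1) ↔ (-u + 1 < f p) := fun p => by
    constructor <;> intro h <;> linarith
  have e₂ : ∀ p, (u - 1 ≤ -f p ∧ -f p ≤ u + 1) ↔ (-u - 1 ≤ f p ∧ f p ≤ -u + 1) := fun p => by
    constructor <;> rintro ⟨h, h'⟩ <;> constructor <;> linarith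
  have e₃ : ∀ p, (u + 1 < -f p) ↔ (f p < -u - 1) := fun p => by
    constructor <;> intro h <;> linarith
  simp only [IsBalancedCut, e₁, e₂, e₃] at h ⊢
  obtain ⟨h₁, h₂, h₃⟩ := h
  refine ⟨?_, h₃, h₂⟩
  rw [add_comm] at h₁
  convert h₁ using 4 <;> ring

lemma exists_median {P : Finset α} (hP : P.Nonempty) (f : α → ℝ) :
    ∃ m : ℝ, P.card ≤ 2 * (P.filter (fun p => f p ≤ m)).card ∧
      P.card ≤ 2 * (P.filter (fun p => m ≤ f p)).card := by
  obtain ⟨q, hq, hmax⟩ := P.exists_max_image f hP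
  have hne : (P.filter fun q => P.card ≤ 2 * (P.filter fun p => f p ≤ f q).card).Nonempty := by
    refine ⟨q, mem_filter.2 ⟨hq, ?_⟩⟩
    rw [filter_true_of_mem hmax]
    omega
  obtain ⟨r, hr, hmin⟩ := exists_min_image _ f hne
  refine ⟨f r, (mem_filter.1 hr).2, ?_⟩
  by_contra! hlt
  have hsplit := card_filter_add_card_filter_not (s := P) (fun p => f r ≤ f p)
  simp only [not_le] at hsplit
  have hne' : (P.filter fun p => f p < f r).Nonempty := by
    rw [← card_pos]
    omega
  obtain ⟨s, hs, hsmax⟩ := exists_max_image _ f hne'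
  have hs' := mem_filter.1 hs
  have hsub : (P.filter fun p => f p < f r) ⊆ P.filter fun p => f p ≤ f s := fun p hp =>
    mem_filter.2 ⟨(mem_filter.1 hp).1, hsmax p hp⟩
  have := card_le_card hsub
  exact absurd (hmin s (mem_filter.2 ⟨hs'.1, by omega⟩)) (not_le.2 hs'.2)

/-- Without a balanced cut, a tail of density at most `1/2` shrinks to a `(1 + ε)`-th power, or
below density `δ`, whenever the level grows by `3`. -/
lemma tail_step {P : Finset α} (hP : P.Nonempty) {f : α → ℝ} {ε δ m t : ℝ} (hε : 0 ≤ ε)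
    (hδ : δ ≤ 1 / 2) (hm : P.card ≤ 2 * (P.filter (fun p => f p ≤ m)).card) (ht : m ≤ t)
    (hcut : ∀ u, ¬ IsBalancedCut P f ε δ u)
    (hc : δ ≤ ((P.filter fun p => t + 3 < f p).card : ℝ) / P.card) :
    ((P.filter fun p => t + 3 < f p).card : ℝ) / P.card ≤
      (((P.filter fun p => t < f p).card : ℝ) / P.card) ^ (1 + ε) := by
  classical
  by_contra! hlt
  have hn : (0 : ℝ) < P.card := by exact_mod_cast hP.card_pos
  refine hcut (t + 2) ?_
  have e : ∀ p, (t + 2 + 1 < f p) ↔ (t + 3 < f p) := fun p => by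
    constructor <;> intro h <;> linarith
  simp only [IsBalancedCut, e]
  set A := P.filter fun p => f p < t + 2 - 1
  set B := P.filter fun p => t + 2 - 1 ≤ f p ∧ f p ≤ t + 2 + 1
  set C := P.filter fun p => t + 3 < f p
  have hBC : (B.card : ℝ) + C.card ≤ (P.filter fun p => t < f p).card := by
    have hd : Disjoint B C := disjoint_filter.2 fun p _ h h' => by linarith [h.2]
    rw [← Nat.cast_add, ← card_union_of_disjoint hd]
    refine Nat.cast_le.2 (card_le_card ?_)
    intro p hp
    simp only [B, C, mem_union, mem_filter] at hp ⊢
    rcases hp with ⟨h, h'⟩ | ⟨h, h'⟩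
    · exact ⟨h, by linarith [h'.1]⟩
    · exact ⟨h, by linarith⟩
  have hABC : (A.card : ℝ) + B.card + C.card ≤ P.card := by
    have hd : Disjoint A B := disjoint_filter.2 fun p _ h h' => by linarith [h'.1]
    have hd' : Disjoint (A ∪ B) C := disjoint_left.2 fun p h h' => by
      simp only [A, B, C, mem_union, mem_filter] at h h'
      rcases h with h | h
      · linarith [h.2, h'.2]
      · linarith [h.2.2, h'.2]
    rw [← Nat.cast_add, ← Nat.cast_add, ← card_union_of_disjoint hd,
      ← card_union_of_disjoint hd']
    refine Nat.cast_le.2 (card_le_card ?_)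
    exact union_subset (union_subset (filter_subset _ _) (filter_subset _ _)) (filter_subset _ _)
  have hA : (1 : ℝ) / 2 ≤ A.card / P.card := by
    have hsub : (P.filter fun p => f p ≤ m) ⊆ A := fun p hp => by
      simp only [A, mem_filter] at hp ⊢
      exact ⟨hp.1, by linarith [hp.2]⟩
    have h := card_le_card hsub
    have h' : (P.card : ℝ) ≤ 2 * A.card := by exact_mod_cast hm.trans (by omega)
    rw [div_le_div_iff₀ two_pos hn]
    linarith
  refine ⟨?_, hδ.trans hA, hc⟩
  have hAB : ((A.card : ℝ) + B.card) / P.card ≤ 1 - C.card / P.card := by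
    rw [le_sub_iff_add_le, ← add_div, div_le_one hn]
    exact hABC
  have h₁ : (((A.card : ℝ) + B.card) / P.card) ^ (1 + ε) ≤ 1 - C.card / P.card := by
    refine le_trans ?_ hAB
    refine Real.rpow_le_self_of_le_one (by positivity) (hAB.trans ?_) (by linarith)
    linarith [show (0 : ℝ) ≤ C.card / P.card by positivity]
  have h₂ : (((B.card : ℝ) + C.card) / P.card) ^ (1 + ε) ≤ C.card / P.card :=
    (Real.rpow_le_rpow (by positivity) (by gcongr) (by linarith)).trans hlt.le
  linarith

lemma tail_le {P : Finset α} (hP : P.Nonempty) {f : α → ℝ} {ε δ m : ℝ} (hε : 0 ≤ ε)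
    (hδ : δ ≤ 1 / 2) (hm : P.card ≤ 2 * (P.filter (fun p => f p ≤ m)).card)
    (hcut : ∀ u, ¬ IsBalancedCut P f ε δ u) (k : ℕ) :
    ((P.filter fun p => m + 3 * k < f p).card : ℝ) / P.card ≤
      max δ ((1 / 2 : ℝ) ^ ((1 + ε) ^ k)) := by
  have hn : (0 : ℝ) < P.card := by exact_mod_cast hP.card_pos
  induction k with
  | zero =>
    refine le_max_of_le_right ?_
    have hsplit := card_filter_add_card_filter_not (s := P) (fun p => f p ≤ m)
    simp only [not_le] at hsplit
    have h : 2 * (P.filter fun p => m < f p).card ≤ P.card := by omega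
    have h' : (2 : ℝ) * (P.filter fun p => m < f p).card ≤ P.card := by exact_mod_cast h
    simp only [Nat.cast_zero, mul_zero, add_zero, pow_zero, Real.rpow_one]
    rw [div_le_div_iff₀ hn two_pos]
    linarith
  | succ k ih =>
    have e : m + 3 * ((k + 1 : ℕ) : ℝ) = m + 3 * k + 3 := by push_cast; ring
    rw [e]
    rcases le_total (((P.filter fun p => m + 3 * k + 3 < f p).card : ℝ) / P.card) δ with hc | hc
    · exact le_max_of_le_left hc
    rcases le_max_iff.1 ih with h | h
    · refine le_max_of_le_left (le_trans ?_ h)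
      refine div_le_div_of_nonneg_right (Nat.cast_le.2 (card_le_card ?_)) hn.le
      exact monotone_filter_right P fun p _ hp => by linarith
    · refine le_max_of_le_right ((tail_step hP hε hδ hm ?_ hcut hc).trans ?_)
      · linarith [show (0 : ℝ) ≤ 3 * k by positivity]
      · rw [pow_succ, Real.rpow_mul (by norm_num)]
        exact Real.rpow_le_rpow (by positivity) h (by linarith)

lemma one_le_four_mul_log_log {x : ℝ} (hx : 4 ≤ x) : 1 ≤ 4 * Real.log (Real.log x) := by
  have h4 : (4 : ℝ) / 3 ≤ Real.log x := by
    have h := Real.log_le_log (by norm_num) hx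
    rw [show (4 : ℝ) = 2 ^ 2 by norm_num, Real.log_pow] at h
    push_cast at h
    linarith [Real.log_two_gt_d9]
  have h := Real.one_sub_inv_le_log_of_pos (show 0 < Real.log x by linarith)
  have h' := inv_anti₀ (by norm_num) h4
  norm_num at h'
  linarith

lemma exists_iteration_count {d ε : ℝ} (hd : 4 ≤ d) (hε : ε ∈ Set.Ioo (0 : ℝ) 1) :
    ∃ k : ℕ, (3 * k : ℝ) ≤ 54 * Real.log (Real.log d) / ε ∧
      (1 / 2 : ℝ) ^ ((1 + ε) ^ k) ≤ 1 / 4 / d := by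
  obtain ⟨hε₀, hε₁⟩ := hε
  have hL := one_le_four_mul_log_log hd
  set L := Real.log (Real.log d) with hLdef
  have hlog4 : Real.log 4 = 2 * Real.log 2 := by
    rw [show (4 : ℝ) = 2 ^ 2 by norm_num, Real.log_pow]
    norm_num
  have hlog2 := Real.log_two_gt_d9
  have hlog2' := Real.log_two_lt_d9
  have hlogd : Real.log 4 ≤ Real.log d := Real.log_le_log (by norm_num) hd
  refine ⟨⌈14 * L / ε⌉₊, ?_, ?_⟩
  · have h := (Nat.ceil_lt_add_one (show 0 ≤ 14 * L / ε by
      apply div_nonneg <;> linarith)).le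
    have h₁ : 1 ≤ 4 * L / ε := by
      rw [le_div_iff₀ hε₀]
      linarith
    calc (3 * ⌈14 * L / ε⌉₊ : ℝ) ≤ 3 * (14 * L / ε + 4 * L / ε) := by linarith
      _ = 54 * L / ε := by ring
  · set k := ⌈14 * L / ε⌉₊
    have hk : 14 * L ≤ k * ε := (div_le_iff₀ hε₀).1 (Nat.le_ceil _)
    have hlogε : ε / 2 ≤ Real.log (1 + ε) := by
      refine le_trans ?_ (Real.le_log_one_add_of_nonneg hε₀.le)
      rw [div_le_div_iff₀ two_pos (by linarith)]
      nlinarith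
    have hpow : 4 * Real.log d ≤ (1 + ε) ^ k := by
      have hld : 0 < Real.log d := by linarith
      rw [← Real.log_le_log_iff (by positivity) (by positivity), Real.log_pow,
        Real.log_mul (by norm_num) hld.ne', ← hLdef]
      have := mul_le_mul_of_nonneg_left hlogε (Nat.cast_nonneg k)
      linarith
    rw [← Real.log_le_log_iff (by positivity) (by positivity), Real.log_rpow (by norm_num),
      div_div, one_div, one_div, Real.log_inv, Real.log_inv,
      Real.log_mul (by norm_num) (by linarith)]
    nlinarith

end BalancedCut

open BalancedCut

/-- **Indyk's structural lemma for ANN over `ℓ∞`.** There are universal constants `K > 0`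
and `c₀ ∈ (0,1)` such that for every `d ≥ 4`, `ε ∈ (0,1)` and every finite set `P` of
`n ≥ 1` points in `ℝ^d`, either (1) some `ℓ∞`-ball of radius `K·(log log d)/ε` contains at
least `c₀·n` points of `P`, or (2) there are a coordinate `i` and a threshold `u ∈ ℝ` such
that, with `A = {p ∈ P : pᵢ < u − 1}`, `B = {p ∈ P : u − 1 ≤ pᵢ ≤ u + 1}` and
`C = {p ∈ P : pᵢ > u + 1}`, one has
`((|A|+|B|)/n)^{1+ε} + ((|B|+|C|)/n)^{1+ε} ≤ 1`, `|A|/n ≥ c₀/d` and `|C|/n ≥ c₀/d`. -/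
theorem indyk_linfty_structural_lemma :
    ∃ K c₀ : ℝ, 0 < K ∧ c₀ ∈ Set.Ioo (0 : ℝ) 1 ∧
      ∀ (d : ℕ), 4 ≤ d → ∀ (ε : ℝ), ε ∈ Set.Ioo (0 : ℝ) 1 →
        ∀ (P : Finset (Fin d → ℝ)) (n : ℕ), P.card = n → 1 ≤ n →
          (∃ x : Fin d → ℝ,
            (c₀ * n : ℝ) ≤
              (P.filter (fun p => ∀ i, |p i - x i| ≤ K * Real.log (Real.log d) / ε)).card) ∨
          (∃ (i : Fin d) (u : ℝ),
            letI a : ℝ := (P.filter (fun p => p i < u - 1)).card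
            letI b : ℝ := (P.filter (fun p => u - 1 ≤ p i ∧ p i ≤ u + 1)).card
            letI c : ℝ := (P.filter (fun p => u + 1 < p i)).card
            ((a + b) / n) ^ (1 + ε) + ((b + c) / n) ^ (1 + ε) ≤ 1 ∧
              c₀ / d ≤ a / n ∧ c₀ / d ≤ c / n) := by
  refine ⟨54, 1 / 4, by norm_num, by norm_num, ?_⟩
  rintro d hd ε hε P n rfl hn
  have hd' : (4 : ℝ) ≤ d := by exact_mod_cast hd
  have hP : P.Nonempty := card_pos.1 hn
  have hn' : (0 : ℝ) < P.card := by exact_mod_cast hn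
  rw [or_iff_not_imp_right]
  intro hcut
  have hcut₁ : ∀ (i : Fin d) u, ¬ IsBalancedCut P (fun p => p i) ε (1 / 4 / d) u :=
    fun i u h => hcut ⟨i, u, h⟩
  have hcut₂ : ∀ (i : Fin d) u, ¬ IsBalancedCut P (fun p => -p i) ε (1 / 4 / d) u :=
    fun i u h => hcut₁ i (-u) h.of_neg
  choose x hx₁ hx₂ using fun i : Fin d => exists_median hP (fun p => p i)
  obtain ⟨k, hk, hkd⟩ := exists_iteration_count hd' hε
  have hδ : 1 / 4 / (d : ℝ) ≤ 1 / 2 := by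
    rw [div_le_iff₀ (by linarith)]
    linarith
  refine ⟨x, ?_⟩
  set R := 54 * Real.log (Real.log d) / ε
  have hup : ∀ i, ((P.filter fun p => x i + 3 * k < p i).card : ℝ) ≤ 1 / 4 / d * P.card := by
    intro i
    have h := tail_le hP hε.1.le hδ (hx₁ i) (hcut₁ i) k
    rwa [max_eq_left hkd, div_le_iff₀ hn'] at h
  have hdown : ∀ i, ((P.filter fun p => -x i + 3 * k < -p i).card : ℝ) ≤ 1 / 4 / d * P.card := by
    intro i
    have h := tail_le hP (m := -x i) hε.1.le hδ (by simpa using hx₂ i) (hcut₂ i) k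
    rwa [max_eq_left hkd, div_le_iff₀ hn'] at h
  have hcover : (P.filter fun p => ¬ ∀ i, |p i - x i| ≤ R) ⊆
      univ.biUnion fun i => (P.filter fun p => x i + 3 * k < p i) ∪
        P.filter fun p => -x i + 3 * k < -p i := by
    intro p hp
    obtain ⟨hpP, hp⟩ := mem_filter.1 hp
    push Not at hp
    obtain ⟨i, hi⟩ := hp
    simp only [mem_biUnion, mem_univ, true_and, mem_union, mem_filter]
    rcases lt_abs.1 hi with h | h
    · exact ⟨i, Or.inl ⟨hpP, by linarith⟩⟩
    · exact ⟨i, Or.inr ⟨hpP, by linarith⟩⟩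
  have hout : ((P.filter fun p => ¬ ∀ i, |p i - x i| ≤ R).card : ℝ) ≤ 1 / 2 * P.card :=
    calc ((P.filter fun p => ¬ ∀ i, |p i - x i| ≤ R).card : ℝ)
        ≤ ∑ i : Fin d, (((P.filter fun p => x i + 3 * k < p i).card : ℝ) +
            (P.filter fun p => -x i + 3 * k < -p i).card) := by
          exact_mod_cast ((card_le_card hcover).trans card_biUnion_le).trans
            (sum_le_sum fun i _ => card_union_le _ _)
      _ ≤ ∑ _i : Fin d, (1 / 4 / d * P.card + 1 / 4 / d * P.card : ℝ) :=
          sum_le_sum fun i _ => add_le_add (hup i) (hdown i)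
      _ = 1 / 2 * P.card := by
          have : (d : ℝ) ≠ 0 := by linarith
          simp only [sum_const, card_univ, Fintype.card_fin, nsmul_eq_mul]
          field_simp
          norm_num
  have hsplit : ((P.filter fun p => ∀ i, |p i - x i| ≤ R).card : ℝ) +
      (P.filter fun p => ¬ ∀ i, |p i - x i| ≤ R).card = P.card := by
    exact_mod_cast card_filter_add_card_filter_not (s := P) (fun p => ∀ i, |p i - x i| ≤ R)
  linarith
end
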